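/- arXiv:1702.04529 — 3 statements merged into one kernel-verified Lean document; each statement's English description precedes it below -/
import Mathlib

section
/- Let SB_n denote the number of semi-Baxter permutations of size n. Let λ = (√5 − 1)/2, μ = (11 + 5√5)/2, and A = (12/π)·5^{−1/4}·λ^{−15/2}. Then the sequence SB_n·n⁶/μⁿ converges to A as n → ∞; in other words, SB_n ∼ A·μⁿ/n⁶. (Corollary 3.17.) -/
/-- `f` contains the vincular pattern 2-41-3: there are positions
`i < j` and `k > j+1` with `f (j+1) < f i < f k < f j`. -/
def Contains2413 {m : ℕ} (f : Fin m → Fin m) : Prop :=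
  ∃ i j j' k : Fin m, (i : ℕ) < (j : ℕ) ∧ (j' : ℕ) = (j : ℕ) + 1 ∧ (j' : ℕ) < (k : ℕ) ∧
    f j' < f i ∧ f i < f k ∧ f k < f j

/-- A semi-Baxter permutation avoids 2-41-3. -/
def IsSemiBaxter {n : ℕ} (π : Equiv.Perm (Fin n)) : Prop := ¬ Contains2413 ⇑π

/-- The number of semi-Baxter permutations of size `n`. -/
noncomputable def semiBaxterCount (n : ℕ) : ℕ :=
  Nat.card {π : Equiv.Perm (Fin n) // IsSemiBaxter π}

open Real Filter

namespace SemiBaxter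

section

open LaurentPolynomial

/-! ### Laurent polynomials in two variables and their constant terms -/

/-- Laurent polynomials in `y` whose coefficients are Laurent polynomials in `x`. -/
abbrev LaurentTwo := LaurentPolynomial (LaurentPolynomial ℂ)

theorem coeff_mul_T {R : Type*} [Semiring R] (f : LaurentPolynomial R) (n k : ℤ) :
    (f * T n).coeff k = f.coeff (k - n) := by
  rw [T, AddMonoidAlgebra.coeff_mul_single_apply, mul_one, sub_eq_add_neg]

theorem coeff_C_mul {R : Type*} [Semiring R] (r : R) (f : LaurentPolynomial R) (k : ℤ) :
    (C r * f).coeff k = r * f.coeff k :=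
  AddMonoidAlgebra.coeff_single_zero_mul f r k

/-- The constant term of a Laurent polynomial in two variables. -/
noncomputable def constTerm : LaurentTwo →+ ℂ where
  toFun F := (F.coeff 0).coeff 0
  map_zero' := by simp
  map_add' F G := by simp

theorem constTerm_apply (F : LaurentTwo) : constTerm F = (F.coeff 0).coeff 0 := rfl

noncomputable def x : LaurentTwo := C (T 1)
noncomputable def xi : LaurentTwo := C (T (-1))
noncomputable def y : LaurentTwo := T 1
noncomputable def yi : LaurentTwo := T (-1)

theorem x_mul_xi : x * xi = 1 := by
  rw [x, xi, ← map_mul, ← T_add]; simp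

theorem y_mul_yi : y * yi = 1 := by
  rw [y, yi, ← T_add]; simp

/-- The step Laurent polynomial. -/
noncomputable def stepPoly : LaurentTwo := (1 + x) * (1 + y) * (1 + xi + yi)

/-- The alternating sum of `(x² y)⁻¹` over the orbit of the group of order ten preserving
`stepPoly`. -/
noncomputable def orbitSum : LaurentTwo :=
  (x * yi ^ 3 - xi ^ 3 * y) + (xi ^ 3 * y ^ 2 - x ^ 2 * yi ^ 3) + (xi ^ 2 * yi - xi * yi ^ 2)
  + (x * yi ^ 2 - xi ^ 2 * y) + 2 * (xi ^ 2 * y ^ 2 - x ^ 2 * yi ^ 2)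
  + (x ^ 3 * yi ^ 2 - xi ^ 2 * y ^ 3) + 2 * (x ^ 3 * yi - xi * y ^ 3)
  + 2 * (x * y ^ 2 - x ^ 2 * y) + 2 * (x * y ^ 3 - x ^ 3 * y) + (x ^ 2 * y ^ 3 - x ^ 3 * y ^ 2)

/-! ### The involution exchanging the variables -/

noncomputable def xUnit : LaurentTwoˣ := ⟨x, xi, x_mul_xi, by rw [mul_comm, x_mul_xi]⟩

noncomputable def yUnit : LaurentTwoˣ := ⟨y, yi, y_mul_yi, by rw [mul_comm, y_mul_yi]⟩

/-- The ring homomorphism exchanging `x` and `y`. -/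
noncomputable def swapHom : LaurentTwo →+* LaurentTwo :=
  eval₂ (eval₂ ((C : LaurentPolynomial ℂ →+* LaurentTwo).comp C) yUnit) xUnit

theorem yUnit_zpow (n : ℤ) : ((yUnit ^ n : LaurentTwoˣ) : LaurentTwo) = T n := by
  induction n using Int.induction_on with
  | zero => simp
  | succ n ih => rw [zpow_add_one, Units.val_mul, ih, T_add]; rfl
  | pred n ih => rw [zpow_sub_one, Units.val_mul, ih, sub_eq_add_neg, T_add]; rfl

theorem xUnit_zpow (n : ℤ) : ((xUnit ^ n : LaurentTwoˣ) : LaurentTwo) = C (T n) := by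
  induction n using Int.induction_on with
  | zero => simp
  | succ n ih => rw [zpow_add_one, Units.val_mul, ih, T_add, map_mul]; rfl
  | pred n ih => rw [zpow_sub_one, Units.val_mul, ih, sub_eq_add_neg, T_add, map_mul]; rfl

theorem swapHom_x : swapHom x = y := by
  rw [swapHom, x, eval₂_C, eval₂_T, yUnit_zpow]; rfl

theorem swapHom_xi : swapHom xi = yi := by
  rw [swapHom, xi, eval₂_C, eval₂_T, yUnit_zpow]; rfl

theorem swapHom_y : swapHom y = x := by
  rw [swapHom, y, eval₂_T, xUnit_zpow]; rfl

theorem swapHom_yi : swapHom yi = xi := by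
  rw [swapHom, yi, eval₂_T, xUnit_zpow]; rfl

/-- An additive property of Laurent polynomials in two variables may be checked on monomials. -/
theorem laurentTwo_induction {P : LaurentTwo → Prop} (F : LaurentTwo)
    (hadd : ∀ F G, P F → P G → P (F + G))
    (hmono : ∀ (c : ℂ) (m n : ℤ), P (C (C c * T m) * T n)) : P F := by
  induction F using LaurentPolynomial.induction_on' with
  | add p q hp hq => exact hadd p q hp hq
  | C_mul_T n a =>
    induction a using LaurentPolynomial.induction_on' with
    | add p q hp hq => rw [map_add, add_mul]; exact hadd _ _ hp hq
    | C_mul_T m c => exact hmono c m n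

theorem constTerm_monomial (c : ℂ) (m n : ℤ) :
    constTerm (C (C c * T m) * T n) = if m = 0 ∧ n = 0 then c else 0 := by
  rw [constTerm_apply, coeff_mul_T, C_apply]
  by_cases hn : n = 0
  · subst hn
    simp only [sub_self, if_true, and_true]
    rw [coeff_mul_T, C_apply]
    simp
  · simp [hn]

theorem constTerm_swapHom (F : LaurentTwo) : constTerm (swapHom F) = constTerm F := by
  induction F using laurentTwo_induction with
  | hadd F G hF hG => rw [map_add, map_add, hF, hG, map_add]
  | hmono c m n =>
    have : swapHom (C (C c * T m) * T n) = C (C c * T n) * T m := by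
      rw [swapHom, eval₂_C_mul_T, eval₂_C_mul_T, xUnit_zpow, yUnit_zpow, map_mul]
      simp only [RingHom.comp_apply]
      ring
    rw [this, constTerm_monomial, constTerm_monomial]
    simp only [and_comm]

theorem constTerm_eq_zero_of_swapHom {F : LaurentTwo} (h : swapHom F = -F) :
    constTerm F = 0 := by
  have h1 := constTerm_swapHom F
  rw [h, map_neg] at h1
  linear_combination -h1 / 2

theorem constTerm_first_boundary (n k : ℕ) :
    constTerm (stepPoly ^ n * ((1 + x) * (1 + y)) ^ k * (x * y) * orbitSum) = 0 := by
  apply constTerm_eq_zero_of_swapHom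
  simp only [stepPoly, orbitSum, map_mul, map_pow, map_add, map_sub, map_one, map_ofNat,
    swapHom_x, swapHom_y, swapHom_xi, swapHom_yi]
  rw [show (1 + y) * (1 + x) * (1 + yi + xi) = (1 + x) * (1 + y) * (1 + xi + yi) by ring]
  ring

/-! ### The involution fixing `x` -/

/-- Antisymmetry under `y ↦ x / ((1 + x) y)`, in terms of coefficients. -/
def PhiAnti (F : LaurentTwo) : Prop :=
  ∀ j : ℕ, (1 + T 1) ^ j * F.coeff (-(j : ℤ)) = -(T 1 ^ j * F.coeff (j : ℤ))

theorem PhiAnti.constTerm_eq_zero {F : LaurentTwo} (h : PhiAnti F) : constTerm F = 0 := by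
  have h0 := congrArg (fun p => p.coeff 0) (h 0)
  simp only [pow_zero, one_mul, Nat.cast_zero, neg_zero, AddMonoidAlgebra.coeff_neg] at h0
  rw [constTerm_apply]
  have : (F.coeff 0).coeff 0 = -(F.coeff 0).coeff 0 := h0
  linear_combination this / 2

theorem PhiAnti.add {F G : LaurentTwo} (hF : PhiAnti F) (hG : PhiAnti G) : PhiAnti (F + G) := by
  intro j
  simp only [AddMonoidAlgebra.coeff_add, Finsupp.add_apply]
  linear_combination hF j + hG j

theorem PhiAnti.C_mul {F : LaurentTwo} (hF : PhiAnti F) (a : LaurentPolynomial ℂ) :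
    PhiAnti (C a * F) := by
  intro j
  simp only [coeff_C_mul]
  linear_combination a * hF j

theorem PhiAnti.mul_symmetric {F : LaurentTwo} (hF : PhiAnti F) :
    PhiAnti ((C (1 + T 1) * T 1 + C (1 + 2 * T 1) + C (T 1) * T (-1)) * F) := by
  have key : ∀ k : ℤ, ((C (1 + T 1) * T 1 + C (1 + 2 * T 1) + C (T 1) * T (-1)) * F).coeff k
      = (1 + T 1) * F.coeff (k - 1) + (1 + 2 * T 1) * F.coeff k + T 1 * F.coeff (k + 1) := by
    intro k
    have : (C (1 + T 1) * T 1 + C (1 + 2 * T 1) + C (T 1) * T (-1)) * F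
      = C (1 + T 1) * (F * T 1) + C (1 + 2 * T 1) * F + C (T 1) * (F * T (-1)) := by ring
    rw [this]
    simp only [AddMonoidAlgebra.coeff_add, Finsupp.add_apply, coeff_C_mul, coeff_mul_T,
      sub_neg_eq_add]
  intro j
  rw [key, key]
  cases j with
  | zero =>
    have h0 := hF 0
    have h1 := hF 1
    simp only [Nat.cast_zero, neg_zero, pow_zero, pow_one, Nat.cast_one, zero_sub, zero_add,
      one_mul] at h0 h1 ⊢
    linear_combination 2 * h1 + (1 + 2 * T 1) * h0
  | succ j =>
    have h0 := hF j
    have h1 := hF (j + 1)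
    have h2 := hF (j + 2)
    have e1 : -((j + 1 : ℕ) : ℤ) - 1 = -((j + 2 : ℕ) : ℤ) := by push_cast; ring
    have e2 : -((j + 1 : ℕ) : ℤ) + 1 = -(j : ℤ) := by push_cast; ring
    have e3 : ((j + 1 : ℕ) : ℤ) - 1 = j := by push_cast; ring
    have e4 : ((j + 1 : ℕ) : ℤ) + 1 = ((j + 2 : ℕ) : ℤ) := by push_cast; ring
    rw [e1, e2, e3, e4]
    linear_combination h2 + (1 + 2 * T 1) * h1 + T 1 * (1 + T 1) * h0

theorem phiAnti_basic (j : ℕ) (hj : j ≠ 0) :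
    PhiAnti (T (-(j : ℤ)) - (1 + xi) ^ j * T (j : ℤ)) := by
  intro i
  have hx : (1 + xi) ^ j = C ((1 + T (-1)) ^ j) := by simp [xi]
  rw [hx]
  simp only [AddMonoidAlgebra.coeff_sub, Finsupp.sub_apply, coeff_C_mul, T_apply]
  by_cases hij : i = j
  · subst hij
    have : ((i : ℤ) = -i) = False := by simp; omega
    have h2 : (-(i : ℤ) = i) = False := by simp; omega
    simp only [if_true, this, h2, if_false]
    have h3 : (1 + T 1 : LaurentPolynomial ℂ) = T 1 * (1 + T (-1)) := by
      rw [mul_add, ← T_add]; simp [add_comm]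
    rw [h3, mul_pow]; ring
  · have h1 : (-(j : ℤ) = -i) = False := by simp; omega
    have h2 : ((j : ℤ) = -i) = False := by simp; omega
    have h3 : (-(j : ℤ) = i) = False := by simp; omega
    have h4 : ((j : ℤ) = i) = False := by simp; omega
    simp only [h1, h2, h3, h4, if_false]; ring

theorem phiAnti_orbitSum : PhiAnti orbitSum := by
  have h : orbitSum = C (T 1 - T 1 ^ 2) * (T (-((3 : ℕ) : ℤ)) - (1 + xi) ^ 3 * T ((3 : ℕ) : ℤ))
      + C (-T (-1) + T 1 - 2 * T 1 ^ 2 + T 1 ^ 3)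
        * (T (-((2 : ℕ) : ℤ)) - (1 + xi) ^ 2 * T ((2 : ℕ) : ℤ))
      + C (T (-1) ^ 2 + 2 * T 1 ^ 3) * (T (-((1 : ℕ) : ℤ)) - (1 + xi) ^ 1 * T ((1 : ℕ) : ℤ)) := by
    have e1 : ∀ j : ℕ, (T (j : ℤ) : LaurentTwo) = y ^ j := fun j => by rw [y, T_pow]; simp
    have e2 : ∀ j : ℕ, (T (-(j : ℤ)) : LaurentTwo) = yi ^ j := fun j => by rw [yi, T_pow]; simp
    simp only [e1, e2, map_add, map_sub, map_neg, map_mul, map_pow, map_ofNat]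
    rw [show (C (T 1) : LaurentTwo) = x from rfl, show (C (T (-1)) : LaurentTwo) = xi from rfl]
    have hx := x_mul_xi
    rw [orbitSum]
    grind
  rw [h]
  exact (((phiAnti_basic 3 (by norm_num)).C_mul _).add
    ((phiAnti_basic 2 (by norm_num)).C_mul _)).add ((phiAnti_basic 1 (by norm_num)).C_mul _)

theorem stepPoly_eq : stepPoly =
    C (1 + T (-1)) * (C (1 + T 1) * T 1 + C (1 + 2 * T 1) + C (T 1) * T (-1)) := by
  have : stepPoly = (1 + xi) * ((1 + x) * y + (1 + 2 * x) + x * yi) := by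
    rw [stepPoly]; have hx := x_mul_xi; have hy := y_mul_yi; grind
  rw [this]
  simp only [map_add, map_one, map_mul, map_ofNat]
  rfl

theorem PhiAnti.stepPoly_pow_mul {F : LaurentTwo} (hF : PhiAnti F) (n : ℕ) :
    PhiAnti (stepPoly ^ n * F) := by
  induction n with
  | zero => simpa using hF
  | succ n ih =>
    rw [pow_succ', mul_assoc, stepPoly_eq, mul_assoc, ← stepPoly_eq]
    exact (ih.mul_symmetric).C_mul _

theorem constTerm_second_boundary (n m : ℕ) :
    constTerm (stepPoly ^ n * (1 + x) ^ m * x ^ 2 * orbitSum) = 0 := by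
  have h : stepPoly ^ n * (1 + x) ^ m * x ^ 2 * orbitSum
      = C ((1 + T 1) ^ m * T 1 ^ 2) * (stepPoly ^ n * orbitSum) := by
    simp only [map_add, map_one, map_mul, map_pow]
    rw [show (C (T 1) : LaurentTwo) = x from rfl]
    ring
  rw [h]
  exact ((phiAnti_orbitSum.stepPoly_pow_mul n).C_mul _).constTerm_eq_zero

end

section

open LaurentPolynomial

/-! ### Binomial coefficients with integer lower index -/

/-- The reciprocal factorial, extended by zero to negative integers. -/
noncomputable def invFact (k : ℤ) : ℂ := if 0 ≤ k then ((k.toNat.factorial : ℕ) : ℂ)⁻¹ else 0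

theorem invFact_natCast (k : ℕ) : invFact k = ((k.factorial : ℕ) : ℂ)⁻¹ := by simp [invFact]

theorem invFact_of_neg {k : ℤ} (hk : k < 0) : invFact k = 0 := if_neg (not_le.mpr hk)

theorem invFact_eq (k : ℤ) : invFact k = (k + 1) * invFact (k + 1) := by
  rcases lt_trichotomy k (-1) with hk | rfl | hk
  · rw [invFact_of_neg (by omega), invFact_of_neg (by omega), mul_zero]
  · simp [invFact]
  · obtain ⟨m, rfl⟩ := Int.eq_ofNat_of_zero_le (show 0 ≤ k by omega)
    have : ((m : ℤ) + 1) = ((m + 1 : ℕ) : ℤ) := by push_cast; ring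
    rw [this, invFact_natCast, invFact_natCast, Nat.factorial_succ]
    have h1 : (m.factorial : ℂ) ≠ 0 := by exact_mod_cast m.factorial_ne_zero
    have h2 : (m : ℂ) + 1 ≠ 0 := by exact_mod_cast m.succ_ne_zero
    push_cast
    field_simp

/-- The binomial coefficient with integer lower index. -/
noncomputable def intChoose (n : ℕ) (k : ℤ) : ℂ := n.factorial * invFact k * invFact (n - k)

theorem intChoose_of_neg (n : ℕ) {k : ℤ} (hk : k < 0) : intChoose n k = 0 := by
  rw [intChoose, invFact_of_neg hk]; ring

theorem intChoose_zero_right (n : ℕ) : intChoose n 0 = 1 := by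
  have h : (n.factorial : ℂ) ≠ 0 := by exact_mod_cast n.factorial_ne_zero
  have h0 : invFact 0 = 1 := by simp [invFact]
  rw [intChoose, sub_zero, invFact_natCast, h0]
  field_simp

theorem intChoose_zero_left (k : ℤ) : intChoose 0 k = if k = 0 then 1 else 0 := by
  split_ifs with h
  · rw [h, intChoose_zero_right]
  · rcases lt_or_gt_of_ne h with h | h
    · exact intChoose_of_neg 0 h
    · rw [intChoose, invFact_of_neg (k := ((0 : ℕ) : ℤ) - k) (by simpa using h), mul_zero]

theorem intChoose_succ (n : ℕ) (k : ℤ) :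
    intChoose (n + 1) k = intChoose n k + intChoose n (k - 1) := by
  have h1 := invFact_eq (n - k)
  have h2 := invFact_eq (k - 1)
  rw [sub_add_cancel] at h2
  rw [intChoose, intChoose, intChoose, h1, h2, Nat.factorial_succ,
    show ((n + 1 : ℕ) : ℤ) - k = n - k + 1 by push_cast; ring,
    show (n : ℤ) - (k - 1) = n - k + 1 by ring]
  push_cast
  ring

theorem coeff_one_add_T_pow {R : Type*} [CommRing R] (f : ℂ →+* R) (n : ℕ) (k : ℤ) :
    ((1 + T 1 : LaurentPolynomial R) ^ n).coeff k = f (intChoose n k) := by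
  induction n generalizing k with
  | zero =>
    rw [pow_zero, intChoose_zero_left, ← T_zero, T_apply]
    simp only [eq_comm (a := (0 : ℤ))]
    split_ifs <;> simp
  | succ n ih =>
    rw [pow_succ, mul_add, mul_one, AddMonoidAlgebra.coeff_add, Finsupp.add_apply, coeff_mul_T,
      ih, ih, intChoose_succ, map_add]

/-! ### Constant terms as binomial sums -/

/-- The monomial `x ^ i * y ^ j`. -/
noncomputable def mono (i j : ℤ) : LaurentTwo := C (T i) * T j

theorem constTerm_powers_mul_mono (p q : ℕ) (i j : ℤ) :
    constTerm ((1 + x) ^ p * (1 + y) ^ q * mono i j) = intChoose p (-i) * intChoose q (-j) := by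
  have h : (1 + x) ^ p * (1 + y) ^ q * mono i j
      = C ((1 + T 1) ^ p * T i) * ((1 + T 1) ^ q * T j) := by
    simp only [map_mul, map_pow, map_add, map_one, x, y, mono]; ring
  rw [h, constTerm_apply, coeff_C_mul, coeff_mul_T, coeff_one_add_T_pow C, mul_comm, coeff_C_mul,
    coeff_mul_T, coeff_one_add_T_pow (RingHom.id ℂ)]
  simp only [zero_sub, RingHom.id_apply]
  ring

theorem mono_mul_mono (i j k l : ℤ) : mono i j * mono k l = mono (i + k) (j + l) := by
  simp only [mono, T_add, map_mul]; ring

theorem mono_pow (i j : ℤ) (n : ℕ) : mono i j ^ n = mono (n * i) (n * j) := by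
  simp only [mono, mul_pow, T_pow, ← map_pow]

theorem constTerm_stepPoly_pow (n p q : ℕ) (i j : ℤ) :
    constTerm (stepPoly ^ n * (1 + x) ^ p * (1 + y) ^ q * mono i j)
      = ∑ l ∈ Finset.range (n + 1), intChoose n l * intChoose (n + q) (l - j)
          * intChoose (2 * n - l + p) (n - l - i) := by
  have hstep : stepPoly = (1 + x) * (1 + y) * mono (-1) 0 * (mono 1 (-1) + (1 + x)) := by
    have e1 : mono (-1) 0 = xi := by simp [mono, xi]
    have e2 : mono 1 (-1) = x * yi := rfl
    rw [e1, e2, stepPoly]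
    have := x_mul_xi
    grind
  have hpow : stepPoly ^ n * (1 + x) ^ p * (1 + y) ^ q * mono i j
      = ∑ l ∈ Finset.range (n + 1), (n.choose l) •
          ((1 + x) ^ (2 * n - l + p) * (1 + y) ^ (n + q) * mono (l - n + i) (j - l)) := by
    rw [hstep, mul_pow, add_pow, Finset.mul_sum, Finset.sum_mul, Finset.sum_mul, Finset.sum_mul]
    refine Finset.sum_congr rfl fun l hl => ?_
    have hl' : l ≤ n := Nat.lt_succ_iff.mp (Finset.mem_range.mp hl)
    have e : mono (l - n + i) (j - l) = mono (-1) 0 ^ n * mono 1 (-1) ^ l * mono i j := by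
      rw [mono_pow, mono_pow, mono_mul_mono, mono_mul_mono]
      congr 1 <;> ring
    rw [e, show 2 * n - l + p = n + (n - l) + p by omega, nsmul_eq_mul]
    simp only [mul_pow]
    generalize 1 + x = u
    generalize 1 + y = v
    ring
  rw [hpow, map_sum]
  refine Finset.sum_congr rfl fun l hl => ?_
  have hl' : l ≤ n := Nat.lt_succ_iff.mp (Finset.mem_range.mp hl)
  rw [map_nsmul, constTerm_powers_mul_mono, nsmul_eq_mul]
  have hc : (n.choose l : ℂ) = intChoose n l := by
    rw [intChoose, ← Nat.cast_sub hl', invFact_natCast, invFact_natCast, Nat.choose_eq_factorial_div_factorial hl',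
      Nat.cast_div (Nat.factorial_mul_factorial_dvd_factorial hl')]
    · push_cast
      have h1 : (l.factorial : ℂ) ≠ 0 := by exact_mod_cast l.factorial_ne_zero
      have h2 : ((n - l).factorial : ℂ) ≠ 0 := by exact_mod_cast (n - l).factorial_ne_zero
      field_simp
    · exact_mod_cast mul_ne_zero l.factorial_ne_zero (n - l).factorial_ne_zero
  rw [hc, show -((l : ℤ) - n + i) = n - l - i by ring, show -(j - (l : ℤ)) = l - j by ring]
  ring

theorem orbitSum_mul_eq : x ^ 2 * y * orbitSum =
    -mono (-1) 2 + mono (-1) 3 + mono 0 0 - mono 0 2 + 2 * mono 0 3 - mono 0 4 - mono 1 (-1)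
    - 2 * mono 1 4 + mono 3 (-2) + mono 3 (-1) + 2 * mono 3 3 + 2 * mono 3 4 - mono 4 (-2)
    - 2 * mono 4 (-1) - 2 * mono 4 2 + mono 4 4 + mono 5 (-1) + 2 * mono 5 0 - 2 * mono 5 2
    - mono 5 3 := by
  have hx (n : ℕ) : mono n 0 = x ^ n := by simp [mono, x, ← map_pow, T_pow]
  have hy (n : ℕ) : mono 0 n = y ^ n := by simp [mono, y, T_pow]
  have hxi : mono (-1) 0 = xi := by simp [mono, xi]
  have hyi (n : ℕ) : mono 0 (-n) = yi ^ n := by simp [mono, yi, T_pow]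
  have e1 (m n : ℕ) : mono m n = x ^ m * y ^ n := by rw [← hx, ← hy, mono_mul_mono]; simp
  have e2 (m n : ℕ) : mono m (-n) = x ^ m * yi ^ n := by rw [← hx, ← hyi, mono_mul_mono]; simp
  have e3 (n : ℕ) : mono (-1) n = xi * y ^ n := by rw [← hxi, ← hy, mono_mul_mono]; simp
  have h1 := e3 2
  have h2 := e3 3
  have h3 := e1 0 0
  have h4 := e1 0 2
  have h5 := e1 0 3
  have h6 := e1 0 4
  have h7 := e2 1 1
  have h8 := e1 1 4
  have h9 := e2 3 2
  have h10 := e2 3 1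
  have h11 := e1 3 3
  have h12 := e1 3 4
  have h13 := e2 4 2
  have h14 := e2 4 1
  have h15 := e1 4 2
  have h16 := e1 4 4
  have h17 := e2 5 1
  have h18 := e1 5 0
  have h19 := e1 5 2
  have h20 := e1 5 3
  push_cast at h1 h2 h3 h4 h5 h6 h7 h8 h9 h10 h11 h12 h13 h14 h15 h16 h17 h18 h19 h20
  rw [h1, h2, h3, h4, h5, h6, h7, h8, h9, h10, h11, h12, h13, h14, h15, h16, h17, h18, h19, h20,
    orbitSum]
  have hx' := x_mul_xi
  have hy' := y_mul_yi
  grind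

/-! ### The telescoping identity -/

/-- The polynomial certificate of the telescoping identity. -/
noncomputable def certPoly (N L : ℂ) : ℂ :=
  (30 * N ^ 9 + 348 * N ^ 8 + 1056 * N ^ 7 - 4104 * N ^ 6 - 42906 * N ^ 5 - 152052 * N ^ 4
    - 281892 * N ^ 3 - 276192 * N ^ 2 - 125568 * N - 17280)
  + (25 * N ^ 9 + 8 * N ^ 8 - 2280 * N ^ 7 - 15218 * N ^ 6 - 38149 * N ^ 5 - 14154 * N ^ 4
    + 126612 * N ^ 3 + 266052 * N ^ 2 + 200304 * N + 47232) * L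
  + (5 * N ^ 9 - 177 * N ^ 8 - 1500 * N ^ 7 - 1021 * N ^ 6 + 23414 * N ^ 5 + 92902 * N ^ 4
    + 132157 * N ^ 3 + 30664 * N ^ 2 - 83140 * N - 49128) * L ^ 2
  + (-47 * N ^ 8 + 300 * N ^ 7 + 5009 * N ^ 6 + 19053 * N ^ 5 + 27247 * N ^ 4 + 2879 * N ^ 3
    - 17065 * N ^ 2 + 14688 * N + 24392) * L ^ 3
  + (168 * N ^ 7 + 379 * N ^ 6 - 4217 * N ^ 5 - 22155 * N ^ 4 - 42362 * N ^ 3 - 35966 * N ^ 2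
    - 14333 * N - 5618) * L ^ 4
  + (-285 * N ^ 6 - 1487 * N ^ 5 - 1423 * N ^ 4 + 4797 * N ^ 3 + 11438 * N ^ 2 + 6836 * N
    + 368) * L ^ 5
  + (240 * N ^ 5 + 1328 * N ^ 4 + 2568 * N ^ 3 + 1656 * N ^ 2 - 132 * N + 28) * L ^ 6
  + (-105 * N ^ 4 - 486 * N ^ 3 - 815 * N ^ 2 - 450 * N + 8) * L ^ 7
  + (23 * N ^ 3 + 70 * N ^ 2 + 69 * N - 2) * L ^ 8
  + (-2 * N ^ 2 - 2 * N) * L ^ 9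

/-- The summand of the constant term of `stepPoly ^ n * x ^ i * y ^ j`. -/
noncomputable def summand (n l : ℕ) (i j : ℤ) : ℂ :=
  intChoose n l * intChoose n (l - j) * intChoose (2 * n - l) (n - l - i)

/-- The antidifference in the telescoping identity. -/
noncomputable def antidifference (n l : ℕ) : ℂ :=
  certPoly n l * (n.factorial) ^ 2 * (2 * n + 1 - l).factorial * invFact (l - 1)
    * invFact (l + 3) * invFact (n - l) * invFact (n - l + 4) * invFact (n - l + 1)
    * invFact (n + 5)

theorem invFact_sub (k : ℤ) (d : ℕ) :
    invFact (k - d) = (∏ i ∈ Finset.range d, ((k : ℂ) - i)) * invFact k := by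
  induction d with
  | zero => simp
  | succ d ih =>
    rw [Finset.prod_range_succ, invFact_eq,
      show k - ((d + 1 : ℕ) : ℤ) + 1 = k - d by push_cast; ring, ih]
    push_cast
    ring

/-- The polynomial factor of `summand` after extracting a common product of factorials. -/
noncomputable def summandPoly (L M : ℂ) (a a' b b' : ℕ) : ℂ :=
  (∏ i ∈ Finset.range b, (L + 4 - i)) * (∏ i ∈ Finset.range b', (M + 4 - i))
    * (∏ i ∈ Finset.range a, (M + 1 - i)) * (∏ i ∈ Finset.range a', (L + M + 5 - i))

theorem summand_eq (l m : ℕ) {i j : ℤ} {a a' b b' : ℕ}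
    (h : i = a - 1 ∧ j = b - 4 ∧ a + a' = 6 ∧ b + b' = 8) :
    summand (l + m) l i j =
      ((l + m).factorial ^ 2 * (l + 2 * m).factorial * invFact l * invFact m * invFact (l + 4)
        * invFact (m + 4) * invFact (m + 1) * invFact (l + m + 5)) *
        summandPoly l m a a' b b' := by
  obtain ⟨rfl, rfl, ha, hb⟩ := h
  have h1 := invFact_sub (l + 4) b
  have h2 := invFact_sub (m + 4) b'
  have h3 := invFact_sub (m + 1) a
  have h4 := invFact_sub (l + m + 5) a'
  push_cast at h1 h2 h3 h4
  have ha' : (a : ℤ) + a' = 6 := by exact_mod_cast ha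
  have hb' : (b : ℤ) + b' = 8 := by exact_mod_cast hb
  simp only [summand, summandPoly, intChoose]
  rw [show 2 * (l + m) - l = l + 2 * m by omega]
  push_cast
  rw [show (l : ℤ) + m - l = m by ring, show (l : ℤ) - (b - 4) = l + 4 - b by ring,
    show (l : ℤ) + m - (l + 4 - b) = m + 4 - b' by linarith,
    show (m : ℤ) - (a - 1) = m + 1 - a by ring,
    show (l : ℤ) + 2 * m - (m + 1 - a) = l + m + 5 - a' by linarith, h1, h2, h3, h4]
  ring

set_option maxRecDepth 10000 in
set_option maxHeartbeats 4000000 in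
theorem certPoly_identity (L M : ℂ) :
    (L + M) * (
        -summandPoly L M 0 6 6 2 + summandPoly L M 0 6 7 1 + summandPoly L M 1 5 4 4
        - summandPoly L M 1 5 6 2 + 2 * summandPoly L M 1 5 7 1 - summandPoly L M 1 5 8 0
        - summandPoly L M 2 4 3 5 - 2 * summandPoly L M 2 4 8 0 + summandPoly L M 4 2 2 6
        + summandPoly L M 4 2 3 5 + 2 * summandPoly L M 4 2 7 1 + 2 * summandPoly L M 4 2 8 0
        - summandPoly L M 5 1 2 6 - 2 * summandPoly L M 5 1 3 5 - 2 * summandPoly L M 5 1 6 2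
        + summandPoly L M 5 1 8 0 + summandPoly L M 6 0 3 5 + 2 * summandPoly L M 6 0 4 4
        - 2 * summandPoly L M 6 0 6 2 - summandPoly L M 6 0 7 1)
      - 24 * (M * ((M + 4) * (M + 3) * (M + 2) * (M + 1)) * (L + 2 * M + 2) * (L + 2 * M + 1)
        * (L + M + 5) * (L + M + 4) * (L + M + 3)) =
      certPoly (L + M) (L + 1) * (M * (M + 4) * (M + 1))
        - certPoly (L + M) L * (L * (L + 4) * (L + 2 * M + 1)) := by
  simp only [summandPoly, certPoly, Finset.prod_range_succ, Finset.prod_range_zero, one_mul]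
  push_cast
  ring1

theorem telescoping (n l : ℕ) (hl : l ≤ n) :
    (n : ℂ) * (n + 1) ^ 2 * (n + 2) * (n + 3) *
      (-summand n l (-1) 2 + summand n l (-1) 3 + summand n l 0 0 - summand n l 0 2
        + 2 * summand n l 0 3 - summand n l 0 4 - summand n l 1 (-1) - 2 * summand n l 1 4
        + summand n l 3 (-2) + summand n l 3 (-1) + 2 * summand n l 3 3 + 2 * summand n l 3 4
        - summand n l 4 (-2) - 2 * summand n l 4 (-1) - 2 * summand n l 4 2 + summand n l 4 4
        + summand n l 5 (-1) + 2 * summand n l 5 0 - 2 * summand n l 5 2 - summand n l 5 3)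
    - 24 * (intChoose (n + 1) l * intChoose (n + 3) (l + 4) * intChoose (2 * n + 2 - l) (n - l))
    = (n + 1) ^ 2 * (n + 2) * (n + 3) * (antidifference n (l + 1) - antidifference n l) := by
  obtain ⟨m, rfl⟩ := Nat.exists_eq_add_of_le hl
  rw [summand_eq l m (a := 0) (a' := 6) (b := 6) (b' := 2)
      (by decide : (-1 : ℤ) = _ ∧ (2 : ℤ) = _ ∧ _),
    summand_eq l m (a := 0) (a' := 6) (b := 7) (b' := 1)
      (by decide : (-1 : ℤ) = _ ∧ (3 : ℤ) = _ ∧ _),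
    summand_eq l m (a := 1) (a' := 5) (b := 4) (b' := 4)
      (by decide : (0 : ℤ) = _ ∧ (0 : ℤ) = _ ∧ _),
    summand_eq l m (a := 1) (a' := 5) (b := 6) (b' := 2)
      (by decide : (0 : ℤ) = _ ∧ (2 : ℤ) = _ ∧ _),
    summand_eq l m (a := 1) (a' := 5) (b := 7) (b' := 1)
      (by decide : (0 : ℤ) = _ ∧ (3 : ℤ) = _ ∧ _),
    summand_eq l m (a := 1) (a' := 5) (b := 8) (b' := 0)
      (by decide : (0 : ℤ) = _ ∧ (4 : ℤ) = _ ∧ _),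
    summand_eq l m (a := 2) (a' := 4) (b := 3) (b' := 5)
      (by decide : (1 : ℤ) = _ ∧ (-1 : ℤ) = _ ∧ _),
    summand_eq l m (a := 2) (a' := 4) (b := 8) (b' := 0)
      (by decide : (1 : ℤ) = _ ∧ (4 : ℤ) = _ ∧ _),
    summand_eq l m (a := 4) (a' := 2) (b := 2) (b' := 6)
      (by decide : (3 : ℤ) = _ ∧ (-2 : ℤ) = _ ∧ _),
    summand_eq l m (a := 4) (a' := 2) (b := 3) (b' := 5)
      (by decide : (3 : ℤ) = _ ∧ (-1 : ℤ) = _ ∧ _),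
    summand_eq l m (a := 4) (a' := 2) (b := 7) (b' := 1)
      (by decide : (3 : ℤ) = _ ∧ (3 : ℤ) = _ ∧ _),
    summand_eq l m (a := 4) (a' := 2) (b := 8) (b' := 0)
      (by decide : (3 : ℤ) = _ ∧ (4 : ℤ) = _ ∧ _),
    summand_eq l m (a := 5) (a' := 1) (b := 2) (b' := 6)
      (by decide : (4 : ℤ) = _ ∧ (-2 : ℤ) = _ ∧ _),
    summand_eq l m (a := 5) (a' := 1) (b := 3) (b' := 5)
      (by decide : (4 : ℤ) = _ ∧ (-1 : ℤ) = _ ∧ _),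
    summand_eq l m (a := 5) (a' := 1) (b := 6) (b' := 2)
      (by decide : (4 : ℤ) = _ ∧ (2 : ℤ) = _ ∧ _),
    summand_eq l m (a := 5) (a' := 1) (b := 8) (b' := 0)
      (by decide : (4 : ℤ) = _ ∧ (4 : ℤ) = _ ∧ _),
    summand_eq l m (a := 6) (a' := 0) (b := 3) (b' := 5)
      (by decide : (5 : ℤ) = _ ∧ (-1 : ℤ) = _ ∧ _),
    summand_eq l m (a := 6) (a' := 0) (b := 4) (b' := 4)
      (by decide : (5 : ℤ) = _ ∧ (0 : ℤ) = _ ∧ _),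
    summand_eq l m (a := 6) (a' := 0) (b := 6) (b' := 2)
      (by decide : (5 : ℤ) = _ ∧ (2 : ℤ) = _ ∧ _),
    summand_eq l m (a := 6) (a' := 0) (b := 7) (b' := 1)
      (by decide : (5 : ℤ) = _ ∧ (3 : ℤ) = _ ∧ _)]
  have k1 := invFact_sub (m + 4) 4
  have k2 := invFact_sub m 1
  have k3 := invFact_sub (l + m + 5) 3
  have k4 := invFact_sub l 1
  have k5 := invFact_sub (l + 4) 1
  simp only [Finset.prod_range_succ, Finset.prod_range_zero, one_mul] at k1 k2 k3 k4 k5 ⊢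
  push_cast at k1 k2 k3 k4 k5
  simp only [intChoose, antidifference]
  rw [show 2 * (l + m) + 1 - (l + 1) = l + 2 * m by omega,
    show 2 * (l + m) + 1 - l = l + 2 * m + 1 by omega,
    show 2 * (l + m) + 2 - l = l + 2 * m + 2 by omega]
  simp only [Nat.factorial_succ]
  push_cast
  have e1 : (l : ℤ) + m + 1 - l = m + 1 := by ring
  have e2 : (l : ℤ) + m + 3 - (l + 4) = m - 1 := by ring
  have e3 : (l : ℤ) + 2 * m + 2 - m = l + m + 5 - 3 := by ring
  have e4 : (l : ℤ) + m - (l + 1) = m - 1 := by ring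
  have e5 : (m : ℤ) - 1 + 4 = m + 4 - 1 := by ring
  have e6 : (l : ℤ) + 1 + 3 = l + 4 := by ring
  have e7 : (l : ℤ) + 3 = l + 4 - 1 := by ring
  have e8 : (l : ℤ) + m - l = m := by ring
  simp only [e1, e2, e3, e4, e5, e6, e7, e8, add_sub_cancel_right, sub_add_cancel] at k1 ⊢
  have k6 : invFact m = (m + 1) * invFact (m + 1) := by simpa using invFact_eq m
  rw [k2, k3, k4, k5]
  rw [show (m : ℤ) + 4 - 1 = (m + 4 : ℤ) - (1 : ℕ) by simp, invFact_sub]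
  simp only [Finset.prod_range_succ, Finset.prod_range_zero, one_mul]
  push_cast
  generalize invFact m = s at k1 k6 ⊢
  generalize invFact l = r
  generalize invFact (l + 4) = t
  generalize invFact (m + 4) = u at k1 ⊢
  generalize invFact (m + 1) = v at k6 ⊢
  generalize invFact (l + m + 5) = w
  generalize ((l + m).factorial : ℂ) = f
  generalize ((l + 2 * m).factorial : ℂ) = g
  generalize (l : ℂ) = L at *
  generalize (m : ℂ) = M at *
  have key := certPoly_identity L M
  generalize certPoly (L + M) (L + 1) = c at key ⊢
  generalize certPoly (L + M) L = d at key ⊢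
  linear_combination
    (L + M + 1) ^ 2 * (L + M + 2) * (L + M + 3) * f ^ 2 * g * r * t * w * s * v * u * key
    - (24 * (L + M + 1) ^ 2 * (L + M + 2) * (L + M + 3) * f ^ 2 * g * r * v * t * M * s
      * (L + 2 * M + 2) * (L + 2 * M + 1) * (L + M + 5) * (L + M + 4) * (L + M + 3) * w) * k1
    - (L + M + 1) ^ 2 * (L + M + 2) * (L + M + 3) * c * f ^ 2 * g * r * t
      * M * s * (M + 4) * u * w * k6

end

section

open LaurentPolynomial

theorem constTerm_stepPoly_pow_mono (n : ℕ) (i j : ℤ) :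
    constTerm (stepPoly ^ n * mono i j) = ∑ l ∈ Finset.range (n + 1), summand n l i j := by
  have h := constTerm_stepPoly_pow n 0 0 i j
  simpa only [pow_zero, mul_one, add_zero, summand] using h

/-- The constant term of `stepPoly ^ n * x ^ 2 * y * orbitSum` as a positive constant term. -/
theorem constTerm_orbitSum_eq (n : ℕ) :
    (n : ℂ) * (n + 1) ^ 2 * (n + 2) * (n + 3) * constTerm (stepPoly ^ n * (x ^ 2 * y * orbitSum))
      = 24 * constTerm (stepPoly ^ (n + 1) * ((1 + y) ^ 2 * mono 1 (-4))) := by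
  have hsum : constTerm (stepPoly ^ n * (x ^ 2 * y * orbitSum)) = ∑ l ∈ Finset.range (n + 1),
      (-summand n l (-1) 2 + summand n l (-1) 3 + summand n l 0 0 - summand n l 0 2
        + 2 * summand n l 0 3 - summand n l 0 4 - summand n l 1 (-1) - 2 * summand n l 1 4
        + summand n l 3 (-2) + summand n l 3 (-1) + 2 * summand n l 3 3 + 2 * summand n l 3 4
        - summand n l 4 (-2) - 2 * summand n l 4 (-1) - 2 * summand n l 4 2 + summand n l 4 4
        + summand n l 5 (-1) + 2 * summand n l 5 0 - 2 * summand n l 5 2 - summand n l 5 3) := by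
    simp only [Finset.sum_sub_distrib, Finset.sum_add_distrib, Finset.sum_neg_distrib,
      ← Finset.mul_sum, ← constTerm_stepPoly_pow_mono]
    rw [orbitSum_mul_eq]
    have hneg (a b : LaurentTwo) : constTerm (a * -b) = -constTerm (a * b) := by
      rw [← map_neg]; congr 1; ring
    simp only [mul_add, mul_sub, hneg, two_mul, map_add, map_sub]
  have h2 := constTerm_stepPoly_pow (n + 1) 0 2 1 (-4)
  rw [pow_zero, mul_one, mul_assoc, Finset.sum_range_succ] at h2
  have hz : intChoose (2 * (n + 1) - (n + 1) + 0) (((n + 1 : ℕ) : ℤ) - ((n + 1 : ℕ) : ℤ) - 1) = 0 :=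
    intChoose_of_neg _ (by omega)
  rw [hz, mul_zero, add_zero] at h2
  rw [h2, hsum, Finset.mul_sum, Finset.mul_sum, ← sub_eq_zero, ← Finset.sum_sub_distrib]
  have htel : ∀ l ∈ Finset.range (n + 1), _ = _ := fun l hl =>
    telescoping n l (Nat.lt_succ_iff.mp (Finset.mem_range.mp hl))
  have hgoal := Finset.sum_congr rfl htel
  rw [← Finset.mul_sum, Finset.sum_range_sub] at hgoal
  have ha : antidifference n (n + 1) = 0 := by
    rw [antidifference, invFact_of_neg (k := (n : ℤ) - ((n + 1 : ℕ) : ℤ)) (by omega)]; ring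
  have hb : antidifference n 0 = 0 := by
    rw [antidifference, invFact_of_neg (k := ((0 : ℕ) : ℤ) - 1) (by omega)]; ring
  rw [ha, hb, sub_zero, mul_zero] at hgoal
  rw [← hgoal]
  refine Finset.sum_congr rfl fun l hl => ?_
  have e1 : 2 * (n + 1) - l + 0 = 2 * n + 2 - l := by omega
  have e2 : ((n + 1 : ℕ) : ℤ) - l - 1 = n - l := by push_cast; ring
  rw [e1, e2, sub_neg_eq_add]

end

section

open LaurentPolynomial

/-- The number of vertices at depth `n` below a vertex with label `(h + 1, k + 1)` in the
generating tree of semi-Baxter permutations. -/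
def labelCount : ℕ → ℕ → ℕ → ℕ
  | 0, _, _ => 1
  | n + 1, h, k => ∑ i ∈ Finset.range (h + 1), labelCount n i (k + 1)
      + ∑ j ∈ Finset.range (k + 1), labelCount n (h + k + 1 - j) j

theorem constTerm_powers_mul_orbitSum (p q : ℕ) :
    constTerm ((1 + x) ^ p * (1 + y) ^ q * (x ^ 2 * y * orbitSum)) = 1 := by
  have hneg (a b : LaurentTwo) : constTerm (a * -b) = -constTerm (a * b) := by
    rw [← map_neg]; congr 1; ring
  have hz (i j : ℤ) (h : 0 < i ∨ 0 < j) :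
      constTerm ((1 + x) ^ p * (1 + y) ^ q * mono i j) = 0 := by
    rw [constTerm_powers_mul_mono]
    rcases h with h | h
    · rw [intChoose_of_neg _ (by omega), zero_mul]
    · rw [intChoose_of_neg _ (by omega : -j < 0), mul_zero]
  rw [orbitSum_mul_eq]
  simp only [mul_add, mul_sub, hneg, two_mul, map_add, map_sub]
  rw [hz (-1) 2 (by omega), hz (-1) 3 (by omega), hz 0 2 (by omega), hz 0 3 (by omega),
    hz 0 4 (by omega), hz 1 (-1) (by omega), hz 1 4 (by omega), hz 3 (-2) (by omega),
    hz 3 (-1) (by omega), hz 3 3 (by omega), hz 3 4 (by omega), hz 4 (-2) (by omega),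
    hz 4 (-1) (by omega), hz 4 2 (by omega), hz 4 4 (by omega), hz 5 (-1) (by omega),
    hz 5 0 (by omega), hz 5 2 (by omega), hz 5 3 (by omega), constTerm_powers_mul_mono]
  norm_num [intChoose_zero_right]

theorem stepPoly_recursion (n h k : ℕ) :
    stepPoly ^ (n + 1) * (1 + x) ^ (h + k) * (1 + y) ^ k * (x ^ 2 * y * orbitSum)
      = ∑ i ∈ Finset.range (h + 1),
          stepPoly ^ n * (1 + x) ^ (i + (k + 1)) * (1 + y) ^ (k + 1) * (x ^ 2 * y * orbitSum)
        + ∑ j ∈ Finset.range (k + 1),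
          stepPoly ^ n * (1 + x) ^ (h + k + 1) * (1 + y) ^ j * (x ^ 2 * y * orbitSum)
        + stepPoly ^ n * ((1 + x) * (1 + y)) ^ (k + 1) * (x * y) * orbitSum
        + stepPoly ^ n * (1 + x) ^ (h + k + 1) * x ^ 2 * orbitSum := by
  have hW : stepPoly * (x * y) = (1 + x) * (1 + y) ^ 2 * x + (1 + x) * (1 + y) * y := by
    have := x_mul_xi
    have := y_mul_yi
    rw [stepPoly]
    grind
  have gx : (∑ i ∈ Finset.range (h + 1), (1 + x) ^ i) * x = (1 + x) ^ (h + 1) - 1 := by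
    rw [← geom_sum_mul]; ring
  have gy : (∑ j ∈ Finset.range (k + 1), (1 + y) ^ j) * y = (1 + y) ^ (k + 1) - 1 := by
    rw [← geom_sum_mul]; ring
  have hx : ∑ i ∈ Finset.range (h + 1),
      stepPoly ^ n * (1 + x) ^ (i + (k + 1)) * (1 + y) ^ (k + 1) * (x ^ 2 * y * orbitSum)
      = stepPoly ^ n * ((1 + x) ^ (h + 1) - 1) * (1 + x) ^ (k + 1) * (1 + y) ^ (k + 1)
        * (x * y * orbitSum) := by
    rw [← gx]
    simp only [Finset.mul_sum, Finset.sum_mul]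
    exact Finset.sum_congr rfl fun i _ => by rw [pow_add (1 + x) i]; ring
  have hy : ∑ j ∈ Finset.range (k + 1),
      stepPoly ^ n * (1 + x) ^ (h + k + 1) * (1 + y) ^ j * (x ^ 2 * y * orbitSum)
      = stepPoly ^ n * ((1 + y) ^ (k + 1) - 1) * (1 + x) ^ (h + k + 1) * (x ^ 2 * orbitSum) := by
    rw [← gy]
    simp only [Finset.mul_sum, Finset.sum_mul]
    exact Finset.sum_congr rfl fun i _ => by ring
  rw [hx, hy]
  generalize hu : 1 + x = u at *
  generalize hw : 1 + y = w at *
  generalize stepPoly = W at *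
  linear_combination W ^ n * u ^ (h + k) * w ^ k * x * orbitSum * hW
    + W ^ n * u ^ (h + k + 1) * w ^ (k + 1) * orbitSum * (x * y * hu - x ^ 2 * hw)

theorem labelCount_eq_constTerm (n h k : ℕ) :
    (labelCount n h k : ℂ)
      = constTerm (stepPoly ^ n * (1 + x) ^ (h + k) * (1 + y) ^ k * (x ^ 2 * y * orbitSum)) := by
  induction n generalizing h k with
  | zero =>
    rw [pow_zero, one_mul, constTerm_powers_mul_orbitSum]
    simp [labelCount]
  | succ n ih =>
    rw [stepPoly_recursion, map_add, map_add, map_add, constTerm_first_boundary,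
      constTerm_second_boundary, add_zero, add_zero, map_sum, map_sum, labelCount]
    push_cast
    congr 1
    · exact Finset.sum_congr rfl fun i _ => ih i (k + 1)
    · refine Finset.sum_congr rfl fun j hj => ?_
      rw [ih, Nat.sub_add_cancel (by have := Finset.mem_range.mp hj; omega)]

end

/-! ### The generating tree of semi-Baxter permutations -/

/-- Append the value `p` to the permutation `σ`, shifting up the values at least `p`. -/
def appendValue {n : ℕ} (p : Fin (n + 1)) (σ : Equiv.Perm (Fin n)) : Equiv.Perm (Fin (n + 1)) :=
  (finSuccEquiv' (Fin.last n)).trans ((Equiv.optionCongr σ).trans (finSuccEquiv' p).symm)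

theorem appendValue_castSucc {n : ℕ} (p : Fin (n + 1)) (σ : Equiv.Perm (Fin n)) (i : Fin n) :
    appendValue p σ i.castSucc = p.succAbove (σ i) := by
  simp [appendValue, finSuccEquiv'_last_apply_castSucc]

theorem appendValue_last {n : ℕ} (p : Fin (n + 1)) (σ : Equiv.Perm (Fin n)) :
    appendValue p σ (Fin.last n) = p := by
  simp [appendValue]

theorem appendValue_bijective (n : ℕ) :
    Function.Bijective
      (fun a : Fin (n + 1) × Equiv.Perm (Fin n) => appendValue a.1 a.2) := by
  rw [Fintype.bijective_iff_injective_and_card]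
  constructor
  · rintro ⟨p, σ⟩ ⟨q, τ⟩ h
    have hp : p = q := by
      rw [← appendValue_last p σ, ← appendValue_last q τ]
      exact congrArg (fun ρ : Equiv.Perm (Fin (n + 1)) => ρ (Fin.last n)) h
    subst hp
    congr 1
    ext i
    have := congrArg (fun ρ : Equiv.Perm (Fin (n + 1)) => ρ i.castSucc) h
    simp only [appendValue_castSucc, Fin.succAbove_right_inj] at this
    rw [this]
  · simp [Fintype.card_perm, Nat.factorial_succ]

/-- The value `q` can be appended to `σ` without creating an occurrence of 2-41-3. -/
def ActiveSite {n : ℕ} (σ : Equiv.Perm (Fin n)) (q : ℕ) : Prop :=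
  ∀ i j j' : Fin n, (i : ℕ) < j → (j' : ℕ) = j + 1 → (σ j' : ℕ) < σ i → (σ i : ℕ) < q →
    (σ j : ℕ) < q

theorem succAbove_val {n : ℕ} (p : Fin (n + 1)) (a : Fin n) :
    (p.succAbove a : ℕ) = if (a : ℕ) < p then (a : ℕ) else a + 1 := by
  simp only [Fin.succAbove, Fin.lt_def, Fin.val_castSucc]
  split_ifs <;> simp

theorem isSemiBaxter_appendValue {n : ℕ} (p : Fin (n + 1)) (σ : Equiv.Perm (Fin n)) :
    IsSemiBaxter (appendValue p σ) ↔ IsSemiBaxter σ ∧ ActiveSite σ p := by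
  constructor
  · intro h
    refine ⟨?_, ?_⟩
    · rintro ⟨i, j, j', k, h1, h2, h3, h4, h5, h6⟩
      refine h ⟨i.castSucc, j.castSucc, j'.castSucc, k.castSucc, h1, h2, h3, ?_, ?_, ?_⟩ <;>
      simpa [appendValue_castSucc]
    · intro i j j' h1 h2 h3 h4
      by_contra h5
      refine h ⟨i.castSucc, j.castSucc, j'.castSucc, Fin.last n, h1, h2, by simp, ?_, ?_, ?_⟩ <;>
      simp only [appendValue_castSucc, appendValue_last, Fin.lt_def, succAbove_val] <;>
      split_ifs <;> omega
  · rintro ⟨h, hp⟩ ⟨i, j, j', k, h1, h2, h3, h4, h5, h6⟩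
    have hj' : (j' : ℕ) < n := by have := k.isLt; omega
    obtain ⟨i, rfl⟩ : ∃ a : Fin n, i = a.castSucc := ⟨⟨i, by omega⟩, rfl⟩
    obtain ⟨j, rfl⟩ : ∃ a : Fin n, j = a.castSucc := ⟨⟨j, by omega⟩, rfl⟩
    obtain ⟨j', rfl⟩ : ∃ a : Fin n, j' = a.castSucc := ⟨⟨j', by omega⟩, rfl⟩
    induction k using Fin.lastCases with
    | last =>
      have := hp i j j' h1 h2
      simp only [appendValue_castSucc, appendValue_last, Fin.lt_def, succAbove_val] at h4 h5 h6
      split_ifs at h4 h5 h6 <;> omega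
    | cast k =>
      simp only [appendValue_castSucc, Fin.succAbove_lt_succAbove_iff] at h4 h5 h6
      exact h ⟨i, j, j', k, h1, h2, h3, h4, h5, h6⟩

theorem activeSite_appendValue_of_le {n : ℕ} (p : Fin (n + 2)) (σ : Equiv.Perm (Fin (n + 1)))
    (q : ℕ) (hq : q ≤ p) : ActiveSite (appendValue p σ) q ↔ ActiveSite σ q := by
  constructor
  · intro h i j j' h1 h2 h3 h4
    have := h i.castSucc j.castSucc j'.castSucc h1 h2
    simp only [appendValue_castSucc, succAbove_val] at this
    split_ifs at this <;> omega
  · intro h i j j' h1 h2 h3 h4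
    have hj' := j'.isLt
    obtain ⟨i, rfl⟩ : ∃ a : Fin (n + 1), i = a.castSucc := ⟨⟨i, by omega⟩, rfl⟩
    obtain ⟨j, rfl⟩ : ∃ a : Fin (n + 1), j = a.castSucc := ⟨⟨j, by omega⟩, rfl⟩
    induction j' using Fin.lastCases with
    | last => rw [appendValue_last] at h3; omega
    | cast j' =>
      have := h i j j' h1 h2
      simp only [appendValue_castSucc, succAbove_val] at h3 h4 ⊢
      split_ifs at h3 h4 ⊢ <;> omega

theorem activeSite_appendValue_succ {n : ℕ} (p : Fin (n + 2)) (σ : Equiv.Perm (Fin (n + 1)))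
    (q : ℕ) (hq : p ≤ q) : ActiveSite (appendValue p σ) (q + 1) ↔
      ActiveSite σ q ∧ ¬ (p < q ∧ q ≤ σ (Fin.last n)) := by
  constructor
  · intro h
    refine ⟨?_, ?_⟩
    · intro i j j' h1 h2 h3 h4
      have := h i.castSucc j.castSucc j'.castSucc h1 h2
      simp only [appendValue_castSucc, succAbove_val] at this
      split_ifs at this <;> omega
    · rintro ⟨h1, h2⟩
      have hl := (σ (Fin.last n)).isLt
      obtain ⟨i, hi⟩ := σ.surjective ⟨p, by omega⟩
      have hi' : (σ i : ℕ) = p := by rw [hi]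
      have hne : i ≠ Fin.last n := by rintro rfl; omega
      have := h i.castSucc (Fin.last n).castSucc (Fin.last (n + 1))
        (Fin.lt_last_iff_ne_last.mpr hne) rfl
      rw [appendValue_last, appendValue_castSucc, appendValue_castSucc, succAbove_val,
        succAbove_val] at this
      split_ifs at this <;> omega
  · rintro ⟨h, hq'⟩ i j j' h1 h2 h3 h4
    have hj' := j'.isLt
    obtain ⟨i, rfl⟩ : ∃ a : Fin (n + 1), i = a.castSucc := ⟨⟨i, by omega⟩, rfl⟩
    obtain ⟨j, rfl⟩ : ∃ a : Fin (n + 1), j = a.castSucc := ⟨⟨j, by omega⟩, rfl⟩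
    induction j' using Fin.lastCases with
    | last =>
      obtain rfl : j = Fin.last n := by
        ext
        simp only [Fin.val_last, Fin.val_castSucc] at h2 ⊢
        omega
      have hne : (σ i : ℕ) ≠ σ (Fin.last n) := fun e => by
        have := σ.injective (Fin.ext e)
        subst this
        exact lt_irrefl _ h1
      rw [appendValue_last] at h3
      simp only [appendValue_castSucc, succAbove_val] at h3 h4 ⊢
      split_ifs at h3 h4 ⊢ <;> omega
    | cast j' =>
      have := h i j j' h1 h2
      simp only [appendValue_castSucc, succAbove_val] at h3 h4 ⊢
      split_ifs at h3 h4 ⊢ <;> omega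

theorem sum_card_filter_lt {M : Type*} [AddCommMonoid M] (s : Finset ℕ) (G : ℕ → M) :
    ∑ p ∈ s, G (s.filter (· < p)).card = ∑ i ∈ Finset.range s.card, G i := by
  induction s using Finset.induction_on_max with
  | empty => simp
  | insert a s ha ih =>
    have hna : a ∉ s := fun h => lt_irrefl _ (ha a h)
    rw [Finset.sum_insert hna, Finset.card_insert_of_notMem hna, Finset.sum_range_succ, ← ih,
      add_comm]
    congr 1
    · refine Finset.sum_congr rfl fun p hp => ?_
      rw [Finset.filter_insert, if_neg (not_lt.mpr (ha p hp).le)]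
    · rw [Finset.filter_insert, if_neg (lt_irrefl a), Finset.filter_true_of_mem ha]

theorem sum_card_filter_gt {M : Type*} [AddCommMonoid M] (s : Finset ℕ) (G : ℕ → M) :
    ∑ p ∈ s, G (s.filter (p < ·)).card = ∑ i ∈ Finset.range s.card, G i := by
  induction s using Finset.induction_on_min with
  | empty => simp
  | insert a s ha ih =>
    have hna : a ∉ s := fun h => lt_irrefl _ (ha a h)
    rw [Finset.sum_insert hna, Finset.card_insert_of_notMem hna, Finset.sum_range_succ, ← ih,
      add_comm]
    congr 1
    · refine Finset.sum_congr rfl fun p hp => ?_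
      rw [Finset.filter_insert, if_neg (not_lt.mpr (ha p hp).le)]
    · rw [Finset.filter_insert, if_neg (lt_irrefl a), Finset.filter_true_of_mem ha]

open Classical in
/-- The active sites of `σ`. -/
noncomputable def activeSites {n : ℕ} (σ : Equiv.Perm (Fin n)) : Finset ℕ :=
  (Finset.range (n + 1)).filter (ActiveSite σ)

/-- The active sites weakly below the last value. -/
noncomputable def lowerSites {n : ℕ} (σ : Equiv.Perm (Fin (n + 1))) : Finset ℕ :=
  (activeSites σ).filter (· ≤ (σ (Fin.last n) : ℕ))

/-- The active sites strictly above the last value. -/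
noncomputable def upperSites {n : ℕ} (σ : Equiv.Perm (Fin (n + 1))) : Finset ℕ :=
  (activeSites σ).filter ((σ (Fin.last n) : ℕ) < ·)

theorem mem_activeSites {n : ℕ} {σ : Equiv.Perm (Fin n)} {q : ℕ} :
    q ∈ activeSites σ ↔ q < n + 1 ∧ ActiveSite σ q := by
  classical
  simp [activeSites]

theorem mem_lowerSites {n : ℕ} {σ : Equiv.Perm (Fin (n + 1))} {q : ℕ} :
    q ∈ lowerSites σ ↔ ActiveSite σ q ∧ q ≤ σ (Fin.last n) := by
  have := (σ (Fin.last n)).isLt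
  simp only [lowerSites, Finset.mem_filter, mem_activeSites]
  constructor
  · tauto
  · rintro ⟨h1, h2⟩
    exact ⟨⟨by omega, h1⟩, h2⟩

theorem mem_upperSites {n : ℕ} {σ : Equiv.Perm (Fin (n + 1))} {q : ℕ} :
    q ∈ upperSites σ ↔ (q < n + 2 ∧ ActiveSite σ q) ∧ σ (Fin.last n) < q := by
  simp only [upperSites, Finset.mem_filter, mem_activeSites]

theorem activeSite_zero {n : ℕ} (σ : Equiv.Perm (Fin n)) : ActiveSite σ 0 :=
  fun _ _ _ _ _ _ h => absurd h (Nat.not_lt_zero _)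

theorem activeSite_top {n : ℕ} (σ : Equiv.Perm (Fin n)) : ActiveSite σ n :=
  fun _ j _ _ _ _ _ => (σ j).isLt

theorem lowerSites_card_pos {n : ℕ} (σ : Equiv.Perm (Fin (n + 1))) : 0 < (lowerSites σ).card :=
  Finset.card_pos.mpr ⟨0, mem_lowerSites.mpr ⟨activeSite_zero σ, Nat.zero_le _⟩⟩

theorem upperSites_card_pos {n : ℕ} (σ : Equiv.Perm (Fin (n + 1))) : 0 < (upperSites σ).card :=
  Finset.card_pos.mpr ⟨n + 1, mem_upperSites.mpr ⟨⟨by omega, activeSite_top σ⟩,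
    (σ (Fin.last n)).isLt⟩⟩

/-- The number of descendants of `σ` in the generating tree, computed from its label. -/
noncomputable def descendants (m : ℕ) {n : ℕ} (σ : Equiv.Perm (Fin (n + 1))) : ℕ :=
  labelCount m ((lowerSites σ).card - 1) ((upperSites σ).card - 1)

theorem descendants_appendValue_of_lower (m : ℕ) {n : ℕ} (σ : Equiv.Perm (Fin (n + 1)))
    (p : Fin (n + 2)) (hp : (p : ℕ) ∈ lowerSites σ) :
    descendants m (appendValue p σ) =
      labelCount m ((lowerSites σ).filter (· < (p : ℕ))).card (upperSites σ).card := by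
  have hl := (mem_lowerSites.mp hp).2
  have h1 : lowerSites (appendValue p σ) = insert (p : ℕ) ((lowerSites σ).filter (· < (p : ℕ))) := by
    ext q
    simp only [mem_lowerSites, appendValue_last, Finset.mem_insert, Finset.mem_filter]
    constructor
    · rintro ⟨h, h'⟩
      rw [activeSite_appendValue_of_le p σ q h'] at h
      rcases h'.eq_or_lt with h' | h'
      · exact Or.inl h'
      · exact Or.inr ⟨⟨h, by omega⟩, h'⟩
    · rintro (rfl | ⟨⟨h, -⟩, h'⟩)
      · exact ⟨(activeSite_appendValue_of_le p σ _ le_rfl).mpr (mem_lowerSites.mp hp).1, le_rfl⟩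
      · exact ⟨(activeSite_appendValue_of_le p σ q h'.le).mpr h, h'.le⟩
  have h2 : upperSites (appendValue p σ)
      = insert (p + 1 : ℕ) ((upperSites σ).map (addRightEmbedding 1)) := by
    ext q
    simp only [mem_upperSites, appendValue_last, Finset.mem_insert, Finset.mem_map,
      addRightEmbedding_apply]
    constructor
    · rintro ⟨⟨h, h'⟩, h''⟩
      obtain ⟨q, rfl⟩ : ∃ r, q = r + 1 := ⟨q - 1, by omega⟩
      rw [activeSite_appendValue_succ p σ q (by omega)] at h'
      by_cases hq : q = p
      · exact Or.inl (by rw [hq])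
      · exact Or.inr ⟨q, ⟨⟨by omega, h'.1⟩, by omega⟩, rfl⟩
    · rintro (rfl | ⟨q, ⟨⟨h, h'⟩, h''⟩, rfl⟩)
      · refine ⟨⟨by omega, ?_⟩, by omega⟩
        rw [activeSite_appendValue_succ p σ p le_rfl]
        exact ⟨(mem_lowerSites.mp hp).1, by omega⟩
      · refine ⟨⟨by omega, ?_⟩, by omega⟩
        rw [activeSite_appendValue_succ p σ q (by omega)]
        exact ⟨h', by omega⟩
  rw [descendants, h1, h2, Finset.card_insert_of_notMem (by simp),
    Finset.card_insert_of_notMem, Finset.card_map, Nat.add_sub_cancel, Nat.add_sub_cancel]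
  simp only [Finset.mem_map, addRightEmbedding_apply, add_left_inj, exists_eq_right,
    mem_upperSites]
  omega

theorem descendants_appendValue_of_upper (m : ℕ) {n : ℕ} (σ : Equiv.Perm (Fin (n + 1)))
    (p : Fin (n + 2)) (hp : (p : ℕ) ∈ upperSites σ) :
    descendants m (appendValue p σ) =
      labelCount m ((lowerSites σ).card + (upperSites σ).card - 1
          - ((upperSites σ).filter ((p : ℕ) < ·)).card)
        ((upperSites σ).filter ((p : ℕ) < ·)).card := by
  have hl := (mem_upperSites.mp hp).2
  have hpa := (mem_upperSites.mp hp).1.2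
  have h1 : lowerSites (appendValue p σ)
      = lowerSites σ ∪ (upperSites σ).filter (¬ (p : ℕ) < ·) := by
    ext q
    simp only [mem_lowerSites, appendValue_last, Finset.mem_union, Finset.mem_filter,
      mem_upperSites]
    constructor
    · rintro ⟨h, h'⟩
      rw [activeSite_appendValue_of_le p σ q h'] at h
      by_cases hq : q ≤ σ (Fin.last n)
      · exact Or.inl ⟨h, hq⟩
      · exact Or.inr ⟨⟨⟨by omega, h⟩, by omega⟩, by omega⟩
    · rintro (⟨h, h'⟩ | ⟨⟨⟨h, h'⟩, -⟩, h''⟩)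
      · exact ⟨(activeSite_appendValue_of_le p σ q (by omega)).mpr h, by omega⟩
      · exact ⟨(activeSite_appendValue_of_le p σ q (by omega)).mpr h', by omega⟩
  have hd : Disjoint (lowerSites σ) ((upperSites σ).filter (¬ (p : ℕ) < ·)) := by
    rw [Finset.disjoint_left]
    intro q h h'
    have := (mem_lowerSites.mp h).2
    have := (mem_upperSites.mp (Finset.mem_filter.mp h').1).2
    omega
  have h2 : upperSites (appendValue p σ)
      = insert (p + 1 : ℕ) (((upperSites σ).filter ((p : ℕ) < ·)).map (addRightEmbedding 1)) := by
    ext q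
    simp only [mem_upperSites, appendValue_last, Finset.mem_insert, Finset.mem_map,
      addRightEmbedding_apply, Finset.mem_filter]
    constructor
    · rintro ⟨⟨h, h'⟩, h''⟩
      obtain ⟨q, rfl⟩ : ∃ r, q = r + 1 := ⟨q - 1, by omega⟩
      rw [activeSite_appendValue_succ p σ q (by omega)] at h'
      by_cases hq : q = p
      · exact Or.inl (by rw [hq])
      · exact Or.inr ⟨q, ⟨⟨⟨by omega, h'.1⟩, by omega⟩, by omega⟩, rfl⟩
    · rintro (rfl | ⟨q, ⟨⟨⟨h, h'⟩, h''⟩, hbound⟩, rfl⟩)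
      · refine ⟨⟨by omega, ?_⟩, by omega⟩
        rw [activeSite_appendValue_succ p σ p le_rfl]
        exact ⟨hpa, by omega⟩
      · refine ⟨⟨by omega, ?_⟩, by omega⟩
        rw [activeSite_appendValue_succ p σ q (by omega)]
        exact ⟨h', by omega⟩
  have hcard := Finset.card_filter_add_card_filter_not (s := upperSites σ) ((p : ℕ) < ·)
  rw [descendants, h1, h2, Finset.card_union_of_disjoint hd, Finset.card_insert_of_notMem,
    Finset.card_map, Nat.add_sub_cancel]
  · congr 1
    omega
  · simp only [Finset.mem_map, addRightEmbedding_apply, add_left_inj, exists_eq_right,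
      Finset.mem_filter]
    omega

theorem sum_descendants_appendValue (m : ℕ) {n : ℕ} (σ : Equiv.Perm (Fin (n + 1))) :
    ∑ p ∈ Finset.univ.filter (fun p : Fin (n + 2) => (p : ℕ) ∈ activeSites σ), descendants m (appendValue p σ)
      = descendants (m + 1) σ := by
  have hsplit (f : Fin (n + 2) → ℕ) (s : Finset ℕ) (hs : ∀ q ∈ s, q < n + 2) (g : ℕ → ℕ)
      (hfg : ∀ p : Fin (n + 2), (p : ℕ) ∈ s → f p = g p) :
      ∑ p ∈ Finset.univ.filter (fun p : Fin (n + 2) => (p : ℕ) ∈ s), f p = ∑ q ∈ s, g q := by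
    refine Finset.sum_bij (fun p _ => (p : ℕ)) (by simp) (fun _ _ _ _ h => Fin.ext h) ?_ ?_
    · exact fun q hq => ⟨⟨q, hs q hq⟩, by simpa using hq, rfl⟩
    · exact fun p hp => hfg p (Finset.mem_filter.mp hp).2
  have hdisj : Disjoint (Finset.univ.filter fun p : Fin (n + 2) => (p : ℕ) ∈ lowerSites σ)
      (Finset.univ.filter fun p : Fin (n + 2) => (p : ℕ) ∈ upperSites σ) := by
    rw [Finset.disjoint_left]
    intro q h h'
    have := (mem_lowerSites.mp (Finset.mem_filter.mp h).2).2
    have := (mem_upperSites.mp (Finset.mem_filter.mp h').2).2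
    omega
  have hunion : (Finset.univ.filter fun p : Fin (n + 2) => (p : ℕ) ∈ activeSites σ)
      = (Finset.univ.filter fun p : Fin (n + 2) => (p : ℕ) ∈ lowerSites σ)
        ∪ (Finset.univ.filter fun p : Fin (n + 2) => (p : ℕ) ∈ upperSites σ) := by
    ext p
    simp only [Finset.mem_union, Finset.mem_filter, lowerSites, upperSites]
    have := le_or_gt (p : ℕ) (σ (Fin.last n))
    tauto
  rw [hunion, Finset.sum_union hdisj,
    hsplit _ (lowerSites σ) ?_ (fun p => labelCount m ((lowerSites σ).filter (· < p)).card
      (upperSites σ).card) (descendants_appendValue_of_lower m σ),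
    hsplit _ (upperSites σ) ?_ (fun p => labelCount m ((lowerSites σ).card + (upperSites σ).card - 1
      - ((upperSites σ).filter (p < ·)).card) ((upperSites σ).filter (p < ·)).card) (descendants_appendValue_of_upper m σ),
    sum_card_filter_lt (lowerSites σ) (fun i => labelCount m i (upperSites σ).card),
    sum_card_filter_gt (upperSites σ) (fun j => labelCount m
      ((lowerSites σ).card + (upperSites σ).card - 1 - j) j), descendants, labelCount]
  · have := lowerSites_card_pos σ
    have := upperSites_card_pos σ
    rw [Nat.sub_add_cancel (by omega), Nat.sub_add_cancel (by omega)]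
    congr 1
    exact Finset.sum_congr rfl fun j _ => by congr 1; omega
  · exact fun q hq => (mem_upperSites.mp hq).1.1
  · intro q hq
    have := (mem_lowerSites.mp hq).2
    omega

open Classical in
theorem sum_descendants_succ (m n : ℕ) :
    ∑ τ : Equiv.Perm (Fin (n + 2)) with IsSemiBaxter τ, descendants m τ
      = ∑ σ : Equiv.Perm (Fin (n + 1)) with IsSemiBaxter σ, descendants (m + 1) σ := by
  rw [Finset.sum_filter, ← (appendValue_bijective (n + 1)).sum_comp, Fintype.sum_prod_type_right,
    Finset.sum_filter]
  refine Finset.sum_congr rfl fun σ _ => ?_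
  simp only [isSemiBaxter_appendValue]
  split_ifs with h
  · rw [← sum_descendants_appendValue, Finset.sum_filter]
    refine Finset.sum_congr rfl fun p _ => ?_
    simp only [h, true_and, mem_activeSites, p.isLt]
  · simp [h]

theorem semiBaxterCount_succ (n : ℕ) : semiBaxterCount (n + 1) = labelCount n 0 0 := by
  classical
  have hsum (k : ℕ) : ∀ m, ∑ τ : Equiv.Perm (Fin (k + 1)) with IsSemiBaxter τ, descendants m τ
      = labelCount (k + m) 0 0 := by
    induction k with
    | zero =>
      intro m
      have hs (τ : Equiv.Perm (Fin 1)) : IsSemiBaxter τ := by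
        rintro ⟨i, j, _, _, h, _⟩
        have := j.isLt
        omega
      have ha (τ : Equiv.Perm (Fin 1)) (q : ℕ) : ActiveSite τ q := by
        intro i j j' h
        have := j.isLt
        omega
      have hl (τ : Equiv.Perm (Fin 1)) : lowerSites τ = {0} := by
        ext q
        simp [mem_lowerSites, ha]
      have hu (τ : Equiv.Perm (Fin 1)) : upperSites τ = {1} := by
        ext q
        have := (τ (Fin.last 0)).isLt
        simp only [mem_upperSites, ha, Finset.mem_singleton, and_true]
        omega
      simp [hs, descendants, hl, hu]
    | succ k ih =>
      intro m
      rw [sum_descendants_succ, ih]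
      congr 1
      omega
  have h := hsum n 0
  rw [add_zero] at h
  rw [← h, semiBaxterCount, Nat.card_eq_fintype_card, Fintype.card_subtype, Finset.card_eq_sum_ones]
  rfl

section

open LaurentPolynomial

/-! ### Constant terms as integrals over a torus -/

/-- The reciprocal of the golden ratio. -/
noncomputable def lam : ℝ := (√5 - 1) / 2

theorem lam_pos : 0 < lam := by
  have : (1 : ℝ) < √5 := by rw [Real.lt_sqrt] <;> norm_num
  rw [lam]; linarith

theorem lam_sq : lam ^ 2 = 1 - lam := by
  have h : √5 ^ 2 = 5 := Real.sq_sqrt (by norm_num)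
  rw [lam]; linear_combination h / 4

theorem lam_lt_one : lam < 1 := by nlinarith [lam_sq, lam_pos]

/-- The point of argument `θ` on the circle of radius `lam`. -/
noncomputable def circlePoint (θ : ℝ) : ℂˣ :=
  Units.mk0 (lam * Complex.exp (θ * Complex.I))
    (mul_ne_zero (Complex.ofReal_ne_zero.mpr lam_pos.ne') (Complex.exp_ne_zero _))

/-- Evaluation of Laurent polynomials at a point of a torus. -/
noncomputable def torusEval (θ φ : ℝ) : LaurentTwo →+* ℂ :=
  eval₂ (eval₂ (RingHom.id ℂ) (circlePoint θ)) (circlePoint φ)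

/-- The parameter domain of the torus. -/
def torusBox : Set (ℝ × ℝ) := Set.Ioc (-π) π ×ˢ Set.Ioc (-π) π

theorem circlePoint_zpow (θ : ℝ) (m : ℤ) :
    ((circlePoint θ ^ m : ℂˣ) : ℂ) = lam ^ m * Complex.exp (m * Complex.I * θ) := by
  rw [Units.val_zpow_eq_zpow_val, circlePoint, Units.val_mk0, mul_zpow, ← Complex.exp_int_mul]
  congr 2
  ring

theorem torusEval_monomial (θ φ : ℝ) (c : ℂ) (m n : ℤ) :
    torusEval θ φ (C (C c * T m) * T n) = (c * lam ^ m * Complex.exp (m * Complex.I * θ)) *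
      (lam ^ n * Complex.exp (n * Complex.I * φ)) := by
  rw [torusEval, eval₂_C_mul_T, eval₂_C_mul_T, circlePoint_zpow, circlePoint_zpow,
    RingHom.id_apply]
  ring

theorem integral_exp_int_mul (m : ℤ) :
    ∫ θ in Set.Ioc (-π) π, Complex.exp (m * Complex.I * (θ : ℝ)) =
      if m = 0 then (2 * π : ℂ) else 0 := by
  rw [← intervalIntegral.integral_of_le (by linarith [pi_pos])]
  split_ifs with h
  · subst h
    simp
    ring
  · have hc : (m : ℂ) * Complex.I ≠ 0 := mul_ne_zero (by exact_mod_cast h) Complex.I_ne_zero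
    rw [integral_exp_mul_complex hc, div_eq_zero_iff]
    left
    rw [sub_eq_zero, Complex.exp_eq_exp_iff_exists_int]
    exact ⟨m, by push_cast; ring⟩

theorem integral_torusEval (F : LaurentTwo) :
    MeasureTheory.IntegrableOn (fun z : ℝ × ℝ => torusEval z.1 z.2 F) torusBox ∧
      ∫ z in torusBox, torusEval z.1 z.2 F = (2 * π) ^ 2 * constTerm F := by
  induction F using laurentTwo_induction with
  | hadd F G hF hG =>
    simp only [map_add]
    exact ⟨hF.1.add hG.1, by rw [MeasureTheory.integral_add hF.1 hG.1, hF.2, hG.2]; ring⟩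
  | hmono c m n =>
    simp only [torusEval_monomial]
    constructor
    · refine MeasureTheory.IntegrableOn.mono_set (t := Set.Icc (-π) π ×ˢ Set.Icc (-π) π) ?_
        (Set.prod_mono Set.Ioc_subset_Icc_self Set.Ioc_subset_Icc_self)
      refine ContinuousOn.integrableOn_compact (isCompact_Icc.prod isCompact_Icc) ?_
      fun_prop
    · rw [torusBox, MeasureTheory.Measure.volume_eq_prod, MeasureTheory.setIntegral_prod_mul
        (fun θ : ℝ => c * lam ^ m * Complex.exp (m * Complex.I * θ))
        (fun φ : ℝ => lam ^ n * Complex.exp (n * Complex.I * φ)),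
        MeasureTheory.integral_const_mul, MeasureTheory.integral_const_mul, integral_exp_int_mul,
        integral_exp_int_mul, constTerm_monomial]
      by_cases hm : m = 0 <;> by_cases hn : n = 0 <;> simp [hm, hn]
      ring

end

theorem complex_lam_sq : (lam : ℂ) ^ 2 = 1 - lam := by exact_mod_cast lam_sq

theorem lam_inv : (lam : ℂ)⁻¹ = lam + 1 := by
  have h := complex_lam_sq
  have h0 : (lam : ℂ) ≠ 0 := Complex.ofReal_ne_zero.mpr lam_pos.ne'
  field_simp
  linear_combination -h

/-- The deviation of `exp (t * I)` from `1`. -/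
noncomputable def expDev (t : ℝ) : ℂ := Complex.exp (t * Complex.I) - 1

/-- The values of `stepPoly` on the torus of radius `lam`, divided by the value at the real
point. -/
noncomputable def normStep (θ φ : ℝ) : ℂ :=
  (1 + lam ^ 2 * expDev θ) * (1 + lam ^ 2 * expDev φ) *
    (1 + lam ^ 2 * expDev (-θ) + lam ^ 2 * expDev (-φ))

/-- The values on the torus of radius `lam` of the factor `(1 + y) ^ 2 * x * y ^ (-4)`. -/
noncomputable def weight (θ φ : ℝ) : ℂ :=
  (1 + lam * Complex.exp (φ * Complex.I)) ^ 2 * (lam * Complex.exp (θ * Complex.I) *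
    (lam ^ (-4 : ℤ) * Complex.exp (-4 * φ * Complex.I)))

theorem torusEval_mono (θ φ : ℝ) (m n : ℤ) :
    torusEval θ φ (mono m n) = (lam ^ m * Complex.exp (m * Complex.I * θ)) *
      (lam ^ n * Complex.exp (n * Complex.I * φ)) := by
  have h := torusEval_monomial θ φ 1 m n
  rwa [map_one, one_mul, one_mul] at h

theorem torusEval_stepPoly (θ φ : ℝ) :
    torusEval θ φ stepPoly = (8 + 5 * lam) * normStep θ φ := by
  have hx : torusEval θ φ x = lam * Complex.exp (θ * Complex.I) := by
    have := torusEval_mono θ φ 1 0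
    simpa [mono, x, mul_comm] using this
  have hy : torusEval θ φ y = lam * Complex.exp (φ * Complex.I) := by
    have := torusEval_mono θ φ 0 1
    simpa [mono, y, mul_comm] using this
  have hxi : torusEval θ φ xi = (lam + 1) * Complex.exp (-θ * Complex.I) := by
    have := torusEval_mono θ φ (-1) 0
    simpa [mono, xi, mul_comm, lam_inv] using this
  have hyi : torusEval θ φ yi = (lam + 1) * Complex.exp (-φ * Complex.I) := by
    have := torusEval_mono θ φ 0 (-1)
    simpa [mono, yi, mul_comm, lam_inv] using this
  rw [stepPoly, map_mul, map_mul, map_add, map_add, map_add, map_add, hx, hy, hxi, hyi, map_one,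
    normStep, expDev, expDev, expDev, expDev, Complex.ofReal_neg, Complex.ofReal_neg]
  generalize Complex.exp (θ * Complex.I) = e
  generalize Complex.exp (φ * Complex.I) = f
  generalize Complex.exp (-θ * Complex.I) = e'
  generalize Complex.exp (-φ * Complex.I) = f'
  have h := complex_lam_sq
  generalize (lam : ℂ) = a at h ⊢
  have h1 (t : ℂ) : 1 + a * t = (1 + a) * (1 + a ^ 2 * (t - 1)) := by
    linear_combination (-(t - 1) * a) * h
  have h2 : 1 + (a + 1) * e' + (a + 1) * f' =
      (3 + 2 * a) * (1 + a ^ 2 * (e' - 1) + a ^ 2 * (f' - 1)) := by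
    linear_combination (-(2 * a + 1) * (e' + f' - 2)) * h
  have h3 : (1 + a) * (1 + a) * (3 + 2 * a) = 8 + 5 * a := by
    linear_combination (5 + 2 * a) * h
  rw [h1 e, h1 f, h2, ← h3]
  ring

theorem torusEval_weight (θ φ : ℝ) :
    torusEval θ φ ((1 + y) ^ 2 * mono 1 (-4)) = weight θ φ := by
  have hy : torusEval θ φ y = lam * Complex.exp (φ * Complex.I) := by
    have := torusEval_mono θ φ 0 1
    simpa [mono, y, mul_comm] using this
  rw [map_mul, map_pow, map_add, map_one, hy, torusEval_mono, weight, zpow_one, Int.cast_one,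
    one_mul, mul_comm Complex.I]
  congr 4
  push_cast
  ring

theorem constTerm_eq_integral (N : ℕ) :
    constTerm (stepPoly ^ N * ((1 + y) ^ 2 * mono 1 (-4))) = (8 + 5 * lam) ^ N / (2 * π) ^ 2 *
      ∫ z in torusBox, normStep z.1 z.2 ^ N * weight z.1 z.2 := by
  have h := (integral_torusEval (stepPoly ^ N * ((1 + y) ^ 2 * mono 1 (-4)))).2
  have h0 : (π : ℂ) ≠ 0 := Complex.ofReal_ne_zero.mpr pi_ne_zero
  simp only [map_mul, map_pow, torusEval_stepPoly, mul_pow (8 + 5 * (lam : ℂ)), mul_assoc] at h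
  simp only [← map_pow, ← map_mul, torusEval_weight] at h
  rw [MeasureTheory.integral_const_mul] at h
  rw [div_mul_eq_mul_div, h]
  field_simp

/-! ### Bounds for the integrand -/

theorem norm_one_add_expDev_sq (p t : ℝ) :
    ‖1 + p * expDev t‖ ^ 2 = 1 - 2 * p * (1 - p) * (1 - cos t) := by
  have : 1 + p * expDev t = ((1 - p + p * cos t : ℝ) : ℂ) + ((p * sin t : ℝ) : ℂ) * Complex.I := by
    rw [expDev, Complex.exp_mul_I]
    push_cast
    ring
  rw [this, Complex.sq_norm, Complex.normSq_add_mul_I]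
  linear_combination p ^ 2 * sin_sq_add_cos_sq t

/-- The rate of Gaussian decay used to dominate the integrand. -/
noncomputable def decayRate : ℝ := 2 * lam ^ 3 / π ^ 2

theorem norm_one_add_expDev_le {t : ℝ} (ht : |t| ≤ π) :
    ‖1 + lam ^ 2 * expDev t‖ ≤ exp (-decayRate * t ^ 2) := by
  have h := norm_one_add_expDev_sq (lam ^ 2) t
  push_cast at h
  have hc := cos_le_one_sub_mul_cos_sq ht
  have hl : lam ^ 2 * (1 - lam ^ 2) = lam ^ 3 := by
    linear_combination (-lam ^ 2) * lam_sq
  have hp : 0 < lam ^ 3 := pow_pos lam_pos 3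
  refine (pow_le_pow_iff_left₀ (norm_nonneg _) (exp_pos _).le two_ne_zero).mp ?_
  rw [← exp_nat_mul, h]
  refine le_trans ?_ (add_one_le_exp _)
  rw [decayRate]
  have : (2 : ℝ) * lam ^ 2 * (1 - lam ^ 2) = 2 * lam ^ 3 := by linarith
  rw [this]
  have h2 : 2 * lam ^ 3 * (2 / π ^ 2 * t ^ 2) ≤ 2 * lam ^ 3 * (1 - cos t) := by
    gcongr
    linarith
  push_cast
  have h3 : 2 * (-(2 * lam ^ 3 / π ^ 2) * t ^ 2) = - (2 * lam ^ 3 * (2 / π ^ 2 * t ^ 2)) := by ring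
  linarith

theorem norm_normStep_le {θ φ : ℝ} (hθ : |θ| ≤ π) (hφ : |φ| ≤ π) :
    ‖normStep θ φ‖ ≤ exp (-decayRate * θ ^ 2) * exp (-decayRate * φ ^ 2) := by
  have h3 : ‖1 + lam ^ 2 * expDev (-θ) + lam ^ 2 * expDev (-φ)‖ ≤ 1 := by
    have hl : 0 ≤ 1 - 2 * lam ^ 2 := by
      have := lam_sq
      have h5 : (√5 : ℝ) ^ 2 = 5 := Real.sq_sqrt (by norm_num)
      have h2 : (2 : ℝ) ≤ √5 := by rw [Real.le_sqrt] <;> norm_num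
      rw [lam] at this ⊢
      nlinarith
    have : 1 + lam ^ 2 * expDev (-θ) + lam ^ 2 * expDev (-φ) =
        ((1 - 2 * lam ^ 2 : ℝ) : ℂ) + ((lam ^ 2 : ℝ) : ℂ) * Complex.exp ((-θ : ℝ) * Complex.I)
          + ((lam ^ 2 : ℝ) : ℂ) * Complex.exp ((-φ : ℝ) * Complex.I) := by
      rw [expDev, expDev]
      push_cast
      ring
    rw [this]
    refine (norm_add₃_le).trans ?_
    rw [norm_mul, norm_mul, Complex.norm_exp_ofReal_mul_I, Complex.norm_exp_ofReal_mul_I,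
      Complex.norm_of_nonneg hl, Complex.norm_of_nonneg (sq_nonneg lam)]
    linarith
  rw [normStep, norm_mul, norm_mul]
  refine (mul_le_of_le_one_right (by positivity) h3).trans ?_
  gcongr
  · exact norm_one_add_expDev_le hθ
  · exact norm_one_add_expDev_le hφ

theorem norm_weight_le (θ φ : ℝ) : ‖weight θ φ‖ ≤ (1 + lam) ^ 2 * (lam * lam ^ (-4 : ℤ)) := by
  have h0 := lam_pos
  have h4 : (-4 * φ * Complex.I : ℂ) = ((-4 * φ : ℝ) : ℂ) * Complex.I := by push_cast; ring
  have h1 : ‖(lam : ℂ)‖ = lam := Complex.norm_of_nonneg h0.le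
  rw [weight, h4, norm_mul, norm_mul, norm_mul, norm_mul, norm_pow, norm_zpow,
    Complex.norm_exp_ofReal_mul_I, Complex.norm_exp_ofReal_mul_I, h1, mul_one, mul_one]
  gcongr
  refine (norm_add_le _ _).trans ?_
  rw [norm_mul, Complex.norm_exp_ofReal_mul_I, h1, norm_one, mul_one]

/-! ### A two-dimensional Gaussian integral -/

theorem integrable_exp_quadratic {α β : ℝ} (hβ : 0 ≤ β) (h : β < 2 * α) :
    MeasureTheory.Integrable
      fun w : ℝ × ℝ => exp (-α * (w.1 ^ 2 + w.2 ^ 2) + β * (w.1 * w.2)) := by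
  have h0 : 0 < α - β / 2 := by linarith
  refine ((integrable_exp_neg_mul_sq h0).mul_prod (integrable_exp_neg_mul_sq h0)).mono'
    (by fun_prop) (Eventually.of_forall fun w => ?_)
  rw [Real.norm_of_nonneg (exp_pos _).le, ← exp_add, exp_le_exp]
  nlinarith [mul_nonneg hβ (sq_nonneg (w.1 - w.2))]

theorem integral_exp_quadratic {α β : ℝ} (hβ : 0 ≤ β) (h : β < 2 * α) :
    ∫ w : ℝ × ℝ, exp (-α * (w.1 ^ 2 + w.2 ^ 2) + β * (w.1 * w.2)) =
      2 * π / √(4 * α ^ 2 - β ^ 2) := by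
  have hα : 0 < α := by linarith
  have hd : 0 < 4 * α ^ 2 - β ^ 2 := by nlinarith
  have key (a b : ℝ) : exp (-α * (a ^ 2 + b ^ 2) + β * (a * b)) =
      exp (-(α - β ^ 2 / (4 * α)) * a ^ 2) * exp (-α * (b - β * a / (2 * α)) ^ 2) := by
    rw [← exp_add]
    congr 1
    field_simp
    ring
  have hquad := integrable_exp_quadratic hβ h
  rw [MeasureTheory.Measure.volume_eq_prod] at hquad ⊢
  rw [MeasureTheory.integral_prod _ hquad]
  simp only [key, MeasureTheory.integral_const_mul]
  simp only [MeasureTheory.integral_sub_right_eq_self (fun b : ℝ => exp (-α * b ^ 2)),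
    integral_gaussian, MeasureTheory.integral_mul_const]
  have hg : α - β ^ 2 / (4 * α) = (4 * α ^ 2 - β ^ 2) / (4 * α) := by
    field_simp
  rw [← Real.sqrt_mul (by rw [hg]; positivity), hg, eq_div_iff (by positivity),
    ← Real.sqrt_mul (by positivity), Real.sqrt_eq_iff_mul_self_eq (by positivity) (by positivity)]
  field_simp
  ring

/-! ### The scaling limit of the integrand -/

theorem expDev_add_expDev_neg (t : ℝ) : expDev t + expDev (-t) = -(expDev t * expDev (-t)) := by
  have h : Complex.exp (t * Complex.I) * Complex.exp (((-t : ℝ) : ℂ) * Complex.I) = 1 := by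
    rw [← Complex.exp_add]
    simp
  rw [expDev, expDev]
  linear_combination h

theorem tendsto_sqrt_inv : Tendsto (fun N : ℕ => (√(N : ℝ))⁻¹) atTop (nhds 0) :=
  tendsto_inv_atTop_zero.comp (tendsto_sqrt_atTop.comp tendsto_natCast_atTop_atTop)

theorem tendsto_sqrt_mul_expDev (a : ℝ) :
    Tendsto (fun N : ℕ => (√(N : ℝ) : ℂ) * expDev ((√(N : ℝ))⁻¹ * a)) atTop
      (nhds (a * Complex.I)) := by
  have hd : HasDerivAt (fun s : ℝ => expDev (s * a)) (a * Complex.I) 0 := by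
    have h1 : HasDerivAt (fun s : ℝ => ((s * a : ℝ) : ℂ) * Complex.I) (a * Complex.I) 0 := by
      have := ((hasDerivAt_id (0 : ℝ)).mul_const a).ofReal_comp.mul_const Complex.I
      simpa using this
    have h2 := h1.cexp.sub_const 1
    simpa [expDev] using h2
  have hs : Tendsto (fun N : ℕ => (√(N : ℝ))⁻¹) atTop (nhdsWithin 0 {0}ᶜ) := by
    refine tendsto_nhdsWithin_iff.mpr ⟨tendsto_sqrt_inv, ?_⟩
    filter_upwards [eventually_gt_atTop 0] with N hN
    have : (0 : ℝ) < N := by exact_mod_cast hN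
    exact (inv_pos.mpr (Real.sqrt_pos.mpr this)).ne'
  refine (hd.tendsto_slope_zero.comp hs).congr fun N => ?_
  simp [expDev]

theorem tendsto_normStep_pow (a b : ℝ) :
    Tendsto (fun N : ℕ => normStep ((√(N : ℝ))⁻¹ * a) ((√(N : ℝ))⁻¹ * b) ^ N) atTop
      (nhds ((exp (-lam ^ 3 * (a ^ 2 + b ^ 2) + lam ^ 4 * (a * b)) : ℝ) : ℂ)) := by
  have ha := tendsto_sqrt_mul_expDev a
  have hb := tendsto_sqrt_mul_expDev b
  have ha' := tendsto_sqrt_mul_expDev (-a)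
  have hb' := tendsto_sqrt_mul_expDev (-b)
  have hz (c : ℝ) : Tendsto (fun N : ℕ => expDev ((√(N : ℝ))⁻¹ * c)) atTop (nhds 0) := by
    have hc : Continuous expDev := by unfold expDev; fun_prop
    have h0 : expDev 0 = 0 := by simp [expDev]
    have hs := tendsto_sqrt_inv.mul_const c
    rw [zero_mul] at hs
    rw [← h0]
    exact (hc.tendsto 0).comp hs
  have hlim := (((ha.mul ha').add (hb.mul hb')).const_mul (-(lam : ℂ) ^ 2)).add
    (((ha.mul hb).add ((ha.add hb).mul (ha'.add hb'))).const_mul ((lam : ℂ) ^ 4)) |>.add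
    (((ha.mul hb).mul ((hz (-a)).add (hz (-b)))).const_mul ((lam : ℂ) ^ 6))
  have hexp : Tendsto (fun N : ℕ => (N : ℂ) *
      (normStep ((√(N : ℝ))⁻¹ * a) ((√(N : ℝ))⁻¹ * b) - 1)) atTop
      (nhds ((-lam ^ 3 * (a ^ 2 + b ^ 2) + lam ^ 4 * (a * b) : ℝ) : ℂ)) := by
    convert hlim using 2 with N
    · have hN : (N : ℂ) = (√(N : ℝ) : ℂ) ^ 2 := by
        rw [← Complex.ofReal_pow, Real.sq_sqrt (Nat.cast_nonneg N), Complex.ofReal_natCast]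
      have h1 := expDev_add_expDev_neg ((√(N : ℝ))⁻¹ * a)
      have h2 := expDev_add_expDev_neg ((√(N : ℝ))⁻¹ * b)
      rw [mul_neg, mul_neg, normStep, hN]
      linear_combination (√(N : ℝ) : ℂ) ^ 2 * (lam : ℂ) ^ 2 * (h1 + h2)
    · push_cast
      have h := complex_lam_sq
      linear_combination (-lam ^ 2 * (a ^ 2 + b ^ 2) : ℂ) * h -
        (lam ^ 2 * (a ^ 2 + b ^ 2) - lam ^ 4 * (a ^ 2 + a * b + b ^ 2) : ℂ) * Complex.I_sq
  have := Complex.tendsto_one_add_pow_exp_of_tendsto hexp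
  rw [← Complex.ofReal_exp] at this
  simpa using this

/-- The rescaled integrand. -/
noncomputable def scaledIntegrand (N : ℕ) (w : ℝ × ℝ) : ℂ :=
  torusBox.indicator (fun z => normStep z.1 z.2 ^ N * weight z.1 z.2) ((√(N : ℝ))⁻¹ • w)

theorem measurableSet_torusBox : MeasurableSet torusBox :=
  measurableSet_Ioc.prod measurableSet_Ioc

theorem torusBox_mem_nhds : torusBox ∈ nhds (0 : ℝ × ℝ) := by
  have h : Set.Ioc (-π) π ∈ nhds (0 : ℝ) :=
    Ioc_mem_nhds (by linarith [pi_pos]) pi_pos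
  exact prod_mem_nhds h h

theorem integral_scaledIntegrand (N : ℕ) :
    ∫ w, scaledIntegrand N w =
      N * ∫ z in torusBox, normStep z.1 z.2 ^ N * weight z.1 z.2 := by
  unfold scaledIntegrand
  rw [MeasureTheory.Measure.integral_comp_inv_smul_of_nonneg _ _ (Real.sqrt_nonneg _),
    MeasureTheory.integral_indicator measurableSet_torusBox]
  simp

theorem continuous_weight : Continuous fun z : ℝ × ℝ => weight z.1 z.2 := by
  unfold weight
  fun_prop

theorem continuous_integrand (N : ℕ) :
    Continuous fun z : ℝ × ℝ => normStep z.1 z.2 ^ N * weight z.1 z.2 := by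
  refine Continuous.mul ?_ continuous_weight
  unfold normStep expDev
  fun_prop

theorem decayRate_pos : 0 < decayRate := by
  have := lam_pos
  unfold decayRate
  positivity

theorem norm_scaledIntegrand_le {N : ℕ} (hN : 0 < N) (w : ℝ × ℝ) :
    ‖scaledIntegrand N w‖ ≤ exp (-decayRate * w.1 ^ 2) * exp (-decayRate * w.2 ^ 2) *
      ((1 + lam) ^ 2 * (lam * lam ^ (-4 : ℤ))) := by
  have h0 := lam_pos
  have hN' : (0 : ℝ) < N := by exact_mod_cast hN
  rw [scaledIntegrand]
  by_cases h : (√(N : ℝ))⁻¹ • w ∈ torusBox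
  · rw [Set.indicator_of_mem h, norm_mul, norm_pow]
    have hb (t : ℝ) : exp (-decayRate * t ^ 2) =
        exp (-decayRate * ((√(N : ℝ))⁻¹ * t) ^ 2) ^ N := by
      rw [← exp_nat_mul, mul_pow, inv_pow, Real.sq_sqrt hN'.le]
      congr 1
      field_simp
    rw [hb w.1, hb w.2, ← mul_pow]
    gcongr
    · exact norm_normStep_le (abs_le.mpr ⟨h.1.1.le, h.1.2⟩) (abs_le.mpr ⟨h.2.1.le, h.2.2⟩)
    · exact norm_weight_le _ _
  · rw [Set.indicator_of_notMem h, norm_zero]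
    positivity

theorem tendsto_scaledIntegrand (w : ℝ × ℝ) :
    Tendsto (fun N => scaledIntegrand N w) atTop
      (nhds (((exp (-lam ^ 3 * (w.1 ^ 2 + w.2 ^ 2) + lam ^ 4 * (w.1 * w.2)) : ℝ) : ℂ)
        * weight 0 0)) := by
  have hz : Tendsto (fun N : ℕ => (√(N : ℝ))⁻¹ • w) atTop (nhds 0) := by
    simpa using tendsto_sqrt_inv.smul_const w
  have hw := (continuous_weight.tendsto 0).comp hz
  refine ((tendsto_normStep_pow w.1 w.2).mul hw).congr' ?_
  filter_upwards [hz torusBox_mem_nhds] with N hN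
  change (√(N : ℝ))⁻¹ • w ∈ torusBox at hN
  rw [scaledIntegrand, Set.indicator_of_mem hN]
  rfl

theorem tendsto_integral_scaledIntegrand :
    Tendsto (fun N => ∫ w, scaledIntegrand N w) atTop
      (nhds (((2 * π / √(4 * (lam ^ 3) ^ 2 - (lam ^ 4) ^ 2) : ℝ) : ℂ) * weight 0 0)) := by
  have h0 := lam_pos
  have h1 : lam ^ 4 < 2 * lam ^ 3 := by nlinarith [lam_lt_one, pow_pos h0 3]
  rw [← integral_exp_quadratic (by positivity) h1, ← integral_complex_ofReal,
    ← MeasureTheory.integral_mul_const]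
  have hg := integrable_exp_neg_mul_sq decayRate_pos
  refine MeasureTheory.tendsto_integral_filter_of_dominated_convergence _ ?_ ?_
    ((hg.mul_prod hg).mul_const ((1 + lam) ^ 2 * (lam * lam ^ (-4 : ℤ)))) ?_
  · refine Eventually.of_forall fun N => ?_
    have hm := ((continuous_integrand N).stronglyMeasurable.indicator measurableSet_torusBox)
    exact (hm.comp_measurable (measurable_const_smul (√(N : ℝ))⁻¹)).aestronglyMeasurable
  · filter_upwards [eventually_gt_atTop 0] with N hN
    exact Eventually.of_forall fun w => norm_scaledIntegrand_le hN w
  · exact Eventually.of_forall tendsto_scaledIntegrand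

theorem semiBaxterCount_scaled_eq {n : ℕ} (hn : 0 < n) :
    (((semiBaxterCount (n + 1) : ℝ) * ((n + 1 : ℕ) : ℝ) ^ 6 / (8 + 5 * lam) ^ (n + 1) : ℝ) : ℂ) =
      (((1 + 1 / n) ^ 3 / ((1 + 2 / n) * (1 + 3 / n)) : ℝ) : ℂ) *
        (24 / (2 * π) ^ 2 * ∫ w, scaledIntegrand (n + 1) w) := by
  have h := constTerm_orbitSum_eq n
  have hl := labelCount_eq_constTerm n 0 0
  simp only [pow_zero, add_zero, mul_one] at hl
  rw [constTerm_eq_integral, ← hl] at h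
  have hμ : (8 + 5 * lam : ℂ) ≠ 0 := by
    have := lam_pos
    have h1 : 8 + 5 * lam ≠ 0 := by positivity
    exact_mod_cast h1
  have hp : (π : ℂ) ≠ 0 := Complex.ofReal_ne_zero.mpr pi_ne_zero
  have h0 : (n : ℂ) ≠ 0 := by exact_mod_cast hn.ne'
  have h1 : (n : ℂ) + 1 ≠ 0 := by exact_mod_cast Nat.succ_ne_zero n
  have h2 : (n : ℂ) + 2 ≠ 0 := by exact_mod_cast Nat.succ_ne_zero (n + 1)
  have h3 : (n : ℂ) + 3 ≠ 0 := by exact_mod_cast Nat.succ_ne_zero (n + 2)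
  rw [integral_scaledIntegrand, semiBaxterCount_succ]
  push_cast
  generalize (∫ z in torusBox, normStep z.1 z.2 ^ (n + 1) * weight z.1 z.2) = J at h ⊢
  rw [div_eq_iff (pow_ne_zero _ hμ)]
  generalize (8 + 5 * lam : ℂ) ^ (n + 1) = M at h ⊢
  field_simp at h ⊢
  linear_combination h

theorem tendsto_rational_factor :
    Tendsto (fun n : ℕ => ((1 + 1 / n) ^ 3 / ((1 + 2 / n) * (1 + 3 / n)) : ℝ)) atTop (nhds 1) := by
  have h (c : ℝ) : Tendsto (fun n : ℕ => 1 + c / n) atTop (nhds 1) := by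
    simpa using (tendsto_const_div_atTop_nhds_zero_nat c).const_add 1
  have := ((h 1).pow 3).div ((h 2).mul (h 3)) (by norm_num)
  rwa [one_pow, mul_one, div_one] at this

theorem limit_eq :
    24 / (2 * π : ℂ) ^ 2 * (((2 * π / √(4 * (lam ^ 3) ^ 2 - (lam ^ 4) ^ 2) : ℝ) : ℂ) * weight 0 0) =
      (((12 / π) * (5 : ℝ) ^ (-(1 / 4) : ℝ) * lam ^ (-(15 / 2) : ℝ) : ℝ) : ℂ) := by
  have h0 := lam_pos
  have hq := lam_sq
  have h5 : √5 = 2 * lam + 1 := by rw [lam]; ring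
  have hd : 4 * (lam ^ 3) ^ 2 - (lam ^ 4) ^ 2 = √5 * lam ^ 5 := by
    rw [h5]
    linear_combination (-lam ^ 6 + lam ^ 5) * hq
  have hs : √(4 * (lam ^ 3) ^ 2 - (lam ^ 4) ^ 2) = 5 ^ (1 / 4 : ℝ) * lam ^ (5 / 2 : ℝ) := by
    rw [hd, Real.sqrt_mul (by positivity), Real.sqrt_eq_rpow, Real.sqrt_eq_rpow,
      Real.sqrt_eq_rpow, ← Real.rpow_mul (by norm_num), ← Real.rpow_natCast,
      ← Real.rpow_mul h0.le]
    norm_num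
  have hw : weight 0 0 = ((lam ^ (-5 : ℝ) : ℝ) : ℂ) := by
    have hi : 1 + lam = lam⁻¹ := by
      field_simp
      linear_combination hq
    have : weight 0 0 = (((1 + lam) ^ 2 * (lam * lam ^ (-4 : ℤ)) : ℝ) : ℂ) := by
      simp [weight]
    rw [this, hi]
    congr 1
    rw [show (-5 : ℝ) = ((-5 : ℤ) : ℝ) by norm_num, Real.rpow_intCast]
    field_simp
  rw [hs, hw, show (-(15 / 2) : ℝ) = -(5 / 2) + -5 by norm_num, Real.rpow_add h0,
    Real.rpow_neg h0.le (5 / 2), Real.rpow_neg (by norm_num : (0 : ℝ) ≤ 5)]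
  have hp := pi_pos
  have h4 : 0 < (5 : ℝ) ^ (1 / 4 : ℝ) := by positivity
  have h6 : 0 < lam ^ (5 / 2 : ℝ) := by positivity
  generalize (5 : ℝ) ^ (1 / 4 : ℝ) = u at h4 ⊢
  generalize lam ^ (5 / 2 : ℝ) = v at h6 ⊢
  generalize lam ^ (-5 : ℝ) = t
  have hc : 24 / (2 * π : ℂ) ^ 2 = ((24 / (2 * π) ^ 2 : ℝ) : ℂ) := by push_cast; rfl
  rw [hc, ← Complex.ofReal_mul, ← Complex.ofReal_mul]
  congr 1
  field_simp
  ring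

end SemiBaxter

/-- Corollary 3.17: the asymptotic behavior of the semi-Baxter numbers,
`SB_n ~ A μⁿ / n⁶` with `λ = (√5−1)/2`, `μ = (11+5√5)/2`,
`A = (12/π) 5^(−1/4) λ^(−15/2)`. -/
theorem semiBaxter_asymptotics :
    Filter.Tendsto
      (fun n : ℕ => (semiBaxterCount n : ℝ) * (n : ℝ) ^ 6 /
        (((11 : ℝ) + 5 * Real.sqrt 5) / 2) ^ n)
      Filter.atTop
      (nhds ((12 / Real.pi) * (5 : ℝ) ^ (-(1 / 4) : ℝ) *
        ((Real.sqrt 5 - 1) / 2) ^ (-(15 / 2) : ℝ))) := by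
  have hμ : ((11 : ℝ) + 5 * √5) / 2 = 8 + 5 * SemiBaxter.lam := by rw [SemiBaxter.lam]; ring
  rw [hμ, ← tendsto_add_atTop_iff_nat 1, ← Filter.tendsto_ofReal_iff]
  have hr : Tendsto (fun n : ℕ => (((1 + 1 / n) ^ 3 / ((1 + 2 / n) * (1 + 3 / n)) : ℝ) : ℂ)) atTop
      (nhds ((1 : ℝ) : ℂ)) :=
    (Complex.continuous_ofReal.tendsto 1).comp SemiBaxter.tendsto_rational_factor
  have hi := (tendsto_add_atTop_iff_nat 1).mpr SemiBaxter.tendsto_integral_scaledIntegrand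
  have := hr.mul (hi.const_mul (24 / (2 * π : ℂ) ^ 2))
  rw [SemiBaxter.limit_eq, Complex.ofReal_one, one_mul] at this
  refine this.congr' ?_
  filter_upwards [eventually_gt_atTop 0] with n hn
  exact (SemiBaxter.semiBaxterCount_scaled_eq hn).symm
end

section
/- Let SB_n denote the number of semi-Baxter permutations of size n. For every n ≥ 2, the following identity holds in ℤ: (n−1)·SB_n = Σ_{j=0}^{n} binomial(n−1,j)·[ binomial(n−1,j+1)·( binomial(n+j+1,j+5) + 2·binomial(n+j+1,j) ) + 2·binomial(n−1,j+2)·( −binomial(n+j+2,j+5) + binomial(n+j+1,j+3) − binomial(n+j+2,j+2) + binomial(n+j+1,j) ) + 3·binomial(n−1,j+3)·( binomial(n+j+2,j+4) − binomial(n+j+2,j+2) ) ]. (Corollary 3.15.) -/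
section

open Equiv Finset

/-- Append a new last entry with value `c`, shifting the values `≥ c` up by one. -/
def appendLast {n : ℕ} (σ : Perm (Fin n)) (c : Fin (n + 1)) : Perm (Fin (n + 1)) :=
  (finSuccEquiv' (Fin.last n)).trans ((Equiv.optionCongr σ).trans (finSuccEquiv' c).symm)

lemma appendLast_castSucc {n : ℕ} (σ : Perm (Fin n)) (c : Fin (n + 1)) (i : Fin n) :
    appendLast σ c i.castSucc = c.succAbove (σ i) := by
  have h : finSuccEquiv' (Fin.last n) i.castSucc = some i := by
    rw [← Fin.succAbove_last, finSuccEquiv'_succAbove]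
  simp [appendLast, h]

lemma appendLast_last {n : ℕ} (σ : Perm (Fin n)) (c : Fin (n + 1)) :
    appendLast σ c (Fin.last n) = c := by
  simp [appendLast]

lemma appendLast_bijective (n : ℕ) :
    Function.Bijective (fun p : Perm (Fin n) × Fin (n + 1) => appendLast p.1 p.2) := by
  rw [Fintype.bijective_iff_injective_and_card]
  constructor
  · rintro ⟨σ, c⟩ ⟨τ, d⟩ h
    simp only at h
    have hc : c = d := by rw [← appendLast_last σ c, h, appendLast_last]
    subst hc
    have : σ = τ := by
      ext1 i
      have := congrArg (fun e => e i.castSucc) h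
      simpa [appendLast_castSucc] using this
    rw [this]
  · simp [Fintype.card_perm, Nat.factorial_succ, mul_comm]

/-- The value `g` is an active site of `σ`: appending it creates no new pattern 2-41-3. -/
def IsActive {n : ℕ} (σ : Perm (Fin n)) (g : ℕ) : Prop :=
  ∀ i j j' : Fin n, (i : ℕ) < j → (j' : ℕ) = j + 1 → σ j' < σ i → (σ i : ℕ) < g →
    (σ j : ℕ) < g

lemma succAbove_val {n : ℕ} (c : Fin (n + 1)) (v : Fin n) :
    (c.succAbove v : ℕ) = if (v : ℕ) < c then (v : ℕ) else v + 1 := by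
  simp only [Fin.succAbove, Fin.lt_def, Fin.val_castSucc]
  split_ifs <;> simp

lemma isSemiBaxter_appendLast {n : ℕ} (σ : Perm (Fin n)) (c : Fin (n + 1)) :
    IsSemiBaxter (appendLast σ c) ↔ IsSemiBaxter σ ∧ IsActive σ c := by
  constructor
  · intro h
    constructor
    · rintro ⟨i, j, j', k, h1, h2, h3, h4, h5, h6⟩
      refine h ⟨i.castSucc, j.castSucc, j'.castSucc, k.castSucc, h1, h2, h3, ?_, ?_, ?_⟩ <;>
        simpa [appendLast_castSucc]
    · intro i j j' h1 h2 h3 h4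
      by_contra h5
      refine h ⟨i.castSucc, j.castSucc, j'.castSucc, Fin.last n, h1, h2, j'.2, ?_, ?_, ?_⟩
      · simpa [appendLast_castSucc]
      · simp only [appendLast_castSucc, appendLast_last, Fin.lt_def, succAbove_val]
        split_ifs; omega
      · simp only [appendLast_castSucc, appendLast_last, Fin.lt_def, succAbove_val]
        split_ifs; omega
  · rintro ⟨h, ha⟩ ⟨i, j, j', k, h1, h2, h3, h4, h5, h6⟩
    have hj' : (j' : ℕ) < n := by have := k.2; omega
    obtain ⟨i, rfl⟩ : ∃ i' : Fin n, i = i'.castSucc := ⟨⟨i, by omega⟩, rfl⟩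
    obtain ⟨j, rfl⟩ : ∃ i' : Fin n, j = i'.castSucc := ⟨⟨j, by omega⟩, rfl⟩
    obtain ⟨j', rfl⟩ : ∃ i' : Fin n, j' = i'.castSucc := ⟨⟨j', by omega⟩, rfl⟩
    induction k using Fin.lastCases with
    | last =>
      simp only [appendLast_castSucc, appendLast_last, Fin.succAbove_lt_succAbove_iff] at h4 h5 h6
      have := ha i j j' h1 h2 h4
      simp only [Fin.lt_def, succAbove_val] at h5 h6
      split_ifs at h5 h6 <;> omega
    | cast k =>
      simp only [appendLast_castSucc, Fin.succAbove_lt_succAbove_iff] at h4 h5 h6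
      exact h ⟨i, j, j', k, h1, h2, h3, h4, h5, h6⟩

lemma succAbove_val_lt_iff {n : ℕ} (c : Fin (n + 1)) (v : Fin n) (g : ℕ) :
    (c.succAbove v : ℕ) < g ↔ (v : ℕ) < if g ≤ c then g else g - 1 := by
  rw [succAbove_val]
  split_ifs <;> omega

lemma isActive_appendLast {n : ℕ} (σ : Perm (Fin (n + 1))) (c : Fin (n + 2)) (g : ℕ) :
    IsActive (appendLast σ c) g ↔ IsActive σ (if g ≤ c then g else g - 1) ∧
      ((c : ℕ) ≤ σ (Fin.last n) → g ≤ c + 1 ∨ (σ (Fin.last n) : ℕ) + 1 < g) := by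
  constructor
  · intro h
    constructor
    · intro i j j' h1 h2 h3 h4
      have := h i.castSucc j.castSucc j'.castSucc h1 h2 (by simpa [appendLast_castSucc])
      simp only [appendLast_castSucc, succAbove_val_lt_iff] at this
      exact this h4
    · intro hc
      by_contra! hg
      obtain ⟨i, hi⟩ := σ.surjective ⟨c, by omega⟩
      have hiv : (σ i : ℕ) = c := by rw [hi]
      have hil : (i : ℕ) < n := by
        have h1 := i.2
        by_contra h2
        have : i = Fin.last n := by ext; simp; omega
        rw [this] at hiv
        omega
      have := h i.castSucc (Fin.last n).castSucc (Fin.last (n + 1)) hil rfl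
      simp only [appendLast_castSucc, appendLast_last, Fin.lt_def,
        succAbove_val, hiv] at this
      simp only [lt_irrefl, if_false] at this
      split_ifs at this <;> omega
  · rintro ⟨ha, hc⟩ i j j' h1 h2 h3 h4
    have hj : (j : ℕ) < n + 1 := by have := j'.2; omega
    obtain ⟨i, rfl⟩ : ∃ i' : Fin (n + 1), i = i'.castSucc := ⟨⟨i, by omega⟩, rfl⟩
    obtain ⟨j, rfl⟩ : ∃ i' : Fin (n + 1), j = i'.castSucc := ⟨⟨j, by omega⟩, rfl⟩
    induction j' using Fin.lastCases with
    | last =>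
      have hjl : j = Fin.last n := by
        ext; simp at h2 ⊢; omega
      subst hjl
      simp only [appendLast_castSucc, appendLast_last, Fin.lt_def] at h3 h4 ⊢
      rw [succAbove_val] at h3 h4
      rw [succAbove_val]
      split_ifs at * <;> omega
    | cast j' =>
      simp only [appendLast_castSucc, succAbove_val_lt_iff, Fin.succAbove_lt_succAbove_iff]
        at h3 h4 ⊢
      exact ha i j j' h1 h2 h3 h4

open Classical in
/-- The active sites of `σ` not above its last value. -/
noncomputable def lowSites {n : ℕ} (σ : Perm (Fin (n + 1))) : Finset ℕ :=
  {g ∈ range (n + 2) | IsActive σ g ∧ g ≤ σ (Fin.last n)}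

open Classical in
/-- The active sites of `σ` above its last value. -/
noncomputable def highSites {n : ℕ} (σ : Perm (Fin (n + 1))) : Finset ℕ :=
  {g ∈ range (n + 2) | IsActive σ g ∧ (σ (Fin.last n) : ℕ) < g}

lemma card_lowSites_pos {n : ℕ} (σ : Perm (Fin (n + 1))) : 0 < #(lowSites σ) :=
  card_pos.2 ⟨0, by simp [lowSites, IsActive]⟩

lemma card_highSites_pos {n : ℕ} (σ : Perm (Fin (n + 1))) : 0 < #(highSites σ) :=
  card_pos.2 ⟨n + 1, by
    classical
    exact mem_filter.2 ⟨mem_range.2 (by omega), fun _ j _ _ _ _ _ => (σ j).2, (σ _).2⟩⟩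

lemma card_lowSites_appendLast {n : ℕ} (σ : Perm (Fin (n + 1))) {c : Fin (n + 2)}
    (hc : (c : ℕ) ∈ lowSites σ) :
    #(lowSites (appendLast σ c)) = #{g ∈ lowSites σ | g < (c : ℕ)} + 1 := by
  have : lowSites (appendLast σ c) = insert (c : ℕ) {g ∈ lowSites σ | g < (c : ℕ)} := by
    ext g
    simp only [lowSites, mem_filter, mem_range, mem_insert, isActive_appendLast,
      appendLast_last] at hc ⊢
    have := c.2
    constructor
    · rintro ⟨h1, ⟨h2, h3⟩, h4⟩
      rw [if_pos h4] at h2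
      rcases h4.eq_or_lt with h | h
      · exact Or.inl h
      · exact Or.inr ⟨⟨by omega, h2, by omega⟩, h⟩
    · rintro (rfl | ⟨⟨h1, h2, h3⟩, h4⟩)
      · simp [hc.2.1]; omega
      · rw [if_pos h4.le]
        exact ⟨by omega, ⟨h2, by omega⟩, by omega⟩
  rw [this, card_insert_of_notMem (by simp)]

lemma card_highSites_appendLast {n : ℕ} (σ : Perm (Fin (n + 1))) {c : Fin (n + 2)}
    (hc : (c : ℕ) ∈ lowSites σ) :
    #(highSites (appendLast σ c)) = #(highSites σ) + 1 := by
  have : highSites (appendLast σ c) =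
      insert ((c : ℕ) + 1) ((highSites σ).map (addRightEmbedding 1)) := by
    ext g
    simp only [lowSites, highSites, mem_filter, mem_range, mem_insert, isActive_appendLast,
      appendLast_last, mem_map, addRightEmbedding_apply] at hc ⊢
    have := c.2
    constructor
    · rintro ⟨h1, ⟨h2, h3⟩, h4⟩
      rw [if_neg (by omega)] at h2
      rcases h3 hc.2.2 with h | h
      · left; omega
      · exact Or.inr ⟨g - 1, ⟨by omega, h2, by omega⟩, by omega⟩
    · rintro (rfl | ⟨g, ⟨h1, h2, h3⟩, rfl⟩)
      · simp [hc.2.1]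
      · rw [if_neg (by omega)]
        exact ⟨by omega, ⟨h2, by omega⟩, by omega⟩
  rw [this, card_insert_of_notMem, card_map]
  simp only [lowSites, highSites, mem_filter, mem_range, mem_map, addRightEmbedding_apply] at hc ⊢
  rintro ⟨g, hg, h⟩
  omega

lemma card_lowSites_appendLast' {n : ℕ} (σ : Perm (Fin (n + 1))) {c : Fin (n + 2)}
    (hc : (c : ℕ) ∈ highSites σ) :
    #(lowSites (appendLast σ c)) = #(lowSites σ) + #{g ∈ highSites σ | g < (c : ℕ)} + 1 := by
  have : lowSites (appendLast σ c) =
      insert (c : ℕ) (lowSites σ ∪ {g ∈ highSites σ | g < (c : ℕ)}) := by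
    ext g
    simp only [lowSites, highSites, mem_filter, mem_range, mem_insert, isActive_appendLast,
      appendLast_last, mem_union] at hc ⊢
    have := c.2
    constructor
    · rintro ⟨h1, ⟨h2, h3⟩, h4⟩
      rw [if_pos h4] at h2
      rcases h4.eq_or_lt with h | h
      · exact Or.inl h
      · rcases le_or_gt g (σ (Fin.last n) : ℕ) with h' | h'
        · exact Or.inr (Or.inl ⟨by omega, h2, h'⟩)
        · exact Or.inr (Or.inr ⟨⟨by omega, h2, h'⟩, h⟩)
    · rintro (rfl | ⟨h1, h2, h3⟩ | ⟨⟨h1, h2, h3⟩, h4⟩)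
      · simp [hc.2.1]; omega
      · rw [if_pos (by omega)]
        exact ⟨by omega, ⟨h2, by omega⟩, by omega⟩
      · rw [if_pos (by omega)]
        exact ⟨by omega, ⟨h2, by omega⟩, by omega⟩
  rw [this, card_insert_of_notMem, card_union_of_disjoint]
  · rw [disjoint_left]
    intro g
    simp only [lowSites, highSites, mem_filter]
    omega
  · simp only [lowSites, highSites, mem_filter, mem_union] at hc ⊢
    rintro (h | h) <;> omega

lemma card_highSites_appendLast' {n : ℕ} (σ : Perm (Fin (n + 1))) {c : Fin (n + 2)}
    (hc : (c : ℕ) ∈ highSites σ) :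
    #(highSites (appendLast σ c)) + #{g ∈ highSites σ | g < (c : ℕ)} = #(highSites σ) := by
  have : highSites (appendLast σ c) =
      {g ∈ highSites σ | ¬ g < (c : ℕ)}.map (addRightEmbedding 1) := by
    ext g
    simp only [highSites, mem_filter, mem_range, isActive_appendLast,
      appendLast_last, mem_map, addRightEmbedding_apply] at hc ⊢
    have := c.2
    constructor
    · rintro ⟨h1, ⟨h2, h3⟩, h4⟩
      rw [if_neg (by omega)] at h2
      exact ⟨g - 1, ⟨⟨by omega, h2, by omega⟩, by omega⟩, by omega⟩
    · rintro ⟨g, ⟨⟨h1, h2, h3⟩, h4⟩, rfl⟩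
      rw [if_neg (by omega)]
      exact ⟨by omega, ⟨h2, by omega⟩, by omega⟩
  rw [this, card_map, add_comm, card_filter_add_card_filter_not]

lemma sum_card_filter_lt {A : Type*} [AddCommMonoid A] (s : Finset ℕ) (f : ℕ → A) :
    ∑ c ∈ s, f #{g ∈ s | g < (c : ℕ)} = ∑ i ∈ range #s, f i := by
  induction s using Finset.induction_on_max with
  | empty => simp
  | insert m s hm ih =>
    have hms : m ∉ s := fun h => lt_irrefl _ (hm m h)
    rw [sum_insert hms, card_insert_of_notMem hms, sum_range_succ, ← ih, add_comm]
    congr 1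
    · refine sum_congr rfl fun c hc => ?_
      rw [filter_insert, if_neg (hm c hc).not_gt]
    · rw [filter_insert, if_neg (lt_irrefl m), filter_true_of_mem hm]

open Classical in
/-- The generating polynomial of semi-Baxter permutations of size `n + 1` by numbers of low and
high sites (both lowered by one), evaluated at `(y, z)`. -/
noncomputable def sitePoly {A : Type*} [CommRing A] (n : ℕ) (y z : A) : A :=
  ∑ σ : Perm (Fin (n + 1)),
    if IsSemiBaxter σ then y ^ (#(lowSites σ) - 1) * z ^ (#(highSites σ) - 1) else 0

lemma sum_appendLast_active {A : Type*} [CommRing A] {n : ℕ} (σ : Perm (Fin (n + 1)))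
    (f : ℕ → ℕ → A) [DecidablePred fun c : Fin (n + 2) => IsActive σ c] :
    ∑ c : Fin (n + 2), (if IsActive σ c then
      f (#(lowSites (appendLast σ c)) - 1) (#(highSites (appendLast σ c)) - 1) else 0) =
    ∑ i ∈ range #(lowSites σ), f i #(highSites σ) +
      ∑ i ∈ range #(highSites σ), f (#(lowSites σ) + i) (#(highSites σ) - 1 - i) := by
  classical
  rw [← sum_card_filter_lt (lowSites σ) fun i => f i #(highSites σ),
    ← sum_card_filter_lt (highSites σ) fun i => f (#(lowSites σ) + i) (#(highSites σ) - 1 - i)]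
  have hl : ∀ F : ℕ → A, ∑ c ∈ lowSites σ, F c =
      ∑ c : Fin (n + 2), if (c : ℕ) ∈ lowSites σ then F c else 0 := by
    intro F
    rw [Fin.sum_univ_eq_sum_range (fun c => if c ∈ lowSites σ then F c else 0),
      ← sum_filter]
    congr 1; ext g; simp only [lowSites, mem_filter, mem_range]; tauto
  have hh : ∀ F : ℕ → A, ∑ c ∈ highSites σ, F c =
      ∑ c : Fin (n + 2), if (c : ℕ) ∈ highSites σ then F c else 0 := by
    intro F
    rw [Fin.sum_univ_eq_sum_range (fun c => if c ∈ highSites σ then F c else 0),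
      ← sum_filter]
    congr 1; ext g; simp only [highSites, mem_filter, mem_range]; tauto
  rw [hl, hh, ← sum_add_distrib]
  refine sum_congr rfl fun c _ => ?_
  have hc2 := c.2
  by_cases ha : IsActive σ c
  · rw [if_pos ha]
    rcases le_or_gt (c : ℕ) (σ (Fin.last n) : ℕ) with h | h
    · have h1 : (c : ℕ) ∈ lowSites σ := by simp [lowSites, ha, h]
      have h2 : (c : ℕ) ∉ highSites σ := by simp [highSites, h]
      rw [if_pos h1, if_neg h2, card_lowSites_appendLast σ h1, card_highSites_appendLast σ h1]
      simp
    · have h1 : (c : ℕ) ∉ lowSites σ := by simp [lowSites, h]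
      have h2 : (c : ℕ) ∈ highSites σ := by simp [highSites, ha, h]
      have h3 := card_highSites_appendLast' σ h2
      rw [if_pos h2, if_neg h1, card_lowSites_appendLast' σ h2, zero_add]
      congr 1
      omega
  · rw [if_neg ha, if_neg (by simp [lowSites, ha]), if_neg (by simp [highSites, ha]), add_zero]

lemma sitePoly_zero {A : Type*} [CommRing A] (y z : A) : sitePoly 0 y z = 1 := by
  have hs : ∀ σ : Perm (Fin 1), IsSemiBaxter σ := by
    rintro σ ⟨i, j, _, _, h, _⟩
    omega
  have hl : ∀ σ : Perm (Fin 1), #(lowSites σ) ≤ 1 := fun σ => by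
    have : lowSites σ ⊆ {0} := by
      intro g; simp only [lowSites, mem_filter, mem_singleton]; omega
    simpa using card_le_card this
  have hh : ∀ σ : Perm (Fin 1), #(highSites σ) ≤ 1 := fun σ => by
    have : highSites σ ⊆ {1} := by
      intro g; simp only [highSites, mem_filter, mem_singleton, mem_range]; omega
    simpa using card_le_card this
  simp [sitePoly, hs, Nat.sub_eq_zero_of_le (hl _), Nat.sub_eq_zero_of_le (hh _)]

/-- The functional equation of the generating tree of semi-Baxter permutations. -/
lemma sitePoly_succ {A : Type*} [CommRing A] (n : ℕ) (y z : A) :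
    (y - 1) * (z - y) * sitePoly (n + 1) y z =
      (z - 1) * (z * y) * sitePoly n y z - (z - y) * (z * sitePoly n 1 z) -
        (y - 1) * (y ^ 2 * sitePoly n y y) := by
  classical
  have key : sitePoly (n + 1) y z = ∑ σ : Perm (Fin (n + 1)), if IsSemiBaxter σ then
      (∑ i ∈ range #(lowSites σ), y ^ i * z ^ #(highSites σ) +
      ∑ i ∈ range #(highSites σ), y ^ (#(lowSites σ) + i) * z ^ (#(highSites σ) - 1 - i))
      else 0 := by
    rw [sitePoly, ← (appendLast_bijective (n + 1)).sum_comp, Fintype.sum_prod_type]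
    refine sum_congr rfl fun σ _ => ?_
    split_ifs with h
    · rw [← sum_appendLast_active σ fun i j => y ^ i * z ^ j]
      simp only [isSemiBaxter_appendLast, h, true_and]
    · simp [isSemiBaxter_appendLast, h]
  rw [key]
  simp only [sitePoly, mul_sum, ← sum_sub_distrib]
  refine sum_congr rfl fun σ _ => ?_
  split_ifs
  · obtain ⟨p, hp⟩ := Nat.exists_eq_succ_of_ne_zero (card_lowSites_pos σ).ne'
    obtain ⟨q, hq⟩ := Nat.exists_eq_succ_of_ne_zero (card_highSites_pos σ).ne'
    rw [hp, hq]
    simp only [Nat.succ_eq_add_one, Nat.add_sub_cancel, pow_add _ (p + 1), ← sum_mul, mul_assoc,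
      ← mul_sum]
    have h1 := geom_sum_mul y (p + 1)
    have h2 := (Commute.all y z).geom_sum₂_mul (q + 1)
    simp only [Nat.add_sub_cancel] at h2
    linear_combination (z - y) * z ^ (q + 1) * h1 - (y - 1) * y ^ (p + 1) * h2
  · ring

lemma map_sitePoly {A B : Type*} [CommRing A] [CommRing B] (f : A →+* B) (n : ℕ) (y z : A) :
    f (sitePoly n y z) = sitePoly n (f y) (f z) := by
  classical
  simp [sitePoly, map_sum, apply_ite f]

lemma sitePoly_one_one {A : Type*} [CommRing A] (n : ℕ) :
    sitePoly n (1 : A) 1 = semiBaxterCount (n + 1) := by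
  classical
  simp [sitePoly, semiBaxterCount, Nat.card_eq_fintype_card, Fintype.card_subtype]

/-- Iterating the functional equation on the curve where its kernel vanishes. -/
lemma kernel_sum {A : Type*} [CommRing A] (N : ℕ) {a w x y z : A} (hy : y = 1 + a)
    (hz : z = 1 + a + w) (hx : x * (z * y * (z - 1)) = a * w) :
    w * ∑ m ∈ range N, z * sitePoly m 1 z * x ^ (m + 1) +
      a * ∑ m ∈ range N, y ^ 2 * sitePoly m y y * x ^ (m + 1) =
    a * w * (1 - x ^ N * sitePoly N y z) := by
  induction N with
  | zero => simp [sitePoly_zero]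
  | succ N ih =>
    have h := sitePoly_succ N y z
    have hya : y - 1 = a := by rw [hy]; ring
    have hzw : z - y = w := by rw [hy, hz]; ring
    rw [hya, hzw] at h
    rw [sum_range_succ, sum_range_succ]
    linear_combination ih + x ^ (N + 1) * h + x ^ N * sitePoly N y z * hx

/-- Elimination along the orbit of `(a, 1 + a + W)` under the group of the kernel. -/
lemma orbit_elimination_field {L : Type*} [Field L] {a u W x R₀ R₁ R₂ Q₀ Q₁ Q₂ s₁ s₂ s₃ s₄ s₅ : L}
    (N : ℕ) (ha : a ≠ 0) (hu0 : u ≠ 0) (hW : W ≠ 0) (huW : u + W ≠ 0) (haW : a + W ≠ 0)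
    (hu : u = 1 + a) (hx : x = a * W * u⁻¹ * (u + W)⁻¹ * (a + W)⁻¹)
    (h₁ : W * R₀ + a * Q₀ = a * W * (1 - x ^ N * s₁))
    (h₂ : a * u⁻¹ * (u + W) * R₀ + W * u⁻¹ * Q₁ =
      W * u⁻¹ * (a * u⁻¹ * (u + W)) * (1 - x ^ N * s₂))
    (h₃ : W * a⁻¹ * u⁻¹ * R₁ + W * u⁻¹ * Q₁ = W * u⁻¹ * (W * a⁻¹ * u⁻¹) * (1 - x ^ N * s₃))
    (h₄ : W * (a + W) * a⁻¹ * (u + W)⁻¹ * R₁ + W * a⁻¹ * (u + W)⁻¹ * Q₂ =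
      W * a⁻¹ * (u + W)⁻¹ * (W * (a + W) * a⁻¹ * (u + W)⁻¹) * (1 - x ^ N * s₄))
    (h₅ : u * a⁻¹ * (u + W)⁻¹ * R₂ + W * a⁻¹ * (u + W)⁻¹ * Q₂ =
      W * a⁻¹ * (u + W)⁻¹ * (u * a⁻¹ * (u + W)⁻¹) * (1 - x ^ N * s₅)) :
    Q₀ + x * u ^ 2 * a⁻¹ ^ 4 * R₂ =
      x * (u ^ 2 + (a⁻¹ ^ 5 * u + 2 * u) * W +
        (-(a⁻¹ ^ 5 * u) + a⁻¹ ^ 3 - a⁻¹ ^ 2 * u + 1) * W ^ 2 + (a⁻¹ ^ 4 - a⁻¹ ^ 2) * W ^ 3) -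
      W * x ^ N * (s₁ - W * a⁻¹ * u⁻¹ * s₂ + W ^ 2 * u⁻¹ * a⁻¹ ^ 3 * (u + W)⁻¹ * s₃ -
        W ^ 2 * a⁻¹ ^ 4 * (u + W)⁻¹ ^ 2 * s₄ + x * u ^ 2 * a⁻¹ ^ 5 * (u + W)⁻¹ * s₅) := by
  generalize hX : x ^ N = y at *
  clear hX
  subst hx
  have key : Q₀ + (a * W * u⁻¹ * (u + W)⁻¹ * (a + W)⁻¹) * u ^ 2 * a⁻¹ ^ 4 * R₂ =
      W * (1 - y * s₁) - W ^ 2 * a⁻¹ * u⁻¹ * (1 - y * s₂) +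
      W ^ 3 * u⁻¹ * a⁻¹ ^ 3 * (u + W)⁻¹ * (1 - y * s₃) -
      W ^ 3 * a⁻¹ ^ 4 * (u + W)⁻¹ ^ 2 * (1 - y * s₄) +
      (a * W * u⁻¹ * (u + W)⁻¹ * (a + W)⁻¹) * u ^ 2 * W * a⁻¹ ^ 5 * (u + W)⁻¹ *
        (1 - y * s₅) := by
    have e₁ : Q₀ = W * (1 - y * s₁) - W * a⁻¹ * R₀ := by
      field_simp; linear_combination h₁
    have e₂ : R₀ = W * u⁻¹ * (1 - y * s₂) - W * a⁻¹ * (u + W)⁻¹ * Q₁ := by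
      field_simp at h₂ ⊢; linear_combination h₂
    have e₃ : Q₁ = W * a⁻¹ * u⁻¹ * (1 - y * s₃) - a⁻¹ * R₁ := by
      field_simp at h₃ ⊢; linear_combination h₃
    have e₄ : R₁ = W * a⁻¹ * (u + W)⁻¹ * (1 - y * s₄) - (a + W)⁻¹ * Q₂ := by
      field_simp at h₄ ⊢; linear_combination h₄
    have e₅ : Q₂ = u * a⁻¹ * (u + W)⁻¹ * (1 - y * s₅) - u * W⁻¹ * R₂ := by
      field_simp at h₅ ⊢; linear_combination h₅
    rw [e₁, e₂, e₃, e₄, e₅]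
    field_simp
    ring
  rw [key]
  subst hu
  field_simp
  ring

lemma orbit_elimination {A : Type*} [CommRing A] [IsDomain A]
    {a b u v W p q x R₀ R₁ R₂ Q₀ Q₁ Q₂ s₁ s₂ s₃ s₄ s₅ : A}
    (N : ℕ) (hb : a * b = 1) (hv : u * v = 1) (hW : W ≠ 0) (hp : (u + W) * p = 1)
    (hq : (a + W) * q = 1) (hu : u = 1 + a) (hx : x = a * W * v * p * q)
    (h₁ : W * R₀ + a * Q₀ = a * W * (1 - x ^ N * s₁))
    (h₂ : a * v * (u + W) * R₀ + W * v * Q₁ = W * v * (a * v * (u + W)) * (1 - x ^ N * s₂))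
    (h₃ : W * b * v * R₁ + W * v * Q₁ = W * v * (W * b * v) * (1 - x ^ N * s₃))
    (h₄ : W * (a + W) * b * p * R₁ + W * b * p * Q₂ =
      W * b * p * (W * (a + W) * b * p) * (1 - x ^ N * s₄))
    (h₅ : u * b * p * R₂ + W * b * p * Q₂ = W * b * p * (u * b * p) * (1 - x ^ N * s₅)) :
    Q₀ + x * u ^ 2 * b ^ 4 * R₂ =
      x * (u ^ 2 + (b ^ 5 * u + 2 * u) * W + (-(b ^ 5 * u) + b ^ 3 - b ^ 2 * u + 1) * W ^ 2 +
        (b ^ 4 - b ^ 2) * W ^ 3) -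
      W * x ^ N * (s₁ - W * b * v * s₂ + W ^ 2 * v * b ^ 3 * p * s₃ -
        W ^ 2 * b ^ 4 * p ^ 2 * s₄ + x * u ^ 2 * b ^ 5 * p * s₅) := by
  let f := algebraMap A (FractionRing A)
  have hf : Function.Injective f := IsFractionRing.injective A (FractionRing A)
  have inv : ∀ {c d : A}, c * d = 1 → f c ≠ 0 ∧ f d = (f c)⁻¹ := fun {c d} h => by
    have h' : f c * f d = 1 := by rw [← map_mul, h, map_one]
    exact ⟨left_ne_zero_of_mul_eq_one h', eq_inv_of_mul_eq_one_right h'⟩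
  obtain ⟨ha0, hb'⟩ := inv hb
  obtain ⟨hu0, hv'⟩ := inv hv
  obtain ⟨hp0, hp'⟩ := inv hp
  obtain ⟨hq0, hq'⟩ := inv hq
  have hW0 : f W ≠ 0 := fun h => hW (hf (by rw [h, map_zero]))
  rw [map_add] at hp0 hp' hq0 hq'
  apply hf
  replace hx := congrArg f hx
  replace h₁ := congrArg f h₁
  replace h₂ := congrArg f h₂
  replace h₃ := congrArg f h₃
  replace h₄ := congrArg f h₄
  replace h₅ := congrArg f h₅
  replace hu := congrArg f hu
  simp only [map_add, map_sub, map_mul, map_pow, map_neg, map_one, map_ofNat, hb', hv', hp', hq']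
    at hx h₁ h₂ h₃ h₄ h₅ hu ⊢
  exact orbit_elimination_field N ha0 hu0 hW0 hp0 hq0 hu hx h₁ h₂ h₃ h₄ h₅

open PowerSeries in
lemma coeff_derivative_mul_pow {k : Type*} [Field k] [CharZero k] {x φ : k⟦X⟧}
    (hx : x * φ = X) (hφ : constantCoeff φ ≠ 0) {m p : ℕ} (hm : m ≤ p) :
    coeff p (x ^ m * derivative k x * φ ^ (p + 1)) = if m = p then 1 else 0 := by
  obtain ⟨q, rfl⟩ := Nat.exists_eq_add_of_le hm
  have hd : x * derivative k φ + φ * derivative k x = 1 := by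
    have := congrArg (derivative k) hx
    simpa using this
  have e : x ^ m * derivative k x * φ ^ (m + q + 1) =
      X ^ m * (φ ^ q - x * derivative k φ * φ ^ q) := by
    rw [← hx]
    linear_combination x ^ m * φ ^ (m + q) * hd
  rw [e, add_comm m q, coeff_X_pow_mul]
  cases q with
  | zero =>
    have h0 : constantCoeff x = 0 := by
      have := congrArg constantCoeff hx
      simpa [hφ] using this
    simp [h0]
  | succ r =>
    have e2 : x * derivative k φ * φ ^ (r + 1) = X * (derivative k φ * φ ^ r) := by
      rw [← hx]; ring
    rw [e2, map_sub, coeff_succ_X_mul, if_neg (by omega)]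
    have h := coeff_derivative (φ ^ (r + 1)) r
    have hr : (r : k) + 1 ≠ 0 := Nat.cast_add_one_ne_zero r
    rw [PowerSeries.derivative_pow, Nat.add_sub_cancel, mul_assoc, ← nsmul_eq_mul, map_nsmul,
      nsmul_eq_mul] at h
    push_cast at h
    apply mul_left_cancel₀ hr
    rw [mul_comm (derivative k φ), mul_zero]
    linear_combination -h

open PowerSeries in
/-- Lagrange inversion for the compositional inverse of `x = X / φ`. -/
lemma lagrange_inversion {k : Type*} [Field k] [CharZero k] {x φ H : k⟦X⟧}
    (hx : x * φ = X) (hφ : constantCoeff φ ≠ 0) (p : ℕ) (c : ℕ → k)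
    (hH : X ^ (p + 2) ∣ ∑ m ∈ range (p + 2), C (c m) * x ^ m - H) :
    ((p : k) + 1) * c (p + 1) = coeff p (derivative k H * φ ^ (p + 1)) := by
  obtain ⟨E, hE⟩ := hH
  have hH : H = ∑ m ∈ range (p + 2), C (c m) * x ^ m - X ^ (p + 2) * E := by
    rw [← hE]; ring
  have hE0 : coeff p (derivative k (X ^ (p + 2) * E) * φ ^ (p + 1)) = 0 := by
    have : derivative k (X ^ (p + 2) * E) * φ ^ (p + 1) =
        X ^ (p + 1) * ((X * derivative k E + ((p : k⟦X⟧) + 2) * E) * φ ^ (p + 1)) := by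
      rw [Derivation.leibniz, Derivation.leibniz_pow]
      simp
      ring
    rw [this, coeff_X_pow_mul', if_neg (by omega)]
  have hs : derivative k (∑ m ∈ range (p + 2), C (c m) * x ^ m) * φ ^ (p + 1) =
      ∑ m ∈ range (p + 1), C (((m : k) + 1) * c (m + 1)) *
        (x ^ m * derivative k x * φ ^ (p + 1)) := by
    rw [sum_range_succ', map_add, map_sum]
    simp only [Derivation.leibniz, Derivation.leibniz_pow, smul_eq_mul, nsmul_eq_mul]
    simp [sum_mul]
    refine sum_congr rfl fun m _ => ?_
    ring
  rw [hH, map_sub, sub_mul, map_sub, hE0, hs, map_sum, sub_zero]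
  simp only [coeff_C_mul]
  rw [sum_congr rfl fun m hm => by
    rw [coeff_derivative_mul_pow hx hφ (Nat.lt_succ_iff.1 (mem_range.1 hm))]]
  simp

open PowerSeries in
lemma coeff_X_pow_mul_pow {k : Type*} [Field k] {a u : k} (ha : a ≠ 0) (e p : ℕ) :
    coeff p (X ^ e * (C (u * a⁻¹) * ((C u + X) * (C a + X))) ^ (p + 1)) =
      ∑ j ∈ range (p + 3), ((p + 1).choose j : k) * ((p + 1).choose (j + (e + 1)) *
        (u ^ (p + 1 + j + (e + 1)) * a⁻¹ ^ j)) := by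
  have hc : ∀ (b : k) (i : ℕ), coeff i ((C b + X) ^ (p + 1)) =
      b ^ (p + 1 - i) * (p + 1).choose i := by
    intro b i
    have := Polynomial.coeff_X_add_C_pow b (p + 1) i
    rw [← Polynomial.coeff_coe] at this
    rw [← this, add_comm]
    simp
  rw [coeff_X_pow_mul']
  split_ifs with h
  · obtain ⟨s, rfl⟩ := Nat.exists_eq_add_of_le h
    rw [mul_pow, ← map_pow, coeff_C_mul, mul_pow (C u + X), mul_comm ((C u + X) ^ _), coeff_mul,
      Nat.add_sub_cancel_left, Nat.sum_antidiagonal_eq_sum_range_succ_mk, mul_sum]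
    rw [← sum_subset (range_subset_range.2 (by omega : s + 1 ≤ e + s + 3))]
    · refine sum_congr rfl fun j hj => ?_
      have hj : j ≤ s := Nat.lt_succ_iff.1 (mem_range.1 hj)
      obtain ⟨t, rfl⟩ := Nat.exists_eq_add_of_le hj
      simp only [hc, Nat.add_sub_cancel_left]
      rw [← Nat.choose_symm (by omega : t ≤ e + (j + t) + 1),
        show e + (j + t) + 1 - t = j + (e + 1) by omega,
        show e + (j + t) + 1 - j = e + t + 1 by omega]
      have hat : a * a⁻¹ = 1 := mul_inv_cancel₀ ha
      have hat : a ^ (e + t + 1) * a⁻¹ ^ (e + t + 1) = 1 := by rw [← mul_pow, hat, one_pow]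
      linear_combination (((e + (j + t) + 1).choose j : k) * (e + (j + t) + 1).choose (j + (e + 1)) *
        u ^ (e + (j + t) + 1 + j + (e + 1)) * a⁻¹ ^ j) * hat
    · intro j _ hj
      rw [mem_range] at hj
      rw [Nat.choose_eq_zero_of_lt (by omega : e + s + 1 < j + (e + 1))]
      simp
  · symm
    refine sum_eq_zero fun j _ => ?_
    rw [Nat.choose_eq_zero_of_lt (by omega : p + 1 < j + (e + 1))]
    simp

open PowerSeries in
/-- The coefficient identity obtained by combining the kernel method and Lagrange inversion. -/
lemma kernel_coeff {k : Type*} [Field k] [CharZero k] {a u : k} (ha : a ≠ 0) (hu0 : u ≠ 0)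
    (hu : u = 1 + a) (p : ℕ) :
    ((p : k) + 1) * (u ^ 2 * sitePoly (p + 1) u u +
      u ^ 2 * a⁻¹ ^ 4 * ((1 + a⁻¹) * sitePoly p 1 (1 + a⁻¹))) =
    ∑ j ∈ range (p + 3), ((p + 1).choose j : k) *
      (((p + 1).choose (j + 1) : k) *
        (u ^ (p + j + 3) * a⁻¹ ^ (j + 5) + 2 * (u ^ (p + j + 3) * a⁻¹ ^ j)) +
      2 * ((p + 1).choose (j + 2) : k) *
        (-(u ^ (p + j + 4) * a⁻¹ ^ (j + 5)) + u ^ (p + j + 3) * a⁻¹ ^ (j + 3) -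
          u ^ (p + j + 4) * a⁻¹ ^ (j + 2) + u ^ (p + j + 3) * a⁻¹ ^ j) +
      3 * ((p + 1).choose (j + 3) : k) *
        (u ^ (p + j + 4) * a⁻¹ ^ (j + 4) - u ^ (p + j + 4) * a⁻¹ ^ (j + 2))) := by
  set b := a⁻¹ with hb
  have hab : a * b = 1 := mul_inv_cancel₀ ha
  have huv : u * u⁻¹ = 1 := mul_inv_cancel₀ hu0
  obtain ⟨P, hP⟩ : ∃ P : k⟦X⟧, (C u + X) * P = 1 :=
    ⟨(C u + X)⁻¹, PowerSeries.mul_inv_cancel _ (by simpa)⟩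
  obtain ⟨Q, hQ⟩ : ∃ Q : k⟦X⟧, (C a + X) * Q = 1 :=
    ⟨(C a + X)⁻¹, PowerSeries.mul_inv_cancel _ (by simpa)⟩
  have hCab : (C a : k⟦X⟧) * C b = 1 := by rw [← map_mul, hab, map_one]
  have hCuv : (C u : k⟦X⟧) * C u⁻¹ = 1 := by rw [← map_mul, huv, map_one]
  have hCu : (C u : k⟦X⟧) = 1 + C a := by rw [hu, map_add, map_one]
  obtain ⟨x, hx⟩ : ∃ x : k⟦X⟧, x = C a * X * C u⁻¹ * P * Q := ⟨_, rfl⟩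
  have hxX : X ∣ x := ⟨C a * C u⁻¹ * P * Q, by rw [hx]; ring⟩
  have hxφ : x * (C (u * b) * ((C u + X) * (C a + X))) = X := by
    rw [hx, map_mul]
    linear_combination X * C a * C b * C u * C u⁻¹ * (C u + X) * P * hQ +
      X * C a * C b * C u * C u⁻¹ * hP + X * C u * C u⁻¹ * hCab + X * hCuv
  have hx0 : x ≠ 0 := fun h => X_ne_zero (R := k) (by rw [← hxφ, h, zero_mul])
  have hxk : x * (C u * (C u + X) * (C a + X)) = C a * X := by
    rw [map_mul] at hxφ
    linear_combination C a * hxφ - x * C u * (C u + X) * (C a + X) * hCab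
  have hP' : P * (C u + X) = 1 := by rw [mul_comm, hP]
  have hy₁ : 1 + X * C u⁻¹ = C u⁻¹ * (C u + X) := by linear_combination -hCuv
  have hz₀ : C u + X - 1 = C a + X := by rw [hCu]; ring
  have hz₁ : 1 + X * C b = C b * (C a + X) := by linear_combination -hCab
  have hy₂ : 1 + X * C b * P = C b * P * C u * (C a + X) := by
    linear_combination -hP' - X * C b * P * hCu - P * (C u + X) * hCab
  have hz₂ : 1 + C b = C b * C u := by linear_combination -hCab - C b * hCu
  have E₁ := kernel_sum (p + 2) (a := C a) (w := X) (y := C u) (z := C u + X) (x := x) hCu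
    (by rw [hCu]) (by rw [← hxk, hCu]; ring)
  have E₂ := kernel_sum (p + 2) (a := X * C u⁻¹) (w := C a * C u⁻¹ * (C u + X))
    (y := 1 + X * C u⁻¹) (z := C u + X) (x := x) rfl
    (by linear_combination (1 + X * C u⁻¹) * hCu - (C a + X) * hCuv)
    (by
      rw [hz₀, hy₁]
      linear_combination C u⁻¹ ^ 2 * (C u + X) * hxk -
        x * C u⁻¹ * (C u + X) ^ 2 * (C a + X) * hCuv)
  have E₃ := kernel_sum (p + 2) (a := X * C u⁻¹) (w := X * C b * C u⁻¹)
    (y := 1 + X * C u⁻¹) (z := 1 + X * C b) (x := x) rfl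
    (by linear_combination X * C b * C u⁻¹ * hCu - X * C b * hCuv + X * C u⁻¹ * hCab)
    (by
      rw [add_sub_cancel_left, hy₁, hz₁]
      linear_combination C b ^ 2 * C u⁻¹ ^ 2 * X * hxk -
        x * C b ^ 2 * C u⁻¹ * X * (C a + X) * (C u + X) * hCuv +
        C b * C u⁻¹ ^ 2 * X ^ 2 * hCab)
  have E₄ := kernel_sum (p + 2) (a := X * C b * P) (w := X * (C a + X) * C b * P)
    (y := 1 + X * C b * P) (z := 1 + X * C b) (x := x) rfl
    (by linear_combination X * C b * P * hCu - X * C b * hP')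
    (by
      rw [add_sub_cancel_left, hy₂, hz₁]
      linear_combination C b ^ 3 * P ^ 2 * X * (C a + X) * hxk -
        x * C b ^ 3 * P * C u * X * (C a + X) ^ 2 * hP' +
        C b ^ 2 * P ^ 2 * X ^ 2 * (C a + X) * hCab)
  have E₅ := kernel_sum (p + 2) (a := X * C b * P) (w := C u * C b * P)
    (y := 1 + X * C b * P) (z := 1 + C b) (x := x) rfl
    (by linear_combination -C b * hP')
    (by
      rw [add_sub_cancel_left, hy₂, hz₂]
      linear_combination C b ^ 3 * P ^ 2 * C u * hxk -
        x * C b ^ 3 * P * C u ^ 2 * (C a + X) * hP' + C b ^ 2 * P ^ 2 * C u * X * hCab)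
  have key := orbit_elimination (p + 2) hCab hCuv X_ne_zero hP hQ hCu hx E₁ E₂ E₃ E₄ E₅
  generalize sitePoly (p + 2) (C u) (C u + X) - _ + _ - _ + _ = E at key
  set c : ℕ → k := fun m => u ^ 2 * sitePoly m u u +
    if m = 0 then 0 else u ^ 2 * b ^ 4 * ((1 + b) * sitePoly (m - 1) 1 (1 + b)) with hc
  set H : k⟦X⟧ := C (u ^ 2) + C (b ^ 5 * u + 2 * u) * X +
    C (-(b ^ 5 * u) + b ^ 3 - b ^ 2 * u + 1) * X ^ 2 + C (b ^ 4 - b ^ 2) * X ^ 3 with hH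
  have hsum : x * ∑ m ∈ range (p + 1 + 1), C (c m) * x ^ m =
      (∑ m ∈ range (p + 1 + 1), C u ^ 2 * sitePoly m (C u) (C u) * x ^ (m + 1)) +
      x * C u ^ 2 * C b ^ 4 *
        (∑ m ∈ range (p + 1 + 1), (1 + C b) * sitePoly m 1 (1 + C b) * x ^ (m + 1)) -
      x * (C u ^ 2 * C b ^ 4 * ((1 + C b) * sitePoly (p + 1) 1 (1 + C b)) * x ^ (p + 1 + 1)) := by
    have hc' : ∀ m, (C (c (m + 1)) : k⟦X⟧) = C u ^ 2 * sitePoly (m + 1) (C u) (C u) +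
        C u ^ 2 * C b ^ 4 * ((1 + C b) * sitePoly m 1 (1 + C b)) := by
      intro m
      simp [hc, map_sitePoly]
    have hc₀ : (C (c 0) : k⟦X⟧) = C u ^ 2 * sitePoly 0 (C u) (C u) := by
      simp [hc, map_sitePoly]
    generalize p + 1 = M
    induction M with
    | zero => simp [hc₀]; ring
    | succ M ih =>
      rw [sum_range_succ, mul_add, ih, hc', sum_range_succ _ (M + 1), sum_range_succ _ (M + 1)]
      ring
  have hdvd : X ^ (p + 2) ∣ ∑ m ∈ range (p + 2), C (c m) * x ^ m - H := by
    obtain ⟨y, hy⟩ := hxX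
    refine ⟨-(y ^ (p + 1) * E + C u ^ 2 * C b ^ 4 *
      ((1 + C b) * sitePoly (p + 1) 1 (1 + C b)) * y ^ (p + 2)), ?_⟩
    apply mul_left_cancel₀ hx0
    rw [mul_sub, hsum, key, hH]
    have h₁ : x ^ (p + 1) = X ^ (p + 1) * y ^ (p + 1) := by rw [hy, mul_pow]
    have h₂ : x ^ (p + 2) = X ^ (p + 2) * y ^ (p + 2) := by rw [hy, mul_pow]
    have h₃ : X * x ^ (p + 2) = x * (X ^ (p + 2) * y ^ (p + 1)) := by
      rw [pow_succ, h₁]; ring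
    rw [h₃, h₂]
    simp only [map_add, map_sub, map_neg, map_mul, map_pow, map_one, map_ofNat]
    ring
  have hφ0 : constantCoeff (C (u * b) * ((C u + X) * (C a + X))) ≠ 0 := by
    simp [hu0, ha, hb]
  have hL := lagrange_inversion hxφ hφ0 p c hdvd
  have hH' : derivative k H = C (b ^ 5 * u + 2 * u) * X ^ 0 +
      C (2 * (-(b ^ 5 * u) + b ^ 3 - b ^ 2 * u + 1)) * X ^ 1 +
      C (3 * (b ^ 4 - b ^ 2)) * X ^ 2 := by
    simp only [hH, map_add (derivative k), Derivation.leibniz, derivative_C, derivative_X,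
      PowerSeries.derivative_pow, smul_eq_mul, map_mul, map_ofNat]
    push_cast
    ring
  have hcp : c (p + 1) = u ^ 2 * sitePoly (p + 1) u u +
      u ^ 2 * b ^ 4 * ((1 + b) * sitePoly p 1 (1 + b)) := by simp [hc]
  rw [← hcp, hL, hH', add_mul, add_mul, map_add, map_add, mul_assoc, mul_assoc, mul_assoc,
    coeff_C_mul, coeff_C_mul, coeff_C_mul, hb, coeff_X_pow_mul_pow ha, coeff_X_pow_mul_pow ha,
    coeff_X_pow_mul_pow ha, mul_sum, mul_sum, mul_sum, ← sum_add_distrib, ← sum_add_distrib]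
  refine sum_congr rfl fun j _ => ?_
  ring

lemma coeff_zero_negative (P : Polynomial ℚ) {i : ℕ} (hi : i ≠ 0) :
    HahnSeries.coeff ((HahnSeries.single (-1 : ℤ) (1 : ℚ)) ^ i *
      Polynomial.eval₂ HahnSeries.C (HahnSeries.single (-1 : ℤ) (1 : ℚ)) P) 0 = 0 := by
  induction P using Polynomial.induction_on' with
  | add P Q hP hQ => rw [Polynomial.eval₂_add, mul_add, HahnSeries.coeff_add, hP, hQ, add_zero]
  | monomial n c =>
    rw [Polynomial.eval₂_monomial, mul_left_comm, ← pow_add, HahnSeries.single_pow,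
      HahnSeries.C_apply, HahnSeries.single_mul_single, HahnSeries.coeff_single_of_ne]
    simp
    omega

lemma coeff_zero_powerSeries_mul (f : PowerSeries ℚ) (r : ℕ) :
    HahnSeries.coeff (HahnSeries.ofPowerSeries ℤ ℚ f *
      (HahnSeries.single (-1 : ℤ) (1 : ℚ)) ^ r) 0 = PowerSeries.coeff r f := by
  rw [HahnSeries.single_pow]
  have := HahnSeries.coeff_mul_single_add (r := (1 : ℚ) ^ r)
    (x := HahnSeries.ofPowerSeries ℤ ℚ f) (a := (r : ℤ)) (b := r • (-1))
  simpa [HahnSeries.ofPowerSeries_apply_coeff] using this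

lemma coeff_one_add_X_pow (q r : ℕ) :
    PowerSeries.coeff r ((1 + PowerSeries.X : PowerSeries ℚ) ^ q) = q.choose r := by
  have := Polynomial.coeff_one_add_X_pow ℚ q r
  rw [← Polynomial.coeff_coe] at this
  rw [← this]
  simp

lemma semiBaxterCount_formula (p : ℕ) :
    ((p : ℚ) + 1) * semiBaxterCount (p + 2) =
    ∑ j ∈ range (p + 3), ((p + 1).choose j : ℚ) *
      (((p + 1).choose (j + 1) : ℚ) *
        ((p + j + 3).choose (j + 5) + 2 * (p + j + 3).choose j) +
      2 * ((p + 1).choose (j + 2) : ℚ) *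
        (-(p + j + 4).choose (j + 5) + (p + j + 3).choose (j + 3) -
          (p + j + 4).choose (j + 2) + (p + j + 3).choose j) +
      3 * ((p + 1).choose (j + 3) : ℚ) *
        ((p + j + 4).choose (j + 4) - (p + j + 4).choose (j + 2))) := by
  set α : HahnSeries ℤ ℚ := HahnSeries.single 1 1 with hα
  set β : HahnSeries ℤ ℚ := HahnSeries.single (-1) 1 with hβ
  set ι := HahnSeries.ofPowerSeries ℤ ℚ with hι
  have hαβ : α * β = 1 := by simp [hα, hβ]
  have hα0 : α ≠ 0 := left_ne_zero_of_mul_eq_one hαβ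
  have hinv : α⁻¹ = β := (eq_inv_of_mul_eq_one_right hαβ).symm
  have hια : ι (1 + PowerSeries.X) = 1 + α := by simp [hι, hα]
  have hu0 : 1 + α ≠ 0 := by
    rw [← hια, map_ne_zero_iff _ HahnSeries.ofPowerSeries_injective]
    intro h
    simpa using congrArg PowerSeries.constantCoeff h
  let c : HahnSeries ℤ ℚ →+ ℚ := HahnSeries.coeff.addMonoidHom 0
  have hc : ∀ f, c f = f.coeff 0 := fun _ => rfl
  have hcn : ∀ (m : ℕ) (f), c (m * f) = m * c f := fun m f => by
    rw [← nsmul_eq_mul, map_nsmul, nsmul_eq_mul]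
  have hc2 : ∀ f, c (2 * f) = 2 * c f := fun f => by simpa using hcn 2 f
  have hc3 : ∀ f, c (3 * f) = 3 * c f := fun f => by simpa using hcn 3 f
  have hterm : ∀ q r : ℕ, c ((1 + α) ^ q * β ^ r) = q.choose r := fun q r => by
    rw [← hια, ← map_pow, hc, coeff_zero_powerSeries_mul, coeff_one_add_X_pow]
  have : CharZero (HahnSeries ℤ ℚ) :=
    charZero_of_injective_ringHom (f := HahnSeries.C) HahnSeries.C_injective
  have h := congrArg c (kernel_coeff hα0 hu0 rfl p)
  have h₁ : c ((1 + α) ^ 2 * sitePoly (p + 1) (1 + α) (1 + α)) = semiBaxterCount (p + 2) := by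
    rw [← hια, ← map_sitePoly, ← map_pow, ← map_mul, hc, ← mul_one (ι _), ← pow_zero β,
      coeff_zero_powerSeries_mul, PowerSeries.coeff_zero_eq_constantCoeff_apply, map_mul,
      map_sitePoly]
    simp [sitePoly_one_one]
  have h₂ : c ((1 + α) ^ 2 * β ^ 4 * ((1 + β) * sitePoly p 1 (1 + β))) = 0 := by
    have e : (1 + α) ^ 2 * β ^ 4 * ((1 + β) * sitePoly p 1 (1 + β)) = β ^ 2 *
        Polynomial.eval₂RingHom HahnSeries.C β ((1 + Polynomial.X) ^ 3 *
          sitePoly p (1 : Polynomial ℚ) (1 + Polynomial.X)) := by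
      have : Polynomial.eval₂RingHom HahnSeries.C β
          (sitePoly p (1 : Polynomial ℚ) (1 + Polynomial.X)) =
          sitePoly p 1 (1 + β) := by
        have := map_sitePoly (Polynomial.eval₂RingHom HahnSeries.C β) p 1 (1 + Polynomial.X)
        simpa using this
      rw [map_mul, this]
      simp only [map_pow, map_add, map_one, Polynomial.coe_eval₂RingHom, Polynomial.eval₂_X]
      linear_combination β ^ 2 * (1 + β) * sitePoly p 1 (1 + β) * (α * β + 1 + 2 * β) * hαβ
    rw [e, hc, Polynomial.coe_eval₂RingHom, coeff_zero_negative _ two_ne_zero]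
  have hp : ((p : HahnSeries ℤ ℚ) + 1) = ((p + 1 : ℕ) : HahnSeries ℤ ℚ) := by push_cast; rfl
  rw [hinv, hp, hcn, map_add, h₁, h₂, map_sum, add_zero] at h
  push_cast at h
  rw [h]
  refine sum_congr rfl fun j _ => ?_
  simp only [hcn, hc2, hc3, mul_assoc, map_add, map_sub, map_neg, hterm]

end

/-- Corollary 3.15: the closed formula for the semi-Baxter numbers obtained
by Lagrange inversion. -/
theorem semiBaxter_lagrange_formula (n : ℕ) (hn : 2 ≤ n) :
    ((n : ℤ) - 1) * (semiBaxterCount n : ℤ) =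
      ∑ j ∈ Finset.range (n + 1),
        (Nat.choose (n - 1) j : ℤ) *
          ((Nat.choose (n - 1) (j + 1) : ℤ) *
              ((Nat.choose (n + j + 1) (j + 5) : ℤ) + 2 * (Nat.choose (n + j + 1) j : ℤ)) +
            2 * (Nat.choose (n - 1) (j + 2) : ℤ) *
              (-(Nat.choose (n + j + 2) (j + 5) : ℤ) + (Nat.choose (n + j + 1) (j + 3) : ℤ) -
                (Nat.choose (n + j + 2) (j + 2) : ℤ) + (Nat.choose (n + j + 1) j : ℤ)) +
            3 * (Nat.choose (n - 1) (j + 3) : ℤ) *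
              ((Nat.choose (n + j + 2) (j + 4) : ℤ) - (Nat.choose (n + j + 2) (j + 2) : ℤ))) := by
  obtain ⟨p, rfl⟩ := Nat.exists_eq_add_of_le' hn
  have h := semiBaxterCount_formula p
  rw [show p + 2 - 1 = p + 1 by omega]
  have e₁ : ∀ j, p + 2 + j + 1 = p + j + 3 := fun j => by ring
  have e₂ : ∀ j, p + 2 + j + 2 = p + j + 4 := fun j => by ring
  simp only [e₁, e₂]
  have e₃ : ((p + 2 : ℕ) : ℤ) - 1 = p + 1 := by push_cast; ring
  rw [e₃]
  exact_mod_cast h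
end

section
/- For n, h, k ≥ 1, let p(n,h,k) denote the number of plane permutations of size n with label (h,k). Then p(1,1,1) = 1 and p(1,h,k) = 0 for (h,k) ≠ (1,1), and for all n ≥ 1 and all h, k ≥ 1: p(n+1, h, k) = Σ_{h' ≥ h} p(n, h', k−1) + Σ_{m=1}^{h−1} p(n, m, h+k−1−m), where p(n, ·, 0) is interpreted as 0. (This is the recurrence on label counts encoded by the succession rule Ω_semi of Proposition 3.5, under which the label (h,k) produces the labels (1,k+1),…,(h,k+1) and (h+k,1),…,(h+1,k).) -/
/-- `f` contains the vincular pattern 2-14-3: there are positions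
`i < j` and `k > j+1` with `f j < f i < f k < f (j+1)`. -/
def Contains2143 {m : ℕ} (f : Fin m → Fin m) : Prop :=
  ∃ i j j' k : Fin m, (i : ℕ) < (j : ℕ) ∧ (j' : ℕ) = (j : ℕ) + 1 ∧ (j' : ℕ) < (k : ℕ) ∧
    f j < f i ∧ f i < f k ∧ f k < f j'

/-- A plane permutation avoids 2-14-3. -/
def IsPlane {n : ℕ} (π : Equiv.Perm (Fin n)) : Prop := ¬ Contains2143 ⇑π

/-- The local expansion `π · a` on the right of `π` (with 0-indexed values):
the last entry is `a`, and the entry at position `i < n` is `π i` if `π i < a`,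
and `π i + 1` otherwise. -/
def insertFun {n : ℕ} (π : Equiv.Perm (Fin n)) (a : Fin (n + 1)) :
    Fin (n + 1) → Fin (n + 1) := fun i =>
  if h : (i : ℕ) < n then
    (if ((π ⟨i, h⟩ : Fin n) : ℕ) < (a : ℕ)
      then ⟨((π ⟨i, h⟩ : Fin n) : ℕ), Nat.lt_succ_of_lt (π ⟨i, h⟩).isLt⟩
      else ⟨((π ⟨i, h⟩ : Fin n) : ℕ) + 1, Nat.succ_lt_succ (π ⟨i, h⟩).isLt⟩)
  else a

/-- Number of plane permutations of size `n` with label `(h, k)`, where `h`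
(resp. `k`) is the number of active sites strictly above (resp. weakly below)
the last entry. -/
noncomputable def planeLabelCount (n h k : ℕ) : ℕ :=
  Nat.card {π : Equiv.Perm (Fin n) // IsPlane π ∧
    ∃ hn : 0 < n,
      h = Nat.card {a : Fin (n + 1) // ¬ Contains2143 (insertFun π a) ∧
            ((π ⟨n - 1, Nat.sub_lt hn Nat.one_pos⟩ : Fin n) : ℕ) < (a : ℕ)} ∧
      k = Nat.card {a : Fin (n + 1) // ¬ Contains2143 (insertFun π a) ∧
            (a : ℕ) ≤ ((π ⟨n - 1, Nat.sub_lt hn Nat.one_pos⟩ : Fin n) : ℕ)}}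

lemma insertFun_castSucc {n : ℕ} (π : Equiv.Perm (Fin n)) (a : Fin (n + 1)) (i : Fin n) :
    (insertFun π a i.castSucc : ℕ) = if (π i : ℕ) < a then (π i : ℕ) else π i + 1 := by
  simp only [insertFun, Fin.val_castSucc, i.isLt, dite_true]
  split_ifs <;> rfl

lemma insertFun_last {n : ℕ} (π : Equiv.Perm (Fin n)) (a : Fin (n + 1)) :
    insertFun π a (Fin.last n) = a := by
  simp [insertFun]

lemma insertFun_injective {n : ℕ} (π : Equiv.Perm (Fin n)) (a : Fin (n + 1)) :
    Function.Injective (insertFun π a) := by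
  intro x y hxy
  have hval := congrArg Fin.val hxy
  induction x using Fin.lastCases with
  | last =>
    induction y using Fin.lastCases with
    | last => rfl
    | cast j =>
      rw [insertFun_last, insertFun_castSucc] at hval
      split_ifs at hval <;> omega
  | cast i =>
    induction y using Fin.lastCases with
    | last =>
      rw [insertFun_last, insertFun_castSucc] at hval
      split_ifs at hval <;> omega
    | cast j =>
      rw [insertFun_castSucc, insertFun_castSucc] at hval
      have : (π i : ℕ) = π j := by split_ifs at hval <;> omega
      rw [π.injective (Fin.ext this)]

/-- The permutation `π · a`. -/
noncomputable def insertPerm {n : ℕ} (π : Equiv.Perm (Fin n)) (a : Fin (n + 1)) :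
    Equiv.Perm (Fin (n + 1)) :=
  Equiv.ofBijective (insertFun π a) (Finite.injective_iff_bijective.1 (insertFun_injective π a))

@[simp] lemma coe_insertPerm {n : ℕ} (π : Equiv.Perm (Fin n)) (a : Fin (n + 1)) :
    ⇑(insertPerm π a) = insertFun π a := rfl

lemma insertPerm_bijective (n : ℕ) :
    Function.Bijective
      (fun p : Equiv.Perm (Fin n) × Fin (n + 1) => insertPerm p.1 p.2) := by
  rw [Fintype.bijective_iff_injective_and_card]
  constructor
  · rintro ⟨π, a⟩ ⟨ρ, b⟩ h
    have hf : insertFun π a = insertFun ρ b := congrArg (fun e : Equiv.Perm _ => ⇑e) h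
    have hab : a = b := by
      rw [← insertFun_last π a, hf, insertFun_last]
    subst hab
    have hπ : π = ρ := by
      ext i
      have hi := congrArg Fin.val (congrFun hf i.castSucc)
      rw [insertFun_castSucc, insertFun_castSucc] at hi
      split_ifs at hi <;> omega
    rw [hπ]
  · simp [Fintype.card_perm, Nat.factorial_succ, mul_comm]

/-- The site `a` of `π` lies inside the `14` of an occurrence of `2-14` in `π`, in such a way that
inserting `a` at the end completes an occurrence of `2-14-3`. -/
def Blocked {n : ℕ} (π : Equiv.Perm (Fin n)) (a : ℕ) : Prop :=
  ∃ i j j' : Fin n, (i : ℕ) < j ∧ (j' : ℕ) = j + 1 ∧ (π j : ℕ) < π i ∧ (π i : ℕ) < a ∧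
    a ≤ (π j' : ℕ)

lemma contains2143_insertFun {n : ℕ} (π : Equiv.Perm (Fin n)) (a : Fin (n + 1)) :
    Contains2143 (insertFun π a) ↔ Contains2143 ⇑π ∨ Blocked π a := by
  constructor
  · rintro ⟨i, j, j', k, hij, hj, hk, h₁, h₂, h₃⟩
    have hkn := k.isLt
    obtain ⟨i, rfl⟩ : ∃ x : Fin n, x.castSucc = i := ⟨⟨i, by omega⟩, rfl⟩
    obtain ⟨j, rfl⟩ : ∃ x : Fin n, x.castSucc = j := ⟨⟨j, by omega⟩, rfl⟩
    obtain ⟨j', rfl⟩ : ∃ x : Fin n, x.castSucc = j' := ⟨⟨j', by omega⟩, rfl⟩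
    simp only [Fin.val_castSucc] at hij hj hk
    rw [Fin.lt_def, insertFun_castSucc, insertFun_castSucc] at h₁
    induction k using Fin.lastCases with
    | last =>
      rw [Fin.lt_def, insertFun_castSucc, insertFun_last] at h₂ h₃
      right
      refine ⟨i, j, j', hij, hj, ?_⟩
      split_ifs at h₁ h₂ h₃ <;> omega
    | cast k =>
      rw [Fin.lt_def, insertFun_castSucc, insertFun_castSucc] at h₂ h₃
      left
      refine ⟨i, j, j', k, hij, hj, hk, ?_⟩
      simp only [Fin.lt_def]
      split_ifs at h₁ h₂ h₃ <;> omega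
  · rintro (⟨i, j, j', k, hij, hj, hk, h₁, h₂, h₃⟩ | ⟨i, j, j', hij, hj, h₁, h₂, h₃⟩)
    · refine ⟨i.castSucc, j.castSucc, j'.castSucc, k.castSucc, hij, hj, hk, ?_⟩
      simp only [Fin.lt_def, insertFun_castSucc] at h₁ h₂ h₃ ⊢
      split_ifs <;> omega
    · refine ⟨i.castSucc, j.castSucc, j'.castSucc, Fin.last n, hij, hj, j'.isLt, ?_⟩
      simp only [Fin.lt_def, insertFun_castSucc, insertFun_last] at h₁ h₂ h₃ ⊢
      split_ifs <;> omega

lemma isPlane_insertPerm {n : ℕ} (π : Equiv.Perm (Fin n)) (a : Fin (n + 1)) :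
    IsPlane (insertPerm π a) ↔ IsPlane π ∧ ¬ Blocked π a := by
  rw [IsPlane, coe_insertPerm, contains2143_insertFun, IsPlane, not_or]

lemma blocked_insertPerm {m : ℕ} (π : Equiv.Perm (Fin (m + 1))) (a : Fin (m + 2)) (b : ℕ) :
    Blocked (insertPerm π a) b ↔
      Blocked π (if b ≤ a then b else b - 1) ∨ ((π (Fin.last m) : ℕ) + 2 ≤ b ∧ b ≤ a) := by
  constructor
  · rintro ⟨i, j, j', hij, hj, h₁, h₂, h₃⟩
    have hjn := j'.isLt
    obtain ⟨i, rfl⟩ : ∃ x : Fin (m + 1), x.castSucc = i := ⟨⟨i, by omega⟩, rfl⟩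
    obtain ⟨j, rfl⟩ : ∃ x : Fin (m + 1), x.castSucc = j := ⟨⟨j, by omega⟩, rfl⟩
    simp only [Fin.val_castSucc] at hij hj
    rw [coe_insertPerm, insertFun_castSucc] at h₁ h₂
    rw [insertFun_castSucc] at h₁
    induction j' using Fin.lastCases with
    | last =>
      rw [coe_insertPerm, insertFun_last] at h₃
      have hlast : j = Fin.last m := Fin.ext (by simp at hj ⊢; omega)
      subst hlast
      right
      split_ifs at h₁ h₂ <;> omega
    | cast j' =>
      rw [coe_insertPerm, insertFun_castSucc] at h₃
      left
      refine ⟨i, j, j', hij, hj, ?_⟩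
      split_ifs at h₁ h₂ h₃ ⊢ <;> omega
  · rintro (⟨i, j, j', hij, hj, h₁, h₂, h₃⟩ | ⟨h₁, h₂⟩)
    · refine ⟨i.castSucc, j.castSucc, j'.castSucc, hij, hj, ?_⟩
      simp only [coe_insertPerm, insertFun_castSucc]
      split_ifs at h₂ h₃ ⊢ <;> omega
    · have ha := a.isLt
      obtain ⟨i, hi⟩ := π.surjective ⟨π (Fin.last m) + 1, by omega⟩
      have hi' : (π i : ℕ) = π (Fin.last m) + 1 := congrArg Fin.val hi
      have hne : (i : ℕ) ≠ m := by
        intro h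
        have : i = Fin.last m := Fin.ext h
        rw [this] at hi'
        omega
      refine ⟨i.castSucc, (Fin.last m).castSucc, Fin.last (m + 1), ?_, ?_, ?_⟩
      · simp only [Fin.val_castSucc, Fin.val_last]; omega
      · simp
      · simp only [coe_insertPerm, insertFun_castSucc, insertFun_last, hi']
        split_ifs <;> omega

lemma not_blocked_zero {n : ℕ} (π : Equiv.Perm (Fin n)) : ¬ Blocked π 0 := by
  rintro ⟨i, j, j', -, -, -, h, -⟩
  omega

lemma not_blocked_size {n : ℕ} (π : Equiv.Perm (Fin n)) : ¬ Blocked π n := by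
  rintro ⟨i, j, j', -, -, -, -, h⟩
  omega

lemma IsPlane.not_blocked_succ_last {m : ℕ} {π : Equiv.Perm (Fin (m + 1))} (hπ : IsPlane π) :
    ¬ Blocked π (π (Fin.last m) + 1) := by
  rintro ⟨i, j, j', hij, hj, h₁, h₂, h₃⟩
  have hi : (π i : ℕ) ≠ π (Fin.last m) := by
    intro h
    have := π.injective (Fin.ext h)
    subst this
    simp only [Fin.val_last] at hij
    omega
  have hj' : (j' : ℕ) ≠ m := by
    intro h
    have : j' = Fin.last m := Fin.ext h
    subst this
    omega
  refine hπ ⟨i, j, j', Fin.last m, hij, hj, ?_, ?_⟩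
  · simp only [Fin.val_last]; omega
  · simp only [Fin.lt_def]; omega

open Classical in
/-- The sites of `π` above its last entry that are not blocked. -/
noncomputable def upSites {m : ℕ} (π : Equiv.Perm (Fin (m + 1))) : Finset ℕ :=
  {a ∈ Finset.Icc ((π (Fin.last m) : ℕ) + 1) (m + 1) | ¬ Blocked π a}

open Classical in
/-- The sites of `π` weakly below its last entry that are not blocked. -/
noncomputable def downSites {m : ℕ} (π : Equiv.Perm (Fin (m + 1))) : Finset ℕ :=
  {a ∈ Finset.range ((π (Fin.last m) : ℕ) + 1) | ¬ Blocked π a}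

lemma mem_upSites {m : ℕ} {π : Equiv.Perm (Fin (m + 1))} {a : ℕ} :
    a ∈ upSites π ↔ ((π (Fin.last m) : ℕ) < a ∧ a ≤ m + 1) ∧ ¬ Blocked π a := by
  simp only [upSites, Finset.mem_filter, Finset.mem_Icc, Nat.add_one_le_iff]

lemma mem_downSites {m : ℕ} {π : Equiv.Perm (Fin (m + 1))} {a : ℕ} :
    a ∈ downSites π ↔ a ≤ (π (Fin.last m) : ℕ) ∧ ¬ Blocked π a := by
  simp [downSites]

lemma card_upSites_pos {m : ℕ} (π : Equiv.Perm (Fin (m + 1))) : 0 < (upSites π).card :=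
  Finset.card_pos.2 ⟨m + 1, mem_upSites.2 ⟨⟨(π (Fin.last m)).isLt, le_rfl⟩, not_blocked_size π⟩⟩

lemma card_downSites_pos {m : ℕ} (π : Equiv.Perm (Fin (m + 1))) : 0 < (downSites π).card :=
  Finset.card_pos.2 ⟨0, mem_downSites.2 ⟨Nat.zero_le _, not_blocked_zero π⟩⟩

lemma card_upSites_le {m : ℕ} (π : Equiv.Perm (Fin (m + 1))) : (upSites π).card ≤ m + 1 := by
  classical
  calc (upSites π).card ≤ (Finset.Icc ((π (Fin.last m) : ℕ) + 1) (m + 1)).card :=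
        Finset.card_filter_le _ _
    _ ≤ m + 1 := by simp

lemma natCard_eq_card_of_mem_iff {n : ℕ} {p : Fin n → Prop} {s : Finset ℕ}
    (hs : ∀ a ∈ s, a < n) (h : ∀ a : Fin n, p a ↔ (a : ℕ) ∈ s) :
    Nat.card {a : Fin n // p a} = s.card := by
  rw [← Nat.card_eq_finsetCard s]
  exact Nat.card_congr
    { toFun := fun a => ⟨a.1, (h a.1).1 a.2⟩
      invFun := fun a => ⟨⟨a.1, hs a.1 a.2⟩, (h _).2 a.2⟩
      left_inv := fun _ => rfl
      right_inv := fun _ => rfl }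

/-- The plane permutations of size `m + 1`. -/
noncomputable def planePerms (m : ℕ) : Finset (Equiv.Perm (Fin (m + 1))) :=
  open Classical in Finset.univ.filter IsPlane

lemma mem_planePerms {m : ℕ} {π : Equiv.Perm (Fin (m + 1))} : π ∈ planePerms m ↔ IsPlane π := by
  simp [planePerms]

lemma planeLabelCount_succ (m h k : ℕ) :
    planeLabelCount (m + 1) h k =
      ((planePerms m).filter fun π => (upSites π).card = h ∧ (downSites π).card = k).card := by
  rw [planeLabelCount, ← Nat.card_eq_finsetCard]
  refine Nat.card_congr (Equiv.subtypeEquivRight fun π => ?_)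
  rw [Finset.mem_filter, mem_planePerms]
  refine and_congr_right fun hπ => ?_
  have hlast : ∀ hn : m + 1 - 1 < m + 1, (⟨m + 1 - 1, hn⟩ : Fin (m + 1)) = Fin.last m :=
    fun _ => rfl
  have hu : Nat.card {a : Fin (m + 2) // ¬ Contains2143 (insertFun π a) ∧
      ((π (Fin.last m) : Fin (m + 1)) : ℕ) < (a : ℕ)} = (upSites π).card := by
    refine natCard_eq_card_of_mem_iff (fun a ha => ?_) fun a => ?_
    · have := (mem_upSites.1 ha).1.2
      omega
    · rw [contains2143_insertFun, mem_upSites, not_or]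
      have ha : (a : ℕ) ≤ m + 1 := by omega
      have : ¬ Contains2143 ⇑π := hπ
      tauto
  have hd : Nat.card {a : Fin (m + 2) // ¬ Contains2143 (insertFun π a) ∧
      (a : ℕ) ≤ ((π (Fin.last m) : Fin (m + 1)) : ℕ)} = (downSites π).card := by
    refine natCard_eq_card_of_mem_iff (fun a ha => ?_) fun a => ?_
    · have := (mem_downSites.1 ha).1
      omega
    · rw [contains2143_insertFun, mem_downSites, not_or]
      have : ¬ Contains2143 ⇑π := hπ
      tauto
  simp only [hlast, hu, hd]
  constructor
  · rintro ⟨-, h₁, h₂⟩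
    exact ⟨h₁.symm, h₂.symm⟩
  · rintro ⟨h₁, h₂⟩
    exact ⟨Nat.succ_pos m, h₁.symm, h₂.symm⟩

lemma card_upSites_insertPerm {m : ℕ} (π : Equiv.Perm (Fin (m + 1))) (a : Fin (m + 2)) :
    (upSites (insertPerm π a)).card =
      ((downSites π ∪ upSites π).filter ((a : ℕ) ≤ ·)).card := by
  rw [← Finset.card_map (s := (downSites π ∪ upSites π).filter _) (addRightEmbedding 1)]
  congr 1
  ext b
  simp only [mem_upSites, coe_insertPerm, insertFun_last, blocked_insertPerm, Finset.mem_map,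
    Finset.mem_filter, Finset.mem_union, mem_downSites, addRightEmbedding_apply]
  have hv := (π (Fin.last m)).isLt
  constructor
  · rintro ⟨⟨h₁, h₂⟩, h₃⟩
    rw [if_neg (by omega)] at h₃
    refine ⟨b - 1, ⟨?_, by omega⟩, by omega⟩
    rcases le_or_gt (b - 1) (π (Fin.last m) : ℕ) with h | h
    · exact Or.inl ⟨h, fun hb => h₃ (Or.inl hb)⟩
    · exact Or.inr ⟨⟨h, by omega⟩, fun hb => h₃ (Or.inl hb)⟩
  · rintro ⟨c, ⟨h, hc⟩, rfl⟩
    have hnb : ¬ Blocked π c := h.elim And.right And.right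
    have hcm : c ≤ m + 1 := h.elim (fun h => by omega) (fun h => h.1.2)
    refine ⟨⟨by omega, by omega⟩, ?_⟩
    rw [if_neg (by omega), Nat.add_sub_cancel]
    rintro (h | h)
    · exact hnb h
    · omega

lemma card_downSites_insertPerm_of_le {m : ℕ} (π : Equiv.Perm (Fin (m + 1))) (a : Fin (m + 2))
    (ha : (a : ℕ) ≤ π (Fin.last m)) :
    (downSites (insertPerm π a)).card = ((downSites π).filter (· ≤ (a : ℕ))).card := by
  congr 1
  ext b
  simp only [mem_downSites, coe_insertPerm, insertFun_last, blocked_insertPerm, Finset.mem_filter]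
  constructor
  · rintro ⟨h₁, h₂⟩
    rw [if_pos h₁] at h₂
    exact ⟨⟨by omega, fun h => h₂ (Or.inl h)⟩, h₁⟩
  · rintro ⟨⟨h₁, h₂⟩, h₃⟩
    rw [if_pos h₃]
    exact ⟨h₃, not_or.2 ⟨h₂, by omega⟩⟩

lemma card_downSites_insertPerm_of_lt {m : ℕ} {π : Equiv.Perm (Fin (m + 1))} (hπ : IsPlane π)
    (a : Fin (m + 2)) (ha : (π (Fin.last m) : ℕ) < a) :
    (downSites (insertPerm π a)).card = (downSites π).card + 1 := by
  have hnot : (π (Fin.last m) : ℕ) + 1 ∉ downSites π := fun h => by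
    have := (mem_downSites.1 h).1
    omega
  rw [← Finset.card_insert_of_notMem hnot]
  congr 1
  ext b
  simp only [mem_downSites, coe_insertPerm, insertFun_last, blocked_insertPerm, Finset.mem_insert]
  constructor
  · rintro ⟨h₁, h₂⟩
    rw [if_pos h₁, not_or] at h₂
    rcases Nat.lt_or_ge (π (Fin.last m) : ℕ) b with h | h
    · exact Or.inl (by omega)
    · exact Or.inr ⟨h, h₂.1⟩
  · rintro (rfl | ⟨h₁, h₂⟩)
    · rw [if_pos (by omega)]
      exact ⟨by omega, not_or.2 ⟨hπ.not_blocked_succ_last, by omega⟩⟩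
    · rw [if_pos (by omega)]
      exact ⟨by omega, not_or.2 ⟨h₂, by omega⟩⟩

lemma Finset.card_filter_card_filter_le_eq {α : Type*} [LinearOrder α] (s : Finset α) {k : ℕ}
    (hk : 1 ≤ k) :
    (s.filter fun a => (s.filter (· ≤ a)).card = k).card = if k ≤ s.card then 1 else 0 := by
  induction s using Finset.induction_on_max with
  | empty => simp; omega
  | insert x s hx ih =>
    have hxs : x ∉ s := fun h => lt_irrefl _ (hx x h)
    have hall : (insert x s).filter (· ≤ x) = insert x s :=
      Finset.filter_true_of_mem fun c hc => by
        rcases Finset.mem_insert.1 hc with rfl | hc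
        · exact le_rfl
        · exact (hx c hc).le
    have hold : (s.filter fun a => ((insert x s).filter (· ≤ a)).card = k) =
        s.filter fun a => (s.filter (· ≤ a)).card = k :=
      Finset.filter_congr fun a ha => by
        rw [Finset.filter_insert, if_neg (hx a ha).not_ge]
    rw [Finset.filter_insert, hall, hold, Finset.card_insert_of_notMem hxs]
    split_ifs with h₁ h₂ h₂
    · rw [Finset.card_insert_of_notMem (by simp [hxs]), ih, if_neg (by omega)]
    · omega
    · rw [ih, if_pos (by omega)]
    · rw [ih, if_neg (by omega)]

lemma Finset.card_filter_card_filter_ge_eq {α : Type*} [LinearOrder α] (s : Finset α) {k : ℕ}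
    (hk : 1 ≤ k) :
    (s.filter fun a => (s.filter (a ≤ ·)).card = k).card = if k ≤ s.card then 1 else 0 :=
  Finset.card_filter_card_filter_le_eq (α := αᵒᵈ) s hk

lemma Finset.card_filter_le_add_card_filter_ge {α : Type*} [LinearOrder α] {s : Finset α} {a : α}
    (ha : a ∈ s) : (s.filter (· ≤ a)).card + (s.filter (a ≤ ·)).card = s.card + 1 := by
  rw [← Finset.card_union_add_card_inter, ← Finset.filter_or, ← Finset.filter_and]
  simp only [le_total, Finset.filter_true, ← le_antisymm_iff, Finset.filter_eq', if_pos ha,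
    Finset.card_singleton]

lemma disjoint_downSites_upSites {m : ℕ} (π : Equiv.Perm (Fin (m + 1))) :
    Disjoint (downSites π) (upSites π) :=
  Finset.disjoint_left.2 fun a h₁ h₂ => by
    have := (mem_downSites.1 h₁).1
    have := (mem_upSites.1 h₂).1.1
    omega

lemma card_upSites_insertPerm_of_lt {m : ℕ} (π : Equiv.Perm (Fin (m + 1))) (a : Fin (m + 2))
    (ha : (π (Fin.last m) : ℕ) < a) :
    (upSites (insertPerm π a)).card = ((upSites π).filter ((a : ℕ) ≤ ·)).card := by
  rw [card_upSites_insertPerm, Finset.filter_union, Finset.filter_false_of_mem, Finset.empty_union]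
  intro c hc
  have := (mem_downSites.1 hc).1
  omega

lemma card_upSites_insertPerm_of_mem {m : ℕ} (π : Equiv.Perm (Fin (m + 1))) (a : Fin (m + 2))
    (ha : (a : ℕ) ∈ downSites π) :
    (upSites (insertPerm π a)).card + ((downSites π).filter (· ≤ (a : ℕ))).card =
      (upSites π).card + (downSites π).card + 1 := by
  have hup : (upSites π).filter ((a : ℕ) ≤ ·) = upSites π :=
    Finset.filter_true_of_mem fun c hc => by
      have := (mem_upSites.1 hc).1.1
      have := (mem_downSites.1 ha).1
      omega
  rw [card_upSites_insertPerm, Finset.filter_union, hup, Finset.card_union_of_disjoint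
    ((disjoint_downSites_upSites π).mono_left (Finset.filter_subset _ _))]
  have := Finset.card_filter_le_add_card_filter_ge ha
  omega

open Classical in
/-- The unblocked sites `a` of `π` for which `π · a` has label `(h, k)`. -/
noncomputable def childSites {m : ℕ} (π : Equiv.Perm (Fin (m + 1))) (h k : ℕ) :
    Finset (Fin (m + 2)) :=
  Finset.univ.filter fun a => ¬ Blocked π a ∧ (upSites (insertPerm π a)).card = h ∧
    (downSites (insertPerm π a)).card = k

lemma map_childSites {m : ℕ} {π : Equiv.Perm (Fin (m + 1))} (hπ : IsPlane π) (h k : ℕ) :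
    (childSites π h k).map Fin.valEmbedding =
      ((upSites π).filter fun a =>
        ((upSites π).filter (a ≤ ·)).card = h ∧ (downSites π).card + 1 = k) ∪
      (downSites π).filter fun a => ((downSites π).filter (· ≤ a)).card = k ∧
        (upSites π).card + (downSites π).card + 1 = h + k := by
  ext a
  simp only [childSites, Finset.mem_map, Finset.mem_filter, Finset.mem_univ, true_and,
    Fin.valEmbedding_apply, Finset.mem_union]
  constructor
  · rintro ⟨a, ⟨hb, hu, hd⟩, rfl⟩
    rcases Nat.lt_or_ge (π (Fin.last m) : ℕ) a with ha | ha
    · rw [card_upSites_insertPerm_of_lt π a ha] at hu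
      rw [card_downSites_insertPerm_of_lt hπ a ha] at hd
      exact Or.inl ⟨mem_upSites.2 ⟨⟨ha, by omega⟩, hb⟩, hu, hd⟩
    · have hmem := mem_downSites.2 ⟨ha, hb⟩
      have := card_upSites_insertPerm_of_mem π a hmem
      rw [card_downSites_insertPerm_of_le π a ha] at hd
      exact Or.inr ⟨hmem, hd, by omega⟩
  · rintro (⟨ha, hu, hd⟩ | ⟨ha, hd, hs⟩)
    · obtain ⟨⟨h₁, h₂⟩, h₃⟩ := mem_upSites.1 ha
      refine ⟨⟨a, by omega⟩, ⟨h₃, ?_, ?_⟩, rfl⟩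
      · rwa [card_upSites_insertPerm_of_lt _ _ h₁]
      · rwa [card_downSites_insertPerm_of_lt hπ _ h₁]
    · obtain ⟨h₁, h₂⟩ := mem_downSites.1 ha
      have ham : a < m + 2 := by omega
      have hsum := card_upSites_insertPerm_of_mem π ⟨a, ham⟩ ha
      have hdown := card_downSites_insertPerm_of_le π ⟨a, ham⟩ h₁
      simp only at hsum hdown
      exact ⟨⟨a, ham⟩, ⟨h₂, by omega, by omega⟩, rfl⟩

lemma card_childSites {m : ℕ} {π : Equiv.Perm (Fin (m + 1))} (hπ : IsPlane π) {h k : ℕ}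
    (hh : 1 ≤ h) (hk : 1 ≤ k) :
    (childSites π h k).card =
      (if h ≤ (upSites π).card ∧ (downSites π).card + 1 = k then 1 else 0) +
        if (upSites π).card < h ∧ (upSites π).card + (downSites π).card + 1 = h + k
          then 1 else 0 := by
  rw [← Finset.card_map Fin.valEmbedding, map_childSites hπ, Finset.card_union_of_disjoint
    ((disjoint_downSites_upSites π).symm.mono (Finset.filter_subset _ _)
      (Finset.filter_subset _ _))]
  congr 1
  · by_cases hd : (downSites π).card + 1 = k
    · simp only [hd, and_true, Finset.card_filter_card_filter_ge_eq _ hh]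
    · simp [hd]
  · by_cases hs : (upSites π).card + (downSites π).card + 1 = h + k
    · have : k ≤ (downSites π).card ↔ (upSites π).card < h := by omega
      simp only [hs, and_true, Finset.card_filter_card_filter_le_eq _ hk, this]
    · simp [hs]

lemma planeLabelCount_eq_sum_card_childSites (m h k : ℕ) :
    planeLabelCount (m + 2) h k = ∑ π ∈ planePerms m, (childSites π h k).card := by
  rw [planeLabelCount_succ, ← Finset.card_sigma]
  symm
  refine Finset.card_bij (fun p _ => insertPerm p.1 p.2) ?_ ?_ ?_
  · rintro ⟨π, a⟩ hp
    simp only [Finset.mem_sigma, mem_planePerms, childSites, Finset.mem_filter, Finset.mem_univ,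
      true_and] at hp
    rw [Finset.mem_filter, mem_planePerms, isPlane_insertPerm]
    exact ⟨⟨hp.1, hp.2.1⟩, hp.2.2⟩
  · rintro ⟨π, a⟩ - ⟨ρ, b⟩ - hab
    have := (insertPerm_bijective (m + 1)).injective (a₁ := (π, a)) (a₂ := (ρ, b)) hab
    rw [Prod.mk.injEq] at this
    rw [this.1, this.2]
  · intro ρ hρ
    obtain ⟨⟨π, a⟩, rfl⟩ := (insertPerm_bijective (m + 1)).surjective ρ
    rw [Finset.mem_filter, mem_planePerms, isPlane_insertPerm] at hρ
    refine ⟨⟨π, a⟩, ?_, rfl⟩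
    simp only [Finset.mem_sigma, mem_planePerms, childSites, Finset.mem_filter, Finset.mem_univ,
      true_and]
    exact ⟨hρ.1.1, hρ.1.2, hρ.2⟩

lemma card_filter_le_card_upSites (m h : ℕ) {k : ℕ} (hk : 1 ≤ k) :
    ((planePerms m).filter fun π =>
        h ≤ (upSites π).card ∧ (downSites π).card + 1 = k).card =
      ∑' h' : ℕ, if h ≤ h' then planeLabelCount (m + 1) h' (k - 1) else 0 := by
  rw [tsum_eq_sum (s := Finset.range (m + 2)), Finset.card_eq_sum_card_fiberwise
    (f := fun π => (upSites π).card) (t := Finset.range (m + 2))]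
  · refine Finset.sum_congr rfl fun h' _ => ?_
    rw [Finset.filter_filter, planeLabelCount_succ]
    split_ifs with hh
    · congr 1
      refine Finset.filter_congr fun π _ => ?_
      omega
    · rw [Finset.card_eq_zero]
      refine Finset.filter_false_of_mem fun π _ => ?_
      omega
  · intro π _
    have := card_upSites_le π
    simp only [Finset.coe_range, Set.mem_Iio]
    omega
  · intro h' hh'
    rw [Finset.mem_range] at hh'
    rw [planeLabelCount_succ, Finset.card_eq_zero.2, ite_self]
    refine Finset.filter_false_of_mem fun π _ => ?_
    have := card_upSites_le π
    omega

lemma card_filter_card_upSites_lt (m h k : ℕ) :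
    ((planePerms m).filter fun π =>
        (upSites π).card < h ∧ (upSites π).card + (downSites π).card + 1 = h + k).card =
      ∑ l ∈ Finset.Ico 1 h, planeLabelCount (m + 1) l (h + k - 1 - l) := by
  rw [Finset.card_eq_sum_card_fiberwise (f := fun π => (upSites π).card) (t := Finset.Ico 1 h)]
  · refine Finset.sum_congr rfl fun l hl => ?_
    rw [Finset.mem_Ico] at hl
    rw [Finset.filter_filter, planeLabelCount_succ]
    congr 1
    refine Finset.filter_congr fun π _ => ?_
    omega
  · intro π hπ
    rw [Finset.mem_coe, Finset.mem_filter] at hπ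
    have := card_upSites_pos π
    simp only [Finset.coe_Ico, Set.mem_Ico]
    omega

lemma planeLabelCount_one (h k : ℕ) :
    planeLabelCount 1 h k = if h = 1 ∧ k = 1 then 1 else 0 := by
  have hplane : planePerms 0 = {1} := by
    ext π
    rw [mem_planePerms, Finset.mem_singleton]
    refine iff_of_true ?_ (Equiv.ext fun i => Fin.ext (by omega))
    rintro ⟨i, j, j', k, hij, -⟩
    omega
  have hu : (upSites (1 : Equiv.Perm (Fin 1))).card = 1 :=
    le_antisymm (card_upSites_le _) (card_upSites_pos _)
  have hd : (downSites (1 : Equiv.Perm (Fin 1))).card = 1 := by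
    refine le_antisymm ?_ (card_downSites_pos _)
    classical
    exact (Finset.card_filter_le _ _).trans (by simp)
  rw [planeLabelCount_succ, hplane, Finset.filter_singleton, hu, hd]
  split_ifs <;> first | rfl | omega

/-- The recurrence on label counts encoded by the succession rule `Ω_semi`
(Proposition 3.5) for plane permutations. -/
theorem plane_omega_semi :
    planeLabelCount 1 1 1 = 1 ∧
    (∀ h k : ℕ, 1 ≤ h → 1 ≤ k → (h, k) ≠ (1, 1) → planeLabelCount 1 h k = 0) ∧
    (∀ n h k : ℕ, 1 ≤ n → 1 ≤ h → 1 ≤ k →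
      planeLabelCount (n + 1) h k =
        (∑' h' : ℕ, if h ≤ h' then planeLabelCount n h' (k - 1) else 0) +
          ∑ m ∈ Finset.Ico 1 h, planeLabelCount n m (h + k - 1 - m)) := by
  refine ⟨by simp [planeLabelCount_one], fun h k _ _ hne => ?_, fun n h k hn hh hk => ?_⟩
  · rw [planeLabelCount_one, if_neg]
    rintro ⟨rfl, rfl⟩
    exact hne rfl
  · obtain ⟨m, rfl⟩ := Nat.exists_eq_add_of_le' hn
    rw [planeLabelCount_eq_sum_card_childSites,
      Finset.sum_congr rfl fun π hπ => card_childSites (mem_planePerms.1 hπ) hh hk,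
      Finset.sum_add_distrib, ← Finset.card_filter, ← Finset.card_filter,
      card_filter_le_card_upSites m h hk, card_filter_card_upSites_lt]
end
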